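/- For all integers r and t with 2 ≤ t < r, the limit of n^{-t} f^{(r)}(n; 3r-2t, 3) as n tends to infinity exists and equals 2 / (t! · (2·C(r,t) − 1)), where C(r,t) denotes the binomial coefficient r choose t. -/

import Mathlib

open Finset Filter

/-- An `r`-graph is `(s,k)`-free if it has no `k` distinct edges spanning at most `s` vertices. -/
def IsFree {V : Type*} [DecidableEq V] (G : Finset (Finset V)) (s k : ℕ) : Prop :=
  ¬ ∃ S ⊆ G, S.card = k ∧ (S.sup id).card ≤ s

/-- `exNum r n s k` is the maximum number of edges of an `(s,k)`-free `r`-uniform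
hypergraph on `n` vertices, i.e. `f^{(r)}(n; s, k)`. -/
noncomputable def exNum (r n s k : ℕ) : ℕ :=
  sSup {m : ℕ | ∃ G : Finset (Finset (Fin n)),
    (∀ e ∈ G, e.card = r) ∧ IsFree G s k ∧ G.card = m}

section Clash

variable {α β : Type*} [DecidableEq α] [DecidableEq β]

/-- Three sets overlap so much that `#a + #b + #c - #(a ∪ b ∪ c) ≥ 2 * t`. -/
def Clash (t : ℕ) (a b c : Finset α) : Prop :=
  2 * t ≤ #(a ∩ b) + #(c ∩ (a ∪ b))

theorem clash_card (a b c : Finset α) :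
    #(a ∩ b) + #(c ∩ (a ∪ b)) + #(a ∪ b ∪ c) = #a + #b + #c := by
  have h1 := card_union_add_card_inter a b
  have h2 := card_union_add_card_inter (a ∪ b) c
  rw [inter_comm (a ∪ b) c] at h2
  omega

theorem clash_iff (t : ℕ) (a b c : Finset α) :
    Clash t a b c ↔ 2 * t + #(a ∪ b ∪ c) ≤ #a + #b + #c := by
  have := clash_card a b c
  unfold Clash
  omega

theorem Clash.swap {t : ℕ} {a b c : Finset α} (h : Clash t a b c) : Clash t b a c := by
  rw [clash_iff] at *
  rw [union_comm b a]; omega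

theorem Clash.rotate {t : ℕ} {a b c : Finset α} (h : Clash t a b c) : Clash t b c a := by
  rw [clash_iff] at *
  rw [union_comm (b ∪ c) a, ← union_assoc]; omega

theorem Clash.mono {t : ℕ} {a b c a' b' c' : Finset α} (h : Clash t a b c)
    (ha : a ⊆ a') (hb : b ⊆ b') (hc : c ⊆ c') : Clash t a' b' c' :=
  le_trans h (add_le_add (card_le_card (inter_subset_inter ha hb))
    (card_le_card (inter_subset_inter hc (union_subset_union ha hb))))

theorem not_clash_of_card {t : ℕ} {a b c : Finset α} (h1 : #(a ∩ b) ≤ t)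
    (h2 : #(c ∩ (a ∪ b)) < t) : ¬ Clash t a b c := by
  unfold Clash; omega

theorem not_clash_of_card' {t : ℕ} {a b c : Finset α} (h1 : #(a ∩ b) < t)
    (h2 : #(c ∩ (a ∪ b)) ≤ t) : ¬ Clash t a b c := by
  unfold Clash; omega

theorem Clash.image {t : ℕ} {a b c : Finset α} (h : Clash t a b c) (φ : α → β)
    (ha : Set.InjOn φ a) (hc : Set.InjOn φ c) :
    Clash t (a.image φ) (b.image φ) (c.image φ) := by
  refine le_trans h (add_le_add ?_ ?_)
  · rw [← card_image_of_injOn (ha.mono (s₁ := ((a ∩ b : Finset α) : Set α)) (by simp))]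
    exact card_le_card (image_inter_subset _ _ _)
  · rw [← card_image_of_injOn (hc.mono (s₁ := ((c ∩ (a ∪ b) : Finset α) : Set α)) (by simp))]
    rw [← image_union]
    exact card_le_card (image_inter_subset _ _ _)

theorem clash_map {t : ℕ} {a b c : Finset α} (φ : α ↪ β) :
    Clash t (a.map φ) (b.map φ) (c.map φ) ↔ Clash t a b c := by
  simp only [Clash, ← map_inter, ← map_union, card_map]

end Clash

section Packing

variable {m : ℕ} {V : Type*} [DecidableEq V]

/-- A family `P` of embedded copies of the `r`-graph `E` together with a family `Z` of `t`-sets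
that contains the non-covered `t`-sets of all copies and is disjoint from the covered ones, such
that edges of different copies share fewer than `t` vertices and no three edges from three
different copies clash. -/
structure IsPacking (t : ℕ) (E : Finset (Finset (Fin m))) (P : Finset (Fin m ↪ V))
    (Z : Finset (Finset V)) : Prop where
  card_eq : ∀ Q ∈ Z, #Q = t
  edge_notMem : ∀ f ∈ P, ∀ e ∈ E, ∀ T ⊆ e, #T = t → T.map f ∉ Z
  nonedge_mem : ∀ f ∈ P, ∀ T : Finset (Fin m), #T = t → (∀ e ∈ E, ¬ T ⊆ e) → T.map f ∈ Z
  inter_lt : ∀ f ∈ P, ∀ g ∈ P, f ≠ g → ∀ e ∈ E, ∀ e' ∈ E, #(e.map f ∩ e'.map g) < t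
  not_clash : ∀ f ∈ P, ∀ g ∈ P, ∀ h ∈ P, f ≠ g → f ≠ h → g ≠ h → ∀ e₁ ∈ E, ∀ e₂ ∈ E, ∀ e₃ ∈ E,
    ¬ Clash t (e₁.map f) (e₂.map g) (e₃.map h)

theorem exists_map_eq_of_subset_map {α β : Type*} {s : Finset α} {f : α ↪ β}
    {Q : Finset β} (h : Q ⊆ s.map f) : ∃ T ⊆ s, Q = T.map f := by
  classical
  obtain ⟨T, hT, rfl⟩ := subset_map_iff.1 h
  exact ⟨T, hT, rfl⟩

/-- An edge of one copy meets the vertex set of another copy in fewer than `t` vertices. -/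
theorem IsPacking.inter_range_lt {t : ℕ} {E : Finset (Finset (Fin m))} {P : Finset (Fin m ↪ V)}
    {Z : Finset (Finset V)} (hP : IsPacking t E P Z) {f g : Fin m ↪ V} (hf : f ∈ P) (hg : g ∈ P)
    (hfg : f ≠ g) {e : Finset (Fin m)} (he : e ∈ E) : #(e.map g ∩ univ.map f) < t := by
  by_contra! hcon
  obtain ⟨Q, hQ, hQc⟩ := exists_subset_card_eq hcon
  obtain ⟨T, -, rfl⟩ := exists_map_eq_of_subset_map (hQ.trans inter_subset_right)
  obtain ⟨T', hT', h'⟩ := exists_map_eq_of_subset_map (hQ.trans inter_subset_left)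
  rw [card_map] at hQc
  have hT'c : #T' = t := by rw [← hQc, ← card_map g, ← h', card_map]
  by_cases hE : ∃ e' ∈ E, T ⊆ e'
  · obtain ⟨e', he', hTe⟩ := hE
    have := hP.inter_lt f hf g hg hfg e' he' e he
    have h2 : T.map f ⊆ e'.map f ∩ e.map g :=
      subset_inter (map_subset_map.2 hTe) (hQ.trans inter_subset_left)
    have := card_le_card h2
    rw [card_map] at this
    omega
  · push Not at hE
    have h1 := hP.nonedge_mem f hf T hQc hE
    rw [h'] at h1
    exact hP.edge_notMem g hg e he T' hT' hT'c h1

end Packing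

section Code

variable {U V X : Type*} [Fintype V] [DecidableEq V] [DecidableEq X]

/-- The embedding of a set into its product with `X` as the graph of a function. -/
def graphEmb {V X : Type*} (φ : V → X) : V ↪ V × X :=
    ⟨fun v => (v, φ v), fun _ _ h => (Prod.ext_iff.1 h).1⟩

@[simp] theorem graphEmb_apply {V X : Type*} (φ : V → X) (v : V) : graphEmb φ v = (v, φ v) := rfl

/-- The graph of a function as a finite set. -/
def graph (φ : V → X) : Finset (V × X) := univ.map (graphEmb φ)

@[simp] theorem mem_graph {φ : V → X} {p : V × X} : p ∈ graph φ ↔ φ p.1 = p.2 := by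
  simp [graph, Prod.ext_iff]

theorem map_graphEmb_subset (φ : V → X) (s : Finset V) : s.map (graphEmb φ) ⊆ graph φ :=
  map_subset_map.2 (subset_univ s)

theorem graph_inter_graph (φ ψ : V → X) :
    graph φ ∩ graph ψ = ({v | φ v = ψ v} : Finset V).map (graphEmb φ) := by
  ext ⟨v, x⟩
  simp only [mem_inter, mem_graph, Finset.mem_map, mem_filter, mem_univ, true_and, graphEmb_apply,
    Prod.mk.injEq]
  constructor
  · rintro ⟨h1, h2⟩
    exact ⟨v, h1.trans h2.symm, rfl, h1⟩
  · rintro ⟨w, h1, rfl, h2⟩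
    exact ⟨h2, h1 ▸ h2⟩

theorem card_graph_inter_graph (φ ψ : V → X) :
    #(graph φ ∩ graph ψ) = #{v | φ v = ψ v} := by
  rw [graph_inter_graph, card_map]

/-- Any two codewords agree in fewer than `t` places, and the graphs of no three codewords
clash. -/
structure IsCode (t : ℕ) (c : U → V → X) : Prop where
  mds : ∀ u u', u ≠ u' → #{v | c u v = c u' v} < t
  not_clash : ∀ u v w, u ≠ v → u ≠ w → v ≠ w → ¬ Clash t (graph (c u)) (graph (c v)) (graph (c w))

theorem IsCode.graph_inter_lt {t : ℕ} {c : U → V → X} (hc : IsCode t c) {u u' : U} (h : u ≠ u') :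
    #(graph (c u) ∩ graph (c u')) < t := by
  rw [card_graph_inter_graph]; exact hc.mds u u' h

theorem IsCode.eq_of_subset {t : ℕ} {c : U → V → X} (hc : IsCode t c) {u u' : U}
    {A : Finset V} (hA : t ≤ #A) (h : ∀ v ∈ A, c u v = c u' v) : u = u' := by
  by_contra hne
  have h1 := hc.mds u u' hne
  have : #A ≤ #{v | c u v = c u' v} := card_le_card fun v hv => by simpa using h v hv
  omega

/-- Every prescription of values on a `t`-set is attained by a codeword if there are `#X ^ t`
codewords. -/
theorem IsCode.exists_eq [Fintype U] [Fintype X] {t : ℕ} {c : U → V → X} (hc : IsCode t c)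
    (hU : Fintype.card U = Fintype.card X ^ t) {A : Finset V} (hA : #A = t) (y : V → X) :
    ∃ u, ∀ v ∈ A, c u v = y v := by
  let φ : U → (A → X) := fun u v => c u v
  have hinj : Function.Injective φ := fun u u' h =>
    hc.eq_of_subset hA.ge fun v hv => congrFun h ⟨v, hv⟩
  have hbij : Function.Bijective φ := by
    rw [Fintype.bijective_iff_injective_and_card]
    exact ⟨hinj, by simp [hU, hA]⟩
  obtain ⟨u, hu⟩ := hbij.2 fun v => y v
  exact ⟨u, fun v hv => congrFun hu ⟨v, hv⟩⟩

/-- The product of two codes. -/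
def prodCode {U₁ U₂ V X₁ X₂ : Type*} (c₁ : U₁ → V → X₁) (c₂ : U₂ → V → X₂) :
    U₁ × U₂ → V → X₁ × X₂ := fun u v => (c₁ u.1 v, c₂ u.2 v)

theorem Clash.of_agree {Y : Type*} [DecidableEq Y] {t : ℕ} {φ₁ φ₂ φ₃ : V → X}
    {ψ₁ ψ₂ ψ₃ : V → Y} (h : Clash t (graph φ₁) (graph φ₂) (graph φ₃)) (π : X → Y)
    (h1 : ∀ v, ψ₁ v = π (φ₁ v)) (h2 : ∀ v, ψ₂ v = π (φ₂ v)) (h3 : ∀ v, ψ₃ v = π (φ₃ v)) :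
    Clash t (graph ψ₁) (graph ψ₂) (graph ψ₃) := by
  have key : ∀ (φ : V → X) (ψ : V → Y), (∀ v, ψ v = π (φ v)) →
      (graph φ).image (fun p => (p.1, π p.2)) ⊆ graph ψ := by
    intro φ ψ h p hp
    obtain ⟨⟨v, x⟩, hq, rfl⟩ := mem_image.1 hp
    simp only [mem_graph] at hq ⊢
    rw [h, hq]
  have inj : ∀ φ : V → X, Set.InjOn (fun p : V × X => (p.1, π p.2)) (graph φ) := by
    rintro φ ⟨v, x⟩ hp ⟨w, y⟩ hq hpq
    simp only [mem_coe, mem_graph, Prod.mk.injEq] at hp hq hpq ⊢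
    obtain ⟨rfl, -⟩ := hpq
    exact ⟨rfl, hp.symm.trans hq⟩
  exact (h.image _ (inj _) (inj _)).mono (key _ _ h1) (key _ _ h2) (key _ _ h3)

theorem IsCode.prod {U₁ U₂ X₁ X₂ : Type*} [DecidableEq X₁] [DecidableEq X₂] {t : ℕ}
    {c₁ : U₁ → V → X₁} {c₂ : U₂ → V → X₂} (h₁ : IsCode t c₁) (h₂ : IsCode t c₂) :
    IsCode t (prodCode c₁ c₂) := by
  have mds : ∀ u u', u ≠ u' → #{v | prodCode c₁ c₂ u v = prodCode c₁ c₂ u' v} < t := by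
    intro u u' h
    by_cases h1 : u.1 = u'.1
    · have h2 : u.2 ≠ u'.2 := fun h2 => h (Prod.ext h1 h2)
      refine (card_le_card fun v hv => ?_).trans_lt (h₂.mds _ _ h2)
      simp only [prodCode, Prod.mk.injEq, mem_filter, mem_univ, true_and] at hv ⊢
      exact hv.2
    · refine (card_le_card fun v hv => ?_).trans_lt (h₁.mds _ _ h1)
      simp only [prodCode, Prod.mk.injEq, mem_filter, mem_univ, true_and] at hv ⊢
      exact hv.1
  have two : ∀ u v w : U₁ × U₂, u ≠ v → u ≠ w → v ≠ w → u.1 = v.1 → v.2 = w.2 →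
      ¬ Clash t (graph (prodCode c₁ c₂ u)) (graph (prodCode c₁ c₂ v))
        (graph (prodCode c₁ c₂ w)) := by
    intro u v w huv huw hvw h1 h2
    have hsub : graph (prodCode c₁ c₂ w) ∩ graph (prodCode c₁ c₂ u) ⊆
        graph (prodCode c₁ c₂ w) ∩ graph (prodCode c₁ c₂ v) := by
      rintro ⟨x, y⟩ hp
      simp only [mem_inter, mem_graph, prodCode] at hp ⊢
      refine ⟨hp.1, ?_⟩
      rw [← hp.1, h2, ← h1]
      exact Prod.ext ((Prod.ext_iff.1 (hp.2.trans hp.1.symm)).1) rfl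
    refine not_clash_of_card ?_ ?_
    · rw [card_graph_inter_graph]; exact (mds u v huv).le
    · rw [inter_union_distrib_left, union_eq_right.2 hsub, card_graph_inter_graph]
      exact mds w v hvw.symm
  refine ⟨mds, fun u v w huv huw hvw hcl => ?_⟩
  by_cases d1 : u.1 ≠ v.1 ∧ u.1 ≠ w.1 ∧ v.1 ≠ w.1
  · exact h₁.not_clash _ _ _ d1.1 d1.2.1 d1.2.2
      (hcl.of_agree Prod.fst (fun _ => rfl) (fun _ => rfl) (fun _ => rfl))
  by_cases d2 : u.2 ≠ v.2 ∧ u.2 ≠ w.2 ∧ v.2 ≠ w.2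
  · exact h₂.not_clash _ _ _ d2.1 d2.2.1 d2.2.2
      (hcl.of_agree Prod.snd (fun _ => rfl) (fun _ => rfl) (fun _ => rfl))
  have e1 : u.1 = v.1 → u.2 ≠ v.2 := fun h h' => huv (Prod.ext h h')
  have e2 : u.1 = w.1 → u.2 ≠ w.2 := fun h h' => huw (Prod.ext h h')
  have e3 : v.1 = w.1 → v.2 ≠ w.2 := fun h h' => hvw (Prod.ext h h')
  have hvu := huv.symm
  have hwu := huw.symm
  have hwv := hvw.symm
  by_cases a1 : u.1 = v.1
  · by_cases b : v.2 = w.2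
    · exact two u v w huv huw hvw a1 b hcl
    · have b' : u.2 = w.2 := by have := e1 a1; tauto
      exact two v u w hvu hvw huw a1.symm b' hcl.swap
  by_cases a2 : u.1 = w.1
  · by_cases b : u.2 = v.2
    · exact two w u v hwu hwv huv a2.symm b hcl.rotate.rotate
    · have b' : v.2 = w.2 := by have := e2 a2; tauto
      exact two u w v huw huv hwv a2 b'.symm hcl.rotate.rotate.swap
  have a3 : v.1 = w.1 := by tauto
  by_cases b : u.2 = v.2
  · exact two w v u hwv hwu hvu a3.symm b.symm hcl.rotate.swap
  · have b' : u.2 = w.2 := by have := e3 a3; tauto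
    exact two v w u hvw hvu hwu a3 b'.symm hcl.rotate

end Code

section HasCode

/-- There is a code with `M ^ t` codewords over an alphabet of size `M`, with coordinates
indexed by `V`. -/
def HasCode (t : ℕ) (V : Type) [Fintype V] [DecidableEq V] (M : ℕ) : Prop :=
  ∃ (U X : Type) (_ : Fintype U) (_ : Fintype X) (_ : DecidableEq X),
    Fintype.card X = M ∧ Fintype.card U = M ^ t ∧ ∃ c : U → V → X, IsCode t c

variable {t : ℕ} {V : Type} [Fintype V] [DecidableEq V]

theorem hasCode_one : HasCode t V 1 :=
  ⟨Unit, Unit, inferInstance, inferInstance, inferInstance, by simp, by simp, fun _ _ => (),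
    fun u u' h => absurd (Subsingleton.elim u u') h,
    fun u u' _ h => absurd (Subsingleton.elim u u') h⟩

theorem HasCode.mul {M N : ℕ} (h₁ : HasCode t V M) (h₂ : HasCode t V N) :
    HasCode t V (M * N) := by
  obtain ⟨U₁, X₁, _, _, _, hX₁, hU₁, c₁, hc₁⟩ := h₁
  obtain ⟨U₂, X₂, _, _, _, hX₂, hU₂, c₂, hc₂⟩ := h₂
  exact ⟨U₁ × U₂, X₁ × X₂, inferInstance, inferInstance, inferInstance, by simp [hX₁, hX₂],
    by simp [hU₁, hU₂, mul_pow], prodCode c₁ c₂, hc₁.prod hc₂⟩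

theorem hasCode_of_prime_factors {B : ℕ} (hB : ∀ p, p.Prime → B ≤ p → HasCode t V p) (M : ℕ)
    (hM : M ≠ 0) (h : ∀ p, p.Prime → p ∣ M → B ≤ p) : HasCode t V M := by
  induction M using Nat.recOnMul with
  | zero => exact absurd rfl hM
  | one => exact hasCode_one
  | prime p hp => exact hB p hp (h p hp dvd_rfl)
  | mul a b ha hb =>
    rw [mul_ne_zero_iff] at hM
    exact (ha hM.1 fun p hp hd => h p hp (hd.mul_right b)).mul
      (hb hM.2 fun p hp hd => h p hp (hd.mul_left a))

end HasCode

section Blowup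

variable {m : ℕ} {U V X : Type*} [Fintype U] [Fintype V] [DecidableEq V] [DecidableEq X]

/-- The embedding of the vertex set into its blowup along a codeword, after a permutation. -/
def blowEmb (c : U → V → X) (σ : U → Equiv.Perm V) (u : U) : V ↪ V × X :=
  (σ u).toEmbedding.trans (graphEmb (c u))

@[simp] theorem blowEmb_apply (c : U → V → X) (σ : U → Equiv.Perm V) (u : U) (v : V) :
    blowEmb c σ u v = (σ u v, c u (σ u v)) := rfl

theorem map_blowEmb_subset (c : U → V → X) (σ : U → Equiv.Perm V) (u : U) (s : Finset V) :
    s.map (blowEmb c σ u) ⊆ graph (c u) := by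
  intro p hp
  obtain ⟨v, -, rfl⟩ := Finset.mem_map.1 hp
  simp

open Classical in
/-- The copies in the blowup of a packing. -/
noncomputable def blowP (c : U → V → X) (σ : U → Equiv.Perm V) (P : Finset (Fin m ↪ V)) :
    Finset (Fin m ↪ V × X) :=
  (univ ×ˢ P).image fun p => p.2.trans (blowEmb c σ p.1)

/-- The `t`-sets that must not be covered by the blowup of a packing. -/
def blowZ (c : U → V → X) (σ : U → Equiv.Perm V) (Z : Finset (Finset V)) :
    Finset (Finset (V × X)) :=
  (univ ×ˢ Z).image fun p => p.2.map (blowEmb c σ p.1)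

variable {c : U → V → X} {σ : U → Equiv.Perm V} {P : Finset (Fin m ↪ V)} {Z : Finset (Finset V)}

theorem mem_blowP {f : Fin m ↪ V × X} :
    f ∈ blowP c σ P ↔ ∃ u, ∃ g ∈ P, g.trans (blowEmb c σ u) = f := by
  simp [blowP]

theorem mem_blowZ {Q : Finset (V × X)} :
    Q ∈ blowZ c σ Z ↔ ∃ u, ∃ R ∈ Z, R.map (blowEmb c σ u) = Q := by
  simp [blowZ]

theorem IsCode.eq_of_map_subset {t : ℕ} (hc : IsCode t c) {u u' : U} {Q : Finset (V × X)}
    (hQ : t ≤ #Q) (h : Q ⊆ graph (c u)) (h' : Q ⊆ graph (c u')) : u = u' := by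
  by_contra hne
  have := hc.graph_inter_lt hne
  have := card_le_card (subset_inter h h')
  omega

theorem card_blowP {t : ℕ} (hc : IsCode t c) (htm : t ≤ m) :
    #(blowP c σ P) = Fintype.card U * #P := by
  classical
  rw [blowP, card_image_of_injective, card_product, card_univ]
  rintro ⟨u, f⟩ ⟨u', f'⟩ h
  have h : f.trans (blowEmb c σ u) = f'.trans (blowEmb c σ u') := h
  have hu : u = u' := by
    refine hc.eq_of_map_subset (Q := univ.map (f.trans (blowEmb c σ u))) (by simpa) ?_ ?_
    · rw [← Finset.map_map]; exact map_blowEmb_subset _ _ _ _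
    · rw [h, ← Finset.map_map]; exact map_blowEmb_subset _ _ _ _
  subst hu
  refine Prod.ext rfl ?_
  ext i
  exact (blowEmb c σ u).injective (DFunLike.congr_fun h i)

theorem card_blowZ {t : ℕ} (hc : IsCode t c) (hZ : ∀ Q ∈ Z, #Q = t) :
    #(blowZ c σ Z) = Fintype.card U * #Z := by
  classical
  rw [blowZ, card_image_of_injOn, card_product, card_univ]
  rintro ⟨u, Q⟩ hQ ⟨u', Q'⟩ hQ' h
  have h : Q.map (blowEmb c σ u) = Q'.map (blowEmb c σ u') := h
  simp only [coe_product, Set.mem_prod, mem_coe] at hQ hQ'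
  have hu : u = u' := by
    refine hc.eq_of_map_subset (Q := Q.map (blowEmb c σ u)) (by simp [hZ Q hQ.2])
      (map_blowEmb_subset _ _ _ _) ?_
    rw [h]; exact map_blowEmb_subset _ _ _ _
  subst hu
  exact Prod.ext rfl (map_injective _ h)

theorem map_trans_subset_graph (u : U) (f : Fin m ↪ V) (e : Finset (Fin m)) :
    e.map (f.trans (blowEmb c σ u)) ⊆ graph (c u) := by
  rw [← Finset.map_map]; exact map_blowEmb_subset _ _ _ _

theorem IsPacking.blow {t : ℕ} {E : Finset (Finset (Fin m))} (hP : IsPacking t E P Z)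
    (hc : IsCode t c) : IsPacking t E (blowP c σ P) (blowZ c σ Z) := by
  have two : ∀ u w, u ≠ w → ∀ f ∈ P, ∀ g ∈ P, f ≠ g → ∀ h : Fin m ↪ V, ∀ e₁ ∈ E, ∀ e₂ ∈ E,
      ∀ e₃ : Finset (Fin m), ¬ Clash t (e₁.map (f.trans (blowEmb c σ u)))
          (e₂.map (g.trans (blowEmb c σ u)))
        (e₃.map (h.trans (blowEmb c σ w))) := by
    intro u w huw f hf g hg hfg h e₁ h₁ e₂ h₂ e₃
    refine not_clash_of_card ?_ ?_
    · rw [← Finset.map_map, ← Finset.map_map, ← map_inter, card_map]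
      exact (hP.inter_lt f hf g hg hfg e₁ h₁ e₂ h₂).le
    · refine (card_le_card (inter_subset_inter (map_trans_subset_graph w h e₃)
        (union_subset (map_trans_subset_graph u f e₁) (map_trans_subset_graph u g e₂)))).trans_lt
        (hc.graph_inter_lt huw.symm)
  constructor
  · intro Q hQ
    obtain ⟨u, R, hR, rfl⟩ := mem_blowZ.1 hQ
    rw [card_map, hP.card_eq R hR]
  · intro f hf e he T hT hTc hmem
    obtain ⟨u, g, hg, rfl⟩ := mem_blowP.1 hf
    obtain ⟨u', R, hR, h⟩ := mem_blowZ.1 hmem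
    have hu : u' = u := by
      refine hc.eq_of_map_subset (Q := R.map (blowEmb c σ u')) (by simp [hP.card_eq R hR])
        (map_blowEmb_subset _ _ _ _) ?_
      rw [h]; exact map_trans_subset_graph _ _ _
    subst hu
    rw [← Finset.map_map] at h
    exact hP.edge_notMem g hg e he T hT hTc (map_injective _ h ▸ hR)
  · intro f hf T hT hE
    obtain ⟨u, g, hg, rfl⟩ := mem_blowP.1 hf
    exact mem_blowZ.2 ⟨u, T.map g, hP.nonedge_mem g hg T hT hE, by rw [Finset.map_map]⟩
  · intro f hf f' hf' hne e he e' he'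
    obtain ⟨u, g, hg, rfl⟩ := mem_blowP.1 hf
    obtain ⟨u', g', hg', rfl⟩ := mem_blowP.1 hf'
    by_cases hu : u = u'
    · subst hu
      rw [← Finset.map_map, ← Finset.map_map, ← map_inter, card_map]
      exact hP.inter_lt g hg g' hg' (fun h => hne (by rw [h])) e he e' he'
    · exact (card_le_card (inter_subset_inter (map_trans_subset_graph _ _ _)
        (map_trans_subset_graph _ _ _))).trans_lt (hc.graph_inter_lt hu)
  · intro f₁ hf₁ f₂ hf₂ f₃ hf₃ h12 h13 h23 e₁ he₁ e₂ he₂ e₃ he₃ hcl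
    obtain ⟨u₁, g₁, hg₁, rfl⟩ := mem_blowP.1 hf₁
    obtain ⟨u₂, g₂, hg₂, rfl⟩ := mem_blowP.1 hf₂
    obtain ⟨u₃, g₃, hg₃, rfl⟩ := mem_blowP.1 hf₃
    by_cases a : u₁ = u₂
    · subst a
      have n12 : g₁ ≠ g₂ := fun h => h12 (by rw [h])
      by_cases b : u₁ = u₃
      · subst b
        rw [← Finset.map_map, ← Finset.map_map, ← Finset.map_map, clash_map] at hcl
        exact hP.not_clash g₁ hg₁ g₂ hg₂ g₃ hg₃ n12 (fun h => h13 (by rw [h]))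
          (fun h => h23 (by rw [h])) e₁ he₁ e₂ he₂ e₃ he₃ hcl
      · exact two _ _ b g₁ hg₁ g₂ hg₂ n12 g₃ e₁ he₁ e₂ he₂ e₃ hcl
    · by_cases b : u₁ = u₃
      · subst b
        exact two _ _ a g₁ hg₁ g₃ hg₃ (fun h => h13 (by rw [h])) g₂ e₁ he₁ e₃ he₃ e₂
          hcl.swap.rotate
      · by_cases b' : u₂ = u₃
        · subst b'
          exact two _ _ (Ne.symm a) g₂ hg₂ g₃ hg₃ (fun h => h23 (by rw [h])) g₁ e₂ he₂ e₃ he₃ e₁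
            hcl.rotate
        · exact hc.not_clash _ _ _ a b b' (hcl.mono (map_trans_subset_graph _ _ _)
            (map_trans_subset_graph _ _ _) (map_trans_subset_graph _ _ _))

end Blowup

section LinearCode

variable {q : ℕ} [Fact q.Prime] {t : ℕ} {V : Type*} [Fintype V] [DecidableEq V]

/-- The linear code whose coordinates are given by the linear forms `g v`. -/
def linCode (g : V → Fin t → ZMod q) : (Fin t → ZMod q) → V → ZMod q := fun u v => g v ⬝ᵥ u

theorem linCode_sub (g : V → Fin t → ZMod q) (u w : Fin t → ZMod q) (v : V) :
    linCode g (u - w) v = linCode g u v - linCode g w v := by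
  simp [linCode, dotProduct_sub]

theorem card_fiber_mul {G H : Type*} [AddCommGroup G] [AddCommGroup H] [Fintype G] [Fintype H]
    [DecidableEq H] (φ : G →+ H) (hφ : Function.Surjective φ) (s : H) :
    #{y | φ y = s} * Fintype.card H = Fintype.card G := by
  have h := card_eq_sum_card_fiberwise (s := (univ : Finset G)) (t := (univ : Finset H)) (f := φ)
    (by simp)
  rw [card_univ] at h
  rw [h, sum_const_nat (m := #{y | φ y = s}), card_univ, mul_comm]
  intro x _
  exact AddMonoidHom.card_fiber_eq_of_mem_range φ (hφ x) (hφ s)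

theorem card_dotProduct_eq {d : Fin t → ZMod q} (hd : d ≠ 0) (s : ZMod q) :
    #{y : Fin t → ZMod q | y ⬝ᵥ d = s} * q = q ^ t := by
  obtain ⟨k, hk⟩ := Function.ne_iff.1 hd
  let φ : (Fin t → ZMod q) →+ ZMod q :=
    { toFun := fun y => y ⬝ᵥ d
      map_zero' := by simp
      map_add' := by simp [add_dotProduct] }
  have h := card_fiber_mul φ (fun s => ⟨Pi.single k (s / d k), by
    simp only [φ, AddMonoidHom.coe_mk, ZeroHom.coe_mk, single_dotProduct]
    exact div_mul_cancel₀ s hk⟩) s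
  simpa [φ, ZMod.card] using h

theorem card_dotProduct_eq_zero₂ {d d' : Fin t → ZMod q} (hd : d ≠ 0) (hd' : ∀ l : ZMod q,
    d' ≠ l • d) :
    #{y : Fin t → ZMod q | y ⬝ᵥ d = 0 ∧ y ⬝ᵥ d' = 0} * q ^ 2 = q ^ t := by
  obtain ⟨k, hk⟩ := Function.ne_iff.1 hd
  simp only [Pi.zero_apply] at hk
  obtain ⟨l, hl⟩ := Function.ne_iff.1 (hd' (d' k / d k))
  simp only [Pi.smul_apply, smul_eq_mul] at hl
  let φ : (Fin t → ZMod q) →+ ZMod q × ZMod q :=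
    { toFun := fun y => (y ⬝ᵥ d, y ⬝ᵥ d')
      map_zero' := by simp
      map_add' := by simp [add_dotProduct] }
  have hdet : d' l * d k - d' k * d l ≠ 0 := by
    intro h
    apply hl
    field_simp
    linear_combination h
  have hsurj : Function.Surjective φ := by
    rintro ⟨s, s'⟩
    refine ⟨Pi.single k ((s * d' l - s' * d l) / (d' l * d k - d' k * d l)) +
      Pi.single l ((s' * d k - s * d' k) / (d' l * d k - d' k * d l)), ?_⟩
    simp only [φ, AddMonoidHom.coe_mk, ZeroHom.coe_mk, add_dotProduct, single_dotProduct]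
    ext
    · simp only
      rw [div_mul_eq_mul_div, div_mul_eq_mul_div, ← add_div, div_eq_iff hdet]; ring
    · simp only
      rw [div_mul_eq_mul_div, div_mul_eq_mul_div, ← add_div, div_eq_iff hdet]; ring
  have h := card_fiber_mul φ hsurj 0
  simpa [φ, ZMod.card, Prod.ext_iff, pow_two] using h

theorem card_forall_mem_mul_le {K : Type*} [Fintype K] [DecidableEq K] (S : V → Finset K)
    (a : V → ℕ) (M b : ℕ) (h : ∀ v, #(S v) * M ^ a v ≤ b * Fintype.card K) :
    #{g : V → K | ∀ v, g v ∈ S v} * M ^ (∑ v, a v) ≤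
      b ^ Fintype.card V * Fintype.card (V → K) := by
  have h1 : ({g : V → K | ∀ v, g v ∈ S v} : Finset _) = Fintype.piFinset S := by
    ext g; simp
  rw [h1, Fintype.card_piFinset, ← prod_pow_eq_pow_sum, ← prod_mul_distrib, Fintype.card_fun,
    ← mul_pow]
  calc _ ≤ ∏ _v : V, b * Fintype.card K := prod_le_prod' fun v _ => h v
    _ = _ := by simp

/-- Some nonzero vector vanishes in `t` coordinates. -/
def BadOne (g : V → Fin t → ZMod q) (k : Fin t) (A : Finset V) (d : Fin t → ZMod q) : Prop :=
  d k = 1 ∧ ∀ v ∈ A, g v ⬝ᵥ d = 0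

def BadTwo (g : V → Fin t → ZMod q) (k : Fin t) (A B : Finset V) (d d' : Fin t → ZMod q) : Prop :=
  d k = 1 ∧ (∀ l : ZMod q, d' ≠ l • d) ∧ (∀ v ∈ A, g v ⬝ᵥ d = 0) ∧
    ∀ v ∈ B, g v ⬝ᵥ d' = 0 ∨ g v ⬝ᵥ d' = g v ⬝ᵥ d

theorem isCode_linCode (g : V → Fin t → ZMod q) (h1 : ∀ k A d, #A = t → ¬ BadOne g k A d)
    (h2 : ∀ k A B d d', 2 * t ≤ #A + #B → ¬ BadTwo g k A B d d') : IsCode t (linCode g) := by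
  have key : ∀ d : Fin t → ZMod q, d ≠ 0 → ∀ A : Finset V, (∀ v ∈ A, g v ⬝ᵥ d = 0) → #A < t := by
    intro d hd A hA
    by_contra! hcon
    obtain ⟨A', hA', hc⟩ := exists_subset_card_eq hcon
    obtain ⟨k, hk⟩ := Function.ne_iff.1 hd
    refine h1 k A' ((d k)⁻¹ • d) hc ⟨?_, fun v hv => ?_⟩
    · simpa using inv_mul_cancel₀ hk
    · rw [dotProduct_smul, hA v (hA' hv), smul_zero]
  have mds : ∀ u u' : Fin t → ZMod q, u ≠ u' → #{v | linCode g u v = linCode g u' v} < t := by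
    intro u u' h
    refine key (u - u') (sub_ne_zero.2 h) _ fun v hv => ?_
    rw [mem_filter] at hv
    exact (linCode_sub g u u' v).trans (sub_eq_zero.2 hv.2)
  refine ⟨mds, fun u v w huv huw hvw hcl => ?_⟩
  set A : Finset V := {x | linCode g u x = linCode g v x}
  set B : Finset V := {x | linCode g w x = linCode g u x ∨ linCode g w x = linCode g v x}
  have hcard : 2 * t ≤ #A + #B := by
    refine le_trans hcl (add_le_add (card_graph_inter_graph _ _).le ?_)
    have : graph (linCode g w) ∩ (graph (linCode g u) ∪ graph (linCode g v)) ⊆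
        B.map (graphEmb (linCode g w)) := by
      rintro ⟨x, y⟩ hp
      simp only [mem_inter, mem_union, mem_graph] at hp
      refine Finset.mem_map.2 ⟨x, ?_, by simp [hp.1]⟩
      simp only [B, mem_filter, mem_univ, true_and, hp.1]
      exact hp.2.imp Eq.symm Eq.symm
    exact (card_le_card this).trans (card_map _).le
  have hd : v - u ≠ 0 := sub_ne_zero.2 huv.symm
  have hA0 : ∀ x ∈ A, g x ⬝ᵥ (v - u) = 0 := fun x hx => by
    simp only [A, mem_filter, mem_univ, true_and] at hx
    exact (linCode_sub g v u x).trans (sub_eq_zero.2 hx.symm)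
  have hB0 : ∀ x ∈ B, g x ⬝ᵥ (w - u) = 0 ∨ g x ⬝ᵥ (w - u) = g x ⬝ᵥ (v - u) := fun x hx => by
    simp only [B, mem_filter, mem_univ, true_and] at hx
    refine hx.imp (fun h => (linCode_sub g w u x).trans (sub_eq_zero.2 h)) fun h => ?_
    exact (linCode_sub g w u x).trans ((linCode_sub g v u x).trans (by rw [h])).symm
  by_cases hl : ∃ l : ZMod q, w - u = l • (v - u)
  · obtain ⟨l, hl⟩ := hl
    have hl0 : l ≠ 0 := by
      rintro rfl
      rw [zero_smul] at hl
      exact huw (sub_eq_zero.1 hl).symm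
    have hl1 : l - 1 ≠ 0 := by
      intro h
      rw [sub_eq_zero.1 h, one_smul] at hl
      exact hvw (sub_left_injective hl).symm
    have hA1 := key _ hd A hA0
    have hB1 := key _ hd B fun x hx => by
      rcases hB0 x hx with h | h
      · rw [hl, dotProduct_smul, smul_eq_mul] at h
        exact (mul_eq_zero.1 h).resolve_left hl0
      · rw [hl, dotProduct_smul, smul_eq_mul] at h
        have h' : (l - 1) * (g x ⬝ᵥ (v - u)) = 0 := by rw [sub_mul, h, one_mul, sub_self]
        exact (mul_eq_zero.1 h').resolve_left hl1
    omega
  · push Not at hl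
    obtain ⟨k, hk⟩ := Function.ne_iff.1 hd
    refine h2 k A B (((v - u) k)⁻¹ • (v - u)) (((v - u) k)⁻¹ • (w - u)) hcard ⟨?_, ?_, ?_, ?_⟩
    · rw [Pi.smul_apply, smul_eq_mul]; exact inv_mul_cancel₀ hk
    · intro l h
      rw [smul_comm] at h
      exact hl l (smul_right_injective _ (inv_ne_zero hk) h)
    · intro x hx
      rw [dotProduct_smul, hA0 x hx, smul_zero]
    · intro x hx
      rw [dotProduct_smul, dotProduct_smul]
      exact (hB0 x hx).imp (fun h => by rw [h, smul_zero]) fun h => by rw [h]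

theorem card_badOne (k : Fin t) (A : Finset V) (hA : #A = t) {d : Fin t → ZMod q} :
    open Classical in
    #{g : V → Fin t → ZMod q | BadOne g k A d} * q ^ t ≤ Fintype.card (V → Fin t → ZMod q) := by
  classical
  by_cases hd : d k = 1
  · have hd0 : d ≠ 0 := fun h => by simp [h] at hd
    have h := card_forall_mem_mul_le (K := Fin t → ZMod q)
      (fun v => if v ∈ A then ({y | y ⬝ᵥ d = 0} : Finset _) else univ)
          (fun v => if v ∈ A then 1 else 0) q 1 (by
        intro v
        split_ifs
        · simpa [ZMod.card] using (card_dotProduct_eq hd0 0).le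
        · simp [ZMod.card])
    rw [one_pow, one_mul] at h
    refine le_trans (Nat.mul_le_mul (card_le_card fun g hg => ?_) ?_) h
    · simp only [mem_filter, mem_univ, true_and] at hg ⊢
      intro v
      split_ifs with hv
      · simpa using hg.2 v hv
      · simp
    · simp [hA]
  · simp [BadOne, hd]

theorem card_badTwo (k : Fin t) (A B : Finset V) (hAB : 2 * t ≤ #A + #B) {d d' : Fin t → ZMod q} :
    open Classical in
    #{g : V → Fin t → ZMod q | BadTwo g k A B d d'} * q ^ (2 * t) ≤
      2 ^ Fintype.card V * Fintype.card (V → Fin t → ZMod q) := by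
  classical
  have hq : 0 < q := (Fact.out : q.Prime).pos
  by_cases hd : d k = 1 ∧ ∀ l : ZMod q, d' ≠ l • d
  · obtain ⟨hd, hdd⟩ := hd
    have hd0 : d ≠ 0 := fun h => by simp [h] at hd
    have hd'0 : d' ≠ 0 := fun h => by simpa [h] using hdd 0
    have hdd0 : d' - d ≠ 0 := fun h => hdd 1 (by rw [one_smul]; exact sub_eq_zero.1 h)
    have h := card_forall_mem_mul_le (K := Fin t → ZMod q)
      (fun v => {y | (v ∈ A → y ⬝ᵥ d = 0) ∧ (v ∈ B → y ⬝ᵥ d' = 0 ∨ y ⬝ᵥ d' = y ⬝ᵥ d)})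
      (fun v => (if v ∈ A then 1 else 0) + if v ∈ B then 1 else 0) q 2 (by
        intro v
        by_cases hvA : v ∈ A <;> by_cases hvB : v ∈ B
        · have := card_dotProduct_eq_zero₂ hd0 hdd
          have hsub : #{y : Fin t → ZMod q | (v ∈ A → y ⬝ᵥ d = 0) ∧
              (v ∈ B → y ⬝ᵥ d' = 0 ∨ y ⬝ᵥ d' = y ⬝ᵥ d)} ≤
              #{y : Fin t → ZMod q | y ⬝ᵥ d = 0 ∧ y ⬝ᵥ d' = 0} := by
            refine card_le_card fun y => ?_
            simp only [hvA, hvB, mem_filter, mem_univ, true_and, true_imp_iff]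
            rintro ⟨h1, h2⟩
            rw [h1, or_self] at h2
            exact ⟨h1, h2⟩
          simp only [hvA, hvB, if_true] at hsub ⊢
          calc _ ≤ _ := Nat.mul_le_mul_right (q ^ 2) hsub
            _ = q ^ t := this
            _ ≤ _ := by simp [ZMod.card]; omega
        · have := card_dotProduct_eq hd0 0
          simp only [hvA, hvB, true_imp_iff, false_imp_iff, and_true, if_true, if_false, add_zero,
            pow_one, this]
          simp [ZMod.card]; omega
        · have h1 := card_dotProduct_eq hd'0 0
          have h2 := card_dotProduct_eq hdd0 0
          have hsub : #{y : Fin t → ZMod q | y ⬝ᵥ d' = 0 ∨ y ⬝ᵥ d' = y ⬝ᵥ d} ≤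
              #{y : Fin t → ZMod q | y ⬝ᵥ d' = 0} + #{y : Fin t → ZMod q | y ⬝ᵥ (d' - d) = 0} := by
            rw [filter_or]
            refine (card_union_le _ _).trans (add_le_add le_rfl (card_le_card fun y => ?_))
            simp [dotProduct_sub, sub_eq_zero]
          simp only [hvA, hvB, true_imp_iff, false_imp_iff, true_and, if_true, if_false, zero_add,
            pow_one]
          calc _ ≤ _ := Nat.mul_le_mul_right q hsub
            _ = 2 * q ^ t := by rw [add_mul, h1, h2]; ring
            _ ≤ _ := by simp [ZMod.card]
        · simp [hvA, hvB, ZMod.card]; omega)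
    refine le_trans (Nat.mul_le_mul (card_le_card fun g hg => ?_) ?_) h
    · simp only [mem_filter, mem_univ, true_and] at hg ⊢
      exact fun v => ⟨hg.2.2.1 v, hg.2.2.2 v⟩
    · refine Nat.pow_le_pow_right hq ?_
      simpa [sum_add_distrib] using hAB
  · have : ({g : V → Fin t → ZMod q | BadTwo g k A B d d'} : Finset _) = ∅ := by
      rw [filter_eq_empty_iff]
      exact fun g _ hg => hd ⟨hg.1, hg.2.1⟩
    rw [this]; simp

theorem card_eq_one_mul (k : Fin t) : #{d : Fin t → ZMod q | d k = 1} * q = q ^ t := by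
  have := card_dotProduct_eq (d := Pi.single (M := fun _ => ZMod q) k 1) (by simp) 1
  simpa using this

/-- Most linear forms define a code. -/
theorem card_not_isCode_mul_le :
    open Classical in
    #{g : V → Fin t → ZMod q | ¬ IsCode t (linCode g)} * q ≤
      2 * t * 8 ^ Fintype.card V * Fintype.card (V → Fin t → ZMod q) := by
  classical
  have hq : 0 < q := (Fact.out : q.Prime).pos
  set N := Fintype.card (V → Fin t → ZMod q) with hN
  set n := Fintype.card V
  let D : Fin t → Finset (Fin t → ZMod q) := fun k => {d | d k = 1}
  have hD : ∀ k, #(D k) * q = q ^ t := card_eq_one_mul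
  let S1 : Finset (V → Fin t → ZMod q) := univ.biUnion fun k : Fin t =>
    (univ : Finset (Finset V)).biUnion fun A => (D k).biUnion fun d =>
      if #A = t then ({g | BadOne g k A d} : Finset _) else ∅
  let S2 : Finset (V → Fin t → ZMod q) := univ.biUnion fun k : Fin t =>
    (univ : Finset (Finset V × Finset V)).biUnion fun A => (D k ×ˢ univ).biUnion fun d =>
      if 2 * t ≤ #A.1 + #A.2 then ({g | BadTwo g k A.1 A.2 d.1 d.2} : Finset _) else ∅
  have hsub : ({g : V → Fin t → ZMod q | ¬ IsCode t (linCode g)} : Finset _) ⊆ S1 ∪ S2 := by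
    intro g hg
    by_contra hcon
    simp only [mem_union, not_or] at hcon
    refine (mem_filter.1 hg).2 (isCode_linCode g (fun k A d hA hb => hcon.1 ?_)
      fun k A B d d' hAB hb => hcon.2 ?_)
    · simp only [S1, mem_biUnion]
      exact ⟨k, mem_univ _, A, mem_univ _, d, by simp [D, hb.1], by simp [hA, hb]⟩
    · simp only [S2, mem_biUnion]
      exact ⟨k, mem_univ _, (A, B), mem_univ _, (d, d'), by simp [D, hb.1], by simp [hAB, hb]⟩
  have h1 : #S1 * q ≤ t * 2 ^ n * N := by
    have hb : #S1 * q ^ t ≤ ∑ k : Fin t, ∑ _A : Finset V, ∑ _d ∈ D k, N := by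
      refine le_trans (Nat.mul_le_mul_right _ (card_biUnion_le.trans (sum_le_sum fun k _ =>
        card_biUnion_le.trans (sum_le_sum fun A _ => card_biUnion_le)))) ?_
      simp only [sum_mul]
      refine sum_le_sum fun k _ => sum_le_sum fun A _ => sum_le_sum fun d _ => ?_
      split_ifs with hA
      · exact card_badOne k A hA
      · simp
    refine Nat.le_of_mul_le_mul_right ?_ (pow_pos hq t)
    calc #S1 * q * q ^ t = (#S1 * q ^ t) * q := by ring
      _ ≤ _ := Nat.mul_le_mul_right q hb
      _ = ∑ k : Fin t, 2 ^ n * (#(D k) * q) * N := by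
        rw [sum_mul]
        refine sum_congr rfl fun k _ => ?_
        simp only [sum_const, smul_eq_mul, card_univ, Fintype.card_finset]
        ring
      _ = _ := by simp only [hD, sum_const, smul_eq_mul, card_univ, Fintype.card_fin]; ring
      _ ≤ _ := le_rfl
  have h2 : #S2 * q ≤ t * 8 ^ n * N := by
    have hb : #S2 * q ^ (2 * t) ≤ ∑ k : Fin t, ∑ _A : Finset V × Finset V,
        ∑ _d ∈ D k ×ˢ (univ : Finset (Fin t → ZMod q)), 2 ^ n * N := by
      refine le_trans (Nat.mul_le_mul_right _ (card_biUnion_le.trans (sum_le_sum fun k _ =>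
        card_biUnion_le.trans (sum_le_sum fun A _ => card_biUnion_le)))) ?_
      simp only [sum_mul]
      refine sum_le_sum fun k _ => sum_le_sum fun A _ => sum_le_sum fun d _ => ?_
      split_ifs with hA
      · exact card_badTwo k A.1 A.2 hA
      · simp
    refine Nat.le_of_mul_le_mul_right ?_ (pow_pos hq (2 * t))
    calc #S2 * q * q ^ (2 * t) = (#S2 * q ^ (2 * t)) * q := by ring
      _ ≤ _ := Nat.mul_le_mul_right q hb
      _ = ∑ k : Fin t, 8 ^ n * (#(D k) * q) * q ^ t * N := by
        rw [sum_mul]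
        refine sum_congr rfl fun k _ => ?_
        have h8 : (8 : ℕ) ^ n = 2 ^ n * 2 ^ n * 2 ^ n := by rw [← mul_pow, ← mul_pow]; norm_num
        simp only [sum_const, smul_eq_mul, card_univ, Fintype.card_finset, Fintype.card_prod,
          card_product, Fintype.card_fun, ZMod.card, Fintype.card_fin, h8]
        ring
      _ = _ := by simp only [hD, sum_const, smul_eq_mul, card_univ, Fintype.card_fin]; ring
      _ ≤ _ := le_rfl
  have h28 : 2 ^ n ≤ 8 ^ n := Nat.pow_le_pow_left (by norm_num) n
  calc _ ≤ (#S1 + #S2) * q := Nat.mul_le_mul_right q ((card_le_card hsub).trans (card_union_le _ _))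
    _ ≤ t * 2 ^ n * N + t * 8 ^ n * N := by rw [add_mul]; exact add_le_add h1 h2
    _ ≤ t * 8 ^ n * N + t * 8 ^ n * N := by gcongr
    _ = _ := by ring

end LinearCode

section Special

variable {m t : ℕ} {U V X : Type*} [Fintype V] [DecidableEq V] [DecidableEq X]

/-- The places where a codeword agrees with `x`. -/
def agr (c : U → Fin m → X) (x : Fin m → X) (u : U) : Finset (Fin m) := {i | c u i = x i}

@[simp] theorem mem_agr {c : U → Fin m → X} {x : Fin m → X} {u : U} {i : Fin m} :
    i ∈ agr c x u ↔ c u i = x i := by simp [agr]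

/-- The codewords that are exceptionally close to `x`. -/
def InW (t : ℕ) (c : U → Fin m → X) (x : Fin m → X) (u : U) : Prop :=
  t ≤ #(agr c x u) ∨ ∃ u', u ≠ u' ∧ #(agr c x u) < t ∧ #(agr c x u') < t ∧
    Clash t (graph x) (graph (c u)) (graph (c u'))

/-- The restriction of a code to the image of an embedding. -/
def pull (c : U → V → X) (f : Fin m ↪ V) : U → Fin m → X := fun u i => c u (f i)

/-- A codeword which agrees with an exceptional codeword `u` or with `x` at `t + 1` places does
so within the range of `f`. -/
def Rigid (t : ℕ) (c : U → V → X) (f : Fin m ↪ V) (x : Fin m → X) : Prop :=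
  ∀ u u', InW t (pull c f) x u → u ≠ u' → ∀ J : Finset V, #J = t + 1 →
    (∀ v ∈ J, c u v = c u' v ∨ ∃ i, f i = v ∧ c u' v = x i) → J ⊆ univ.map f

theorem Clash.le_card_sdiff {α : Type*} [DecidableEq α] {t : ℕ} {a b c : Finset α}
    (h : Clash t a b c) : 2 * t ≤ #(a ∩ b) + #(a ∩ c) + #((b ∩ c) \ a) := by
  refine le_trans h ?_
  rw [add_assoc]
  refine add_le_add le_rfl (le_trans (card_le_card ?_) (card_union_le _ _))
  intro z hz
  simp only [mem_inter, mem_union, Finset.mem_sdiff] at hz ⊢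
  tauto

end Special

section Linear

variable {q : ℕ} [Fact q.Prime] {m t : ℕ} {V : Type*} [Fintype V] [DecidableEq V]
  {g : V → Fin t → ZMod q}

theorem linCode_zero (v : V) : linCode g 0 v = 0 := by simp [linCode]

/-- A pair of codewords is determined by sufficiently many agreements. -/
theorem linCode_unique (hc : IsCode t (linCode g)) {A₁ A₂ A₃ : Finset V} (h₁ : #A₁ < t)
    (h₂ : #A₂ < t) (h₁₃ : Disjoint A₁ A₃) (h₂₃ : Disjoint A₂ A₃)
    (hs : 2 * t ≤ #A₁ + #A₂ + #A₃) (y : V → ZMod q) {u u' w w' : Fin t → ZMod q}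
    (hu : u ≠ u') (hw : w ≠ w') (u1 : ∀ v ∈ A₁, linCode g u v = y v)
    (w1 : ∀ v ∈ A₁, linCode g w v = y v) (u2 : ∀ v ∈ A₂, linCode g u' v = y v)
    (w2 : ∀ v ∈ A₂, linCode g w' v = y v) (u3 : ∀ v ∈ A₃, linCode g u v = linCode g u' v)
    (w3 : ∀ v ∈ A₃, linCode g w v = linCode g w' v) : u = w ∧ u' = w' := by
  by_contra hcon
  have lt_of : ∀ {a b : Fin t → ZMod q}, a ≠ b → ∀ A : Finset V,
      (∀ v ∈ A, linCode g a v = linCode g b v) → #A < t := by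
    intro a b hab A hA
    by_contra! h
    exact hab (hc.eq_of_subset h hA)
  have c23 := card_union_of_disjoint h₂₃
  have c13 := card_union_of_disjoint h₁₃
  by_cases a : u = w
  · have b : u' ≠ w' := fun h => hcon ⟨a, h⟩
    subst a
    have := lt_of b (A₂ ∪ A₃) fun v hv => by
      rcases mem_union.1 hv with hv | hv
      · rw [u2 v hv, w2 v hv]
      · rw [← u3 v hv, w3 v hv]
    omega
  by_cases b : u' = w'
  · subst b
    have := lt_of a (A₁ ∪ A₃) fun v hv => by
      rcases mem_union.1 hv with hv | hv
      · rw [u1 v hv, w1 v hv]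
      · rw [u3 v hv, ← w3 v hv]
    omega
  by_cases d : u - w = u' - w'
  · have h3 := lt_of hu (A₃ ∪ (A₁ ∩ A₂)) fun v hv => by
      rcases mem_union.1 hv with hv | hv
      · exact u3 v hv
      · rw [mem_inter] at hv
        rw [u1 v hv.1, u2 v hv.2]
    have h12 := lt_of a (A₁ ∪ A₂) fun v hv => by
      rcases mem_union.1 hv with hv | hv
      · rw [u1 v hv, w1 v hv]
      · have h := congrArg (fun z => linCode g z v) d
        simp only [linCode_sub, u2 v hv, w2 v hv, sub_self] at h
        exact sub_eq_zero.1 h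
    rw [card_union_of_disjoint (h₁₃.symm.mono_right inter_subset_left)] at h3
    have := card_union_add_card_inter A₁ A₂
    omega
  · refine hc.not_clash 0 (u - w) (u' - w') (sub_ne_zero.2 a).symm (sub_ne_zero.2 b).symm d ?_
    have e1 : A₁.map (graphEmb (linCode g 0)) ⊆ graph (linCode g 0) ∩ graph (linCode g (u - w)) :=
        by
      intro p hp
      obtain ⟨v, hv, rfl⟩ := Finset.mem_map.1 hp
      simp [linCode_sub, u1 v hv, w1 v hv, linCode_zero]
    have e2 : (A₂ ∪ A₃).map (graphEmb (linCode g (u' - w'))) ⊆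
        graph (linCode g (u' - w')) ∩ (graph (linCode g 0) ∪ graph (linCode g (u - w))) := by
      intro p hp
      obtain ⟨v, hv, rfl⟩ := Finset.mem_map.1 hp
      rcases mem_union.1 hv with hv | hv
      · simp [linCode_sub, u2 v hv, w2 v hv, linCode_zero]
      · simp [linCode_sub, u3 v hv, w3 v hv, linCode_zero]
    have e1 := card_le_card e1
    have e2 := card_le_card e2
    rw [card_map] at e1 e2
    unfold Clash
    omega

theorem card_inW_le (hc : IsCode t (linCode g)) (f : Fin m ↪ V) (x : Fin m → ZMod q) :
    open Classical in
    #{u | InW t (pull (linCode g) f) x u} ≤ 2 ^ m + 8 ^ m := by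
  classical
  let S1 : Finset (Fin t → ZMod q) := (univ : Finset (Finset (Fin m))).biUnion fun T =>
    {u | #T = t ∧ ∀ i ∈ T, linCode g u (f i) = x i}
  let S2 : Finset (Fin t → ZMod q) :=
    (univ : Finset (Finset (Fin m) × Finset (Fin m) × Finset (Fin m))).biUnion fun T =>
    {u | #T.1 < t ∧ #T.2.1 < t ∧ Disjoint T.1 T.2.2 ∧ Disjoint T.2.1 T.2.2 ∧
      2 * t ≤ #T.1 + #T.2.1 + #T.2.2 ∧ ∃ u', u ≠ u' ∧ (∀ i ∈ T.1, linCode g u (f i) = x i) ∧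
        (∀ i ∈ T.2.1, linCode g u' (f i) = x i) ∧
        ∀ i ∈ T.2.2, linCode g u (f i) = linCode g u' (f i)}
  have hsub : ({u | InW t (pull (linCode g) f) x u} : Finset _) ⊆ S1 ∪ S2 := by
    intro u hu
    rw [mem_filter] at hu
    rcases hu.2 with h | ⟨u', hne, h1, h2, hcl⟩
    · obtain ⟨T, hT, hTc⟩ := exists_subset_card_eq h
      refine mem_union_left _ (mem_biUnion.2 ⟨T, mem_univ _, ?_⟩)
      simp only [mem_filter, mem_univ, true_and]
      exact ⟨hTc, fun i hi => mem_agr.1 (hT hi)⟩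
    · have hcl := hcl.le_card_sdiff
      have k1 : graph x ∩ graph (pull (linCode g) f u) =
          (agr (pull (linCode g) f) x u).map (graphEmb x) := by
        rw [graph_inter_graph]; congr 1; ext i; simp [eq_comm]
      have k2 : graph x ∩ graph (pull (linCode g) f u') =
          (agr (pull (linCode g) f) x u').map (graphEmb x) := by
        rw [graph_inter_graph]; congr 1; ext i; simp [eq_comm]
      set T3 : Finset (Fin m) := {i | linCode g u (f i) = linCode g u' (f i) ∧
        linCode g u (f i) ≠ x i} with hT3
      have k3 : (graph (pull (linCode g) f u) ∩ graph (pull (linCode g) f u')) \ graph x ⊆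
          T3.map (graphEmb (pull (linCode g) f u)) := by
        rintro ⟨i, z⟩ hp
        simp only [Finset.mem_sdiff, mem_inter, mem_graph, pull] at hp
        refine Finset.mem_map.2 ⟨i, ?_, by simp [pull, hp.1.1]⟩
        simp only [hT3, mem_filter, mem_univ, true_and]
        exact ⟨hp.1.1.trans hp.1.2.symm, fun h => hp.2 (h.symm.trans hp.1.1)⟩
      have k3 := card_le_card k3
      rw [k1, k2, card_map, card_map] at hcl
      rw [card_map] at k3
      refine mem_union_right _ (mem_biUnion.2 ⟨(agr (pull (linCode g) f) x u,
        agr (pull (linCode g) f) x u', T3), mem_univ _, ?_⟩)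
      simp only [mem_filter, mem_univ, true_and]
      refine ⟨h1, h2, ?_, ?_, by omega, u', hne, fun i hi => mem_agr.1 hi,
        fun i hi => mem_agr.1 hi, ?_⟩
      · rw [disjoint_left]
        intro i hi hi'
        simp only [hT3, mem_filter, mem_univ, true_and] at hi'
        exact hi'.2 (mem_agr.1 hi)
      · rw [disjoint_left]
        intro i hi hi'
        simp only [hT3, mem_filter, mem_univ, true_and] at hi'
        exact hi'.2 (hi'.1.trans (mem_agr.1 hi))
      · intro i hi
        simp only [hT3, mem_filter, mem_univ, true_and] at hi
        exact hi.1
  have h1 : #S1 ≤ 2 ^ m := by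
    refine (card_biUnion_le_card_mul _ _ 1 fun T _ => ?_).trans (by simp)
    rw [card_le_one]
    intro u hu w hw
    simp only [mem_filter, mem_univ, true_and] at hu hw
    refine hc.eq_of_subset (A := T.map f) (by rw [card_map, hu.1]) fun v hv => ?_
    obtain ⟨i, hi, rfl⟩ := Finset.mem_map.1 hv
    rw [hu.2 i hi, hw.2 i hi]
  have h2 : #S2 ≤ 8 ^ m := by
    refine (card_biUnion_le_card_mul _ _ 1 fun T _ => ?_).trans ?_
    · rw [card_le_one]
      intro u hu w hw
      simp only [mem_filter, mem_univ, true_and] at hu hw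
      obtain ⟨c1, c2, d1, d2, hs, u', hne, u1, u2, u3⟩ := hu
      obtain ⟨-, -, -, -, -, w', hne', w1, w2, w3⟩ := hw
      refine (linCode_unique hc (A₁ := T.1.map f) (A₂ := T.2.1.map f) (A₃ := T.2.2.map f)
        (by rwa [card_map]) (by rwa [card_map]) ((disjoint_map f).2 d1) ((disjoint_map f).2 d2)
        (by simpa using hs) (Function.extend f x 0) hne hne' ?_ ?_ ?_ ?_ ?_ ?_).1
      all_goals
        intro v hv
        obtain ⟨i, hi, rfl⟩ := Finset.mem_map.1 hv
        try rw [f.injective.extend_apply]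
      exacts [u1 i hi, w1 i hi, u2 i hi, w2 i hi, u3 i hi, w3 i hi]
    · have h8 : (8 : ℕ) ^ m = 2 ^ m * (2 ^ m * 2 ^ m) := by
        rw [← mul_pow, ← mul_pow]; norm_num
      simp [h8]
  exact (card_le_card hsub).trans ((card_union_le _ _).trans (add_le_add h1 h2))

theorem card_mul_le_of_fiber {K : Type*} [Fintype K] [DecidableEq K] (j : V) (A : Finset (V → K))
    (a b : ℕ) (h : ∀ g : V → K, #{y | Function.update g j y ∈ A} * a ≤ b * Fintype.card K) :
    #A * a ≤ b * Fintype.card (V → K) := by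
  classical
  rcases isEmpty_or_nonempty K with hK | hK
  · have : IsEmpty (V → K) := ⟨fun g => hK.elim (g j)⟩
    simp [eq_empty_of_isEmpty A]
  have hcount : #A * Fintype.card K = ∑ g : V → K, #{y | Function.update g j y ∈ A} := by
    rw [← card_univ, ← card_product, ← card_sigma]
    refine card_bij' (fun p _ => ⟨Function.update p.1 j p.2, p.1 j⟩)
      (fun p _ => (Function.update p.1 j p.2, p.1 j)) ?_ ?_ ?_ ?_
    · rintro ⟨g, y⟩ hp
      simpa using hp
    · rintro ⟨g, y⟩ hp
      simpa using hp
    · rintro ⟨g, y⟩ hp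
      simp
    · rintro ⟨g, y⟩ hp
      simp
  have hpos : 0 < Fintype.card K := Fintype.card_pos
  refine Nat.le_of_mul_le_mul_right ?_ hpos
  calc #A * a * Fintype.card K = (#A * Fintype.card K) * a := by ring
    _ = ∑ g : V → K, #{y | Function.update g j y ∈ A} * a := by rw [hcount, sum_mul]
    _ ≤ ∑ _g : V → K, b * Fintype.card K := sum_le_sum fun g _ => h g
    _ = _ := by rw [sum_const, card_univ, smul_eq_mul]; ring

/-- For most codes, the rigidity property holds at a given pair `(f, x)`. -/
theorem card_not_rigid_mul_le (f : Fin m ↪ V) (x : Fin m → ZMod q) :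
    open Classical in
    #{g : V → Fin t → ZMod q | IsCode t (linCode g) ∧ ¬ Rigid t (linCode g) f x} * q ≤
      Fintype.card V * ((2 ^ m + 8 ^ m) * 4 ^ Fintype.card V) *
        Fintype.card (V → Fin t → ZMod q) := by
  classical
  set N := Fintype.card (V → Fin t → ZMod q) with hN
  set C := (2 ^ m + 8 ^ m) * 4 ^ Fintype.card V with hC
  let A : V → Finset (V → Fin t → ZMod q) := fun j =>
    {g | j ∉ univ.map f ∧ IsCode t (linCode g) ∧ ∃ u u', InW t (pull (linCode g) f) x u ∧ u ≠ u' ∧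
      ∃ J : Finset V, #J = t + 1 ∧ j ∈ J ∧
        ∀ v ∈ J, linCode g u v = linCode g u' v ∨ ∃ i, f i = v ∧ linCode g u' v = x i}
  have hsub : ({g : V → Fin t → ZMod q | IsCode t (linCode g) ∧ ¬ Rigid t (linCode g) f x} :
      Finset _) ⊆ univ.biUnion A := by
    intro g hg
    obtain ⟨hc, hR⟩ := (mem_filter.1 hg).2
    unfold Rigid at hR
    push Not at hR
    obtain ⟨u, u', hW, hne, J, hJ, hJv, hJf⟩ := hR
    obtain ⟨j, hj, hjf⟩ := not_subset.1 hJf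
    simp only [A, mem_biUnion, mem_univ, true_and, mem_filter]
    exact ⟨j, hjf, hc, u, u', hW, hne, J, hJ, hj, hJv⟩
  have hA : ∀ j, #(A j) * q ≤ C * N := by
    intro j
    refine card_mul_le_of_fiber j (A j) q C fun g => ?_
    rcases eq_empty_or_nonempty ({y | Function.update g j y ∈ A j} : Finset _) with h0 | ⟨y₀, hy₀⟩
    · rw [h0]; simp
    simp only [A, mem_filter, mem_univ, true_and] at hy₀
    obtain ⟨hj, hc₀, -⟩ := hy₀
    set g₀ := Function.update g j y₀ with hg₀
    have hoff : ∀ y (v : V), v ≠ j → ∀ u, linCode (Function.update g j y) u v = linCode g₀ u v := by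
      intro y v hv u
      simp [linCode, hg₀, hv]
    have hpull : ∀ y, pull (linCode (Function.update g j y)) f = pull (linCode g₀) f := by
      intro y
      funext u i
      refine hoff y (f i) ?_ u
      rintro rfl
      exact hj (mem_map_of_mem _ (mem_univ _))
    let F : (Fin t → ZMod q) × Finset V × Finset V → Finset (Fin t → ZMod q) := fun p =>
      {y | ∃ u', p.1 ≠ u' ∧ y ⬝ᵥ (p.1 - u') = 0 ∧ #(p.2.1 ∪ p.2.2) = t ∧
        (∀ v ∈ p.2.1, linCode g₀ p.1 v = linCode g₀ u' v) ∧
        ∀ v ∈ p.2.2, ∃ i, f i = v ∧ linCode g₀ u' v = x i}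
    have hF : ∀ p, #(F p) * q ≤ q ^ t := by
      intro p
      rcases eq_empty_or_nonempty (F p) with h0 | ⟨y₁, hy₁⟩
      · rw [h0]; simp
      simp only [F, mem_filter, mem_univ, true_and] at hy₁
      obtain ⟨u₁, hne₁, -, hcard, hB₁, hD₁⟩ := hy₁
      rw [← card_dotProduct_eq (sub_ne_zero.2 hne₁) 0]
      refine Nat.mul_le_mul_right q (card_le_card fun y hy => ?_)
      simp only [F, mem_filter, mem_univ, true_and] at hy ⊢
      obtain ⟨u', hne', hy0, -, hB, hD⟩ := hy
      have : u' = u₁ := by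
        refine hc₀.eq_of_subset hcard.ge fun v hv => ?_
        rcases mem_union.1 hv with hv | hv
        · rw [← hB v hv, hB₁ v hv]
        · obtain ⟨i, hi, h⟩ := hD v hv
          obtain ⟨i', hi', h'⟩ := hD₁ v hv
          rw [h, h', f.injective (hi.trans hi'.symm)]
      rwa [this] at hy0
    have hsub' : ({y | Function.update g j y ∈ A j} : Finset _) ⊆
        (({u | InW t (pull (linCode g₀) f) x u} : Finset _) ×ˢ univ).biUnion F := by
      intro y hy
      simp only [A, mem_filter, mem_univ, true_and] at hy
      obtain ⟨-, -, u, u', hW, hne, J, hJ, hjJ, hJv⟩ := hy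
      rw [hpull] at hW
      rw [mem_biUnion]
      refine ⟨(u, ({v ∈ J.erase j | linCode g₀ u v = linCode g₀ u' v} : Finset V),
        ({v ∈ J.erase j | ¬ linCode g₀ u v = linCode g₀ u' v} : Finset V)), ?_, ?_⟩
      · simpa using hW
      · simp only [F, mem_filter, mem_univ, true_and]
        refine ⟨u', hne, ?_, ?_, fun v hv => hv.2, ?_⟩
        · have := hJv j hjJ
          simp only [linCode, Function.update_self] at this
          rcases this with h | ⟨i, hi, -⟩
          · rw [dotProduct_sub, h, sub_self]
          · exact absurd (hi ▸ mem_map_of_mem _ (mem_univ _)) hj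
        · rw [filter_union_filter_not_eq, card_erase_of_mem hjJ, hJ]; rfl
        · rintro v ⟨hv, hne'⟩
          rw [mem_erase] at hv
          have := hJv v hv.2
          rw [hoff y v hv.1, hoff y v hv.1] at this
          exact this.resolve_left hne'
    have hWc := card_inW_le hc₀ f x
    calc _ ≤ (∑ p ∈ ({u | InW t (pull (linCode g₀) f) x u} : Finset _) ×ˢ univ, #(F p)) * q :=
          Nat.mul_le_mul_right q ((card_le_card hsub').trans card_biUnion_le)
      _ ≤ ∑ _p ∈ ({u | InW t (pull (linCode g₀) f) x u} : Finset _) ×ˢ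
          (univ : Finset (Finset V × Finset V)), q ^ t := by
          rw [sum_mul]; exact sum_le_sum fun p _ => hF p
      _ ≤ C * q ^ t := by
          have h4 : (4 : ℕ) ^ Fintype.card V = 2 ^ Fintype.card V * 2 ^ Fintype.card V := by
            rw [← mul_pow]; norm_num
          rw [sum_const, smul_eq_mul, card_product, hC, card_univ, Fintype.card_prod,
            Fintype.card_finset, ← h4]
          gcongr
      _ = _ := by simp [ZMod.card]
  calc _ ≤ (∑ j, #(A j)) * q := Nat.mul_le_mul_right q ((card_le_card hsub).trans card_biUnion_le)
    _ ≤ ∑ _j : V, C * N := by rw [sum_mul]; exact sum_le_sum fun j _ => hA j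
    _ = _ := by rw [sum_const, card_univ, smul_eq_mul]; ring

end Linear

section Shadow

variable {m t : ℕ} {V : Type*} [Fintype V] [DecidableEq V] {E : Finset (Finset (Fin m))}
  {P : Finset (Fin m ↪ V)} {Z : Finset (Finset V)}

/-- A set of vertices is covered by an edge of a copy. -/
def Cov (E : Finset (Finset (Fin m))) (P : Finset (Fin m ↪ V)) (Q : Finset V) : Prop :=
  ∃ g ∈ P, ∃ e ∈ E, Q ⊆ e.map g

theorem Cov.mono {Q R : Finset V} (h : Cov E P R) (hQ : Q ⊆ R) : Cov E P Q := by
  obtain ⟨g, hg, e, he, h⟩ := h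
  exact ⟨g, hg, e, he, hQ.trans h⟩

theorem IsPacking.card_covering_le (hP : IsPacking t E P Z) (hE : ∀ e ∈ E, t ≤ #e) (Q : Finset V)
    (hQ : #Q ≤ t) : open Classical in
    #{g ∈ P | ∃ e ∈ E, Q ⊆ e.map g} ≤ 8 ^ m * t ^ t * Fintype.card V ^ (t - #Q) := by
  classical
  let F : Finset (Fin m) × Finset (Fin m) × Finset (Fin m) → Finset (Fin m ↪ V) := fun p =>
    {g ∈ P | p.1 ∈ E ∧ p.2.1 ⊆ p.2.2 ∧ p.2.2 ⊆ p.1 ∧ #p.2.1 = #Q ∧ #p.2.2 = t ∧ Q = p.2.1.map g}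
  have hsub : ({g ∈ P | ∃ e ∈ E, Q ⊆ e.map g} : Finset _) ⊆ univ.biUnion F := by
    intro g hg
    obtain ⟨hgP, e, he, hQe⟩ := mem_filter.1 hg
    obtain ⟨A, hA, hQA⟩ := exists_map_eq_of_subset_map hQe
    have hc : #A = #Q := by rw [hQA, card_map]
    obtain ⟨T, hAT, hTe, hT⟩ := exists_subsuperset_card_eq hA (hc.trans_le hQ) (hE e he)
    exact mem_biUnion.2 ⟨(e, A, T), mem_univ _, mem_filter.2 ⟨hgP, he, hAT, hTe, hc, hT, hQA⟩⟩
  have hF : ∀ p, #(F p) ≤ t ^ t * Fintype.card V ^ (t - #Q) := by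
    rintro ⟨e, A, T⟩
    rcases eq_empty_or_nonempty (F (e, A, T)) with h0 | ⟨g₀, hg₀⟩
    · rw [h0]; simp
    obtain ⟨-, he, hAT, hTe, hA, hT, -⟩ := mem_filter.1 hg₀
    simp only at he hAT hTe hA hT
    have h1 : #(F (e, A, T)) ≤ #(Fintype.piFinset fun i : T =>
        if (i : Fin m) ∈ A then Q else univ) := by
      refine card_le_card_of_injOn (fun g i => g i) ?_ ?_
      · intro g hg
        obtain ⟨-, -, -, -, -, -, hQA⟩ := mem_filter.1 hg
        simp only [mem_coe, Fintype.mem_piFinset]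
        intro i
        split_ifs with hi
        · rw [hQA]; exact mem_map_of_mem _ hi
        · exact mem_univ _
      · intro g hg g' hg' h
        by_contra hne
        have h2 := hP.inter_lt g (mem_filter.1 hg).1 g' (mem_filter.1 hg').1 hne e he e he
        have h3 : T.map g ⊆ e.map g ∩ e.map g' := by
          intro v hv
          obtain ⟨i, hi, rfl⟩ := Finset.mem_map.1 hv
          refine mem_inter.2 ⟨mem_map_of_mem _ (hTe hi), ?_⟩
          rw [show g i = g' i from congrFun h ⟨i, hi⟩]
          exact mem_map_of_mem _ (hTe hi)
        have := card_le_card h3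
        rw [card_map] at this
        omega
    refine h1.trans ?_
    rw [Fintype.card_piFinset]
    have h4 : ∏ i : T, #(if (i : Fin m) ∈ A then Q else (univ : Finset V)) =
        ∏ i ∈ T, if i ∈ A then #Q else Fintype.card V := by
      rw [← prod_coe_sort T]
      refine prod_congr rfl fun i _ => ?_
      split_ifs <;> simp
    rw [h4, prod_ite, prod_const, prod_const, filter_mem_eq_inter, inter_eq_right.2 hAT,
      filter_notMem_eq_sdiff, card_sdiff_of_subset hAT, hA, hT]
    refine Nat.mul_le_mul_right _ ?_
    rcases Nat.eq_zero_or_pos t with h | h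
    · have : #Q = 0 := by omega
      simp [this, h]
    · exact (Nat.pow_le_pow_left hQ _).trans (Nat.pow_le_pow_right h hQ)
  have h8 : (8 : ℕ) ^ m = 2 ^ m * (2 ^ m * 2 ^ m) := by
    rw [← mul_pow, ← mul_pow]; norm_num
  refine (card_le_card hsub).trans ((card_biUnion_le_card_mul _ _ _ fun p _ => hF p).trans ?_)
  simp [h8, mul_assoc]

theorem IsPacking.card_cov_le (hP : IsPacking t E P Z) (hE : ∀ e ∈ E, t ≤ #e) (Q : Finset V)
    (hQ : #Q ≤ t) : open Classical in
    #{S | Cov E P (Q ∪ S)} ≤ 32 ^ m * t ^ t * Fintype.card V ^ (t - #Q) := by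
  classical
  have hsub : ({S | Cov E P (Q ∪ S)} : Finset _) ⊆
      ({g ∈ P | ∃ e ∈ E, Q ⊆ e.map g} : Finset _).biUnion
        fun g => (univ.map g).powerset := by
    intro S hS
    obtain ⟨g, hg, e, he, h⟩ := (mem_filter.1 hS).2
    refine mem_biUnion.2 ⟨g, mem_filter.2 ⟨hg, e, he, subset_union_left.trans h⟩, ?_⟩
    rw [mem_powerset]
    exact (subset_union_right.trans h).trans (map_subset_map.2 (subset_univ e))
  have h32 : (32 : ℕ) ^ m = 8 ^ m * (2 ^ m * 2 ^ m) := by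
    rw [← mul_pow, ← mul_pow]; norm_num
  refine (card_le_card hsub).trans ((card_biUnion_le_card_mul _ _ (2 ^ m) fun g _ => ?_).trans ?_)
  · simp
  · refine (Nat.mul_le_mul_right _ (hP.card_covering_le hE Q hQ)).trans ?_
    rw [h32]
    have : 1 ≤ 2 ^ m := Nat.one_le_two_pow
    nlinarith [Nat.zero_le (8 ^ m * t ^ t * Fintype.card V ^ (t - #Q) * 2 ^ m)]

end Shadow

section Perm

variable {V : Type*} [Fintype V] [DecidableEq V]

theorem card_perm_map_mem (𝓕 : Finset (Finset V)) (Q : Finset V) (h : ∀ R ∈ 𝓕, #R = #Q) :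
    #{π : Equiv.Perm V | Q.map π.toEmbedding ∈ 𝓕} * (Fintype.card V).choose #Q =
      Fintype.card (Equiv.Perm V) * #𝓕 := by
  have hconst : ∀ R : Finset V, #R = #Q →
      #{π : Equiv.Perm V | Q.map π.toEmbedding = R} =
          #{π : Equiv.Perm V | Q.map π.toEmbedding = Q} := by
    intro R hR
    obtain ⟨τ, hτ⟩ : ∃ τ : Equiv.Perm V, Q.map τ.toEmbedding = R := by
      have e : {x // x ∈ Q} ≃ {x // x ∈ R} := Finset.equivOfCardEq hR.symm
      refine ⟨e.extendSubtype, ?_⟩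
      refine eq_of_subset_of_card_le ?_ (by rw [card_map, hR])
      intro v hv
      obtain ⟨w, hw, rfl⟩ := Finset.mem_map.1 hv
      exact e.extendSubtype_mem w hw
    symm
    refine card_bij (fun π _ => π.trans τ) ?_ ?_ ?_
    · intro π hπ
      simp only [mem_filter, mem_univ, true_and] at hπ ⊢
      rw [← hτ]
      nth_rw 2 [← hπ]
      rw [Finset.map_map]; rfl
    · intro π _ π' _ h
      exact Equiv.ext fun v => τ.injective (Equiv.congr_fun h v)
    · intro π hπ
      simp only [mem_filter, mem_univ, true_and] at hπ
      refine ⟨π.trans τ.symm, ?_, Equiv.ext fun v => by simp⟩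
      simp only [mem_filter, mem_univ, true_and]
      have : Q.map (π.trans τ.symm).toEmbedding = (Q.map π.toEmbedding).map τ.symm.toEmbedding := by
        rw [Finset.map_map]; rfl
      rw [this, hπ, ← hτ, Finset.map_map]
      ext v; simp
  have hsum : ∀ 𝓖 : Finset (Finset V), (∀ R ∈ 𝓖, #R = #Q) →
      #{π : Equiv.Perm V | Q.map π.toEmbedding ∈ 𝓖} =
        #𝓖 * #{π : Equiv.Perm V | Q.map π.toEmbedding = Q} := by
    intro 𝓖 h𝓖
    rw [card_eq_sum_card_fiberwise (f := fun π : Equiv.Perm V => Q.map π.toEmbedding) (t := 𝓖)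
      (s := ({π : Equiv.Perm V | Q.map π.toEmbedding ∈ 𝓖} : Finset _))
      (fun π hπ => by simpa using hπ)]
    rw [sum_const_nat (m := #{π : Equiv.Perm V | Q.map π.toEmbedding = Q})]
    intro R hR
    rw [← hconst R (h𝓖 R hR), filter_filter]
    congr 1
    ext π
    simp only [mem_filter, mem_univ, true_and]
    exact ⟨fun h => h.2, fun h => ⟨h ▸ hR, h⟩⟩
  have hall := hsum (powersetCard #Q univ) fun R hR => (mem_powersetCard.1 hR).2
  rw [filter_true_of_mem (fun π _ => by simp [mem_powersetCard]), card_powersetCard, card_univ,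
    card_univ] at hall
  rw [hsum 𝓕 h, hall]
  ring

theorem pow_le_pow_mul_choose {n q : ℕ} (h : q ≤ n) : n ^ q ≤ (q ^ q * q.factorial) * n.choose q :=
    by
  have h1 : n ≤ q * (n + 1 - q) ∨ q = 0 := by
    rcases Nat.eq_zero_or_pos q with h0 | h0
    · exact Or.inr h0
    · left
      obtain ⟨d, rfl⟩ := Nat.exists_eq_add_of_le h
      rw [show q + d + 1 - q = d + 1 by omega]
      nlinarith
  have h2 : (n + 1 - q) ^ q ≤ q.factorial * n.choose q := by
    have := Nat.pow_sub_le_descFactorial n q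
    rwa [Nat.descFactorial_eq_factorial_mul_choose] at this
  rcases h1 with h1 | rfl
  · calc n ^ q ≤ (q * (n + 1 - q)) ^ q := Nat.pow_le_pow_left h1 _
      _ = q ^ q * (n + 1 - q) ^ q := by rw [mul_pow]
      _ ≤ q ^ q * (q.factorial * n.choose q) := Nat.mul_le_mul_left _ h2
      _ = _ := by ring
  · simp

variable {m t : ℕ} {E : Finset (Finset (Fin m))} {P : Finset (Fin m ↪ V)} {Z : Finset (Finset V)}

/-- A constant for estimates of the number of permutations. -/
def permConst (m t : ℕ) : ℕ := (4 * m * t + 1) ^ (4 * m * t + 1) * (4 * m * t + 1).factorial *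
    (32 ^ m * t ^ t)

theorem IsPacking.card_perm_cov_mul_le (hP : IsPacking t E P Z) (hE : ∀ e ∈ E, t ≤ #e)
    (Q : Finset V)
    (hQ : #Q ≤ 4 * m * t + 1) : open Classical in
    #{π : Equiv.Perm V | Cov E P (Q.map π.toEmbedding)} * Fintype.card V ^ #Q ≤
      permConst m t * Fintype.card V ^ t * Fintype.card (Equiv.Perm V) := by
  classical
  have h := card_perm_map_mem {R | #R = #Q ∧ Cov E P R} Q (fun R hR => (mem_filter.1 hR).2.1)
  have h1 : #({R | #R = #Q ∧ Cov E P R} : Finset (Finset V)) ≤ 32 ^ m * t ^ t *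
      Fintype.card V ^ t := by
    have := hP.card_cov_le hE ∅ (by simp)
    simp only [empty_union, card_empty, Nat.sub_zero] at this
    exact (card_le_card fun R hR => by
      rw [mem_filter] at hR ⊢
      exact ⟨hR.1, hR.2.2⟩).trans this
  have h2 : ({π : Equiv.Perm V | Cov E P (Q.map π.toEmbedding)} : Finset _) =
      ({π : Equiv.Perm V | Q.map π.toEmbedding ∈ ({R | #R = #Q ∧ Cov E P R} : Finset _)} :
          Finset _) := by
    ext π
    simp
  rw [h2]
  have h3 := pow_le_pow_mul_choose (card_le_univ Q)
  have h4 : #Q ^ #Q * (#Q).factorial ≤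
      (4 * m * t + 1) ^ (4 * m * t + 1) * (4 * m * t + 1).factorial := by
    refine Nat.mul_le_mul ?_ (Nat.factorial_le hQ)
    exact (Nat.pow_le_pow_left hQ _).trans (Nat.pow_le_pow_right (by omega) hQ)
  set A := #{π : Equiv.Perm V | Q.map π.toEmbedding ∈ ({R | #R = #Q ∧ Cov E P R} : Finset _)}
  set n := Fintype.card V
  set N := Fintype.card (Equiv.Perm V)
  unfold permConst
  set D := (4 * m * t + 1) ^ (4 * m * t + 1) * (4 * m * t + 1).factorial
  calc A * n ^ #Q ≤ A * ((#Q ^ #Q * (#Q).factorial) * n.choose #Q) := Nat.mul_le_mul_left _ h3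
    _ = (#Q ^ #Q * (#Q).factorial) * (A * n.choose #Q) := by ring
    _ ≤ D * (N * (32 ^ m * t ^ t * n ^ t)) := by
        rw [h]
        exact Nat.mul_le_mul h4 (Nat.mul_le_mul_left _ h1)
    _ = _ := by ring

end Perm

section Product

variable {U K : Type*} [Fintype U] [DecidableEq U] [Fintype K] [DecidableEq K]

theorem card_and_mem_mul (u : U) (A : (U → K) → Prop) (hA : ∀ ω y, A (Function.update ω u y) ↔ A ω)
    (S : K → Prop) : open Classical in
    #{ω | A ω ∧ S (ω u)} * Fintype.card K = #{ω | A ω} * #{y | S y} := by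
  classical
  rw [← card_univ, ← card_product, ← card_product]
  refine card_bij' (fun p _ => (Function.update p.1 u p.2, p.1 u))
    (fun p _ => (Function.update p.1 u p.2, p.1 u)) ?_ ?_ ?_ ?_
  · rintro ⟨ω, y⟩ hp
    simp only [mem_product, mem_filter, mem_univ, true_and, and_true] at hp ⊢
    exact ⟨(hA _ _).2 hp.1, hp.2⟩
  · rintro ⟨ω, y⟩ hp
    simp only [mem_product, mem_filter, mem_univ, true_and, and_true, Function.update_self] at hp ⊢
    exact ⟨(hA _ _).2 hp.1, hp.2⟩
  · rintro ⟨ω, y⟩ hp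
    simp
  · rintro ⟨ω, y⟩ hp
    simp

theorem card_forall_mem_ge (W : Finset U) (G : U → K → Prop) (β : ℝ) (h0 : 0 ≤ β)
    (hG : open Classical in ∀ u ∈ W, β * Fintype.card K ≤ #{y | G u y}) : open Classical in
    β ^ #W * Fintype.card (U → K) ≤ #{ω : U → K | ∀ u ∈ W, G u (ω u)} := by
  classical
  have h1 : ({ω : U → K | ∀ u ∈ W, G u (ω u)} : Finset _) =
      Fintype.piFinset fun u => if u ∈ W then ({y | G u y} : Finset _) else univ := by
    ext ω
    simp only [mem_filter, mem_univ, true_and, Fintype.mem_piFinset]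
    refine forall_congr' fun u => ?_
    split_ifs with h <;> simp [h]
  rw [h1, Fintype.card_piFinset, Fintype.card_fun]
  push_cast
  rw [← card_univ (α := U), ← prod_const (s := (univ : Finset U)), ← prod_const (s := W)]
  have h2 : ∏ _u ∈ W, β = ∏ u : U, if u ∈ W then β else 1 := by
    rw [prod_ite_mem, univ_inter]
  rw [h2, ← prod_mul_distrib]
  refine prod_le_prod (fun u _ => ?_) fun u _ => ?_
  · split_ifs <;> positivity
  · split_ifs with h
    · exact hG u h
    · simp

theorem card_forall_eq (A : Finset U) (y : U → K) :
    #{x : U → K | ∀ i ∈ A, x i = y i} = Fintype.card K ^ (Fintype.card U - #A) := by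
  have h1 : ({x : U → K | ∀ i ∈ A, x i = y i} : Finset _) =
      Fintype.piFinset fun i => if i ∈ A then {y i} else univ := by
    ext ω
    simp only [mem_filter, mem_univ, true_and, Fintype.mem_piFinset]
    refine forall_congr' fun u => ?_
    split_ifs with h <;> simp [h]
  rw [h1, Fintype.card_piFinset]
  have h2 : ∏ i : U, #(if i ∈ A then ({y i} : Finset K) else univ) =
      ∏ i : U, if i ∈ A then 1 else Fintype.card K := by
    refine prod_congr rfl fun i _ => ?_
    split_ifs <;> simp
  rw [h2, prod_ite, prod_const_one, prod_const, one_mul, filter_notMem_eq_sdiff,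
    card_sdiff_of_subset (subset_univ _), card_univ]

end Product

section NewCopy

variable {m t : ℕ} {U V X : Type*} [Fintype U] [Fintype V] [DecidableEq V] [DecidableEq X]
  {E : Finset (Finset (Fin m))} {P : Finset (Fin m ↪ V)} {Z : Finset (Finset V)}

/-- The lift of an embedding `f` to the product, with second coordinates `x`. -/
def newEmb (f : Fin m ↪ V) (x : Fin m → X) : Fin m ↪ V × X :=
  ⟨fun i => (f i, x i), fun _ _ h => f.injective (Prod.ext_iff.1 h).1⟩

@[simp] theorem newEmb_apply (f : Fin m ↪ V) (x : Fin m → X) (i : Fin m) :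
    newEmb f x i = (f i, x i) := rfl

theorem mem_map_old {c : U → V → X} {σ : U → Equiv.Perm V} {u : U} {g : Fin m ↪ V}
    {e : Finset (Fin m)} {p : V × X} :
    p ∈ e.map (g.trans (blowEmb c σ u)) ↔ c u p.1 = p.2 ∧ (σ u).symm p.1 ∈ e.map g := by
  constructor
  · intro h
    obtain ⟨i, hi, rfl⟩ := Finset.mem_map.1 h
    simpa using hi
  · rintro ⟨h1, h2⟩
    obtain ⟨i, hi, h⟩ := Finset.mem_map.1 h2
    refine Finset.mem_map.2 ⟨i, hi, ?_⟩
    have h : σ u (g i) = p.1 := by rw [h]; simp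
    ext
    · simp [h]
    · simp [h, h1]

/-- The condition on a permutation that makes a new copy compatible with a special codeword. -/
def Ok (t : ℕ) (E : Finset (Finset (Fin m))) (P : Finset (Fin m ↪ V)) (Z : Finset (Finset V))
    (c : U → V → X) (f : Fin m ↪ V) (x : Fin m → X) (u : U) (τ : Equiv.Perm V) : Prop :=
  (∀ Q ⊆ univ.map f, #Q = t + 1 → ¬ Cov E P (Q.map τ.toEmbedding)) ∧
  (#(agr (pull c f) x u) = t →
    ((∃ e ∈ E, agr (pull c f) x u ⊆ e) → ((agr (pull c f) x u).map f).map τ.toEmbedding ∉ Z ∧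
      ¬ Cov E P (((agr (pull c f) x u).map f).map τ.toEmbedding)) ∧
    ((¬ ∃ e ∈ E, agr (pull c f) x u ⊆ e) → ((agr (pull c f) x u).map f).map τ.toEmbedding ∈ Z))

/-- A copy that can be added to a packing. -/
structure Addable {V : Type*} [DecidableEq V] (t : ℕ) (E : Finset (Finset (Fin m)))
    (P : Finset (Fin m ↪ V))
    (Z : Finset (Finset V)) (f : Fin m ↪ V) : Prop where
  edge_notMem : ∀ e ∈ E, ∀ T ⊆ e, #T = t → T.map f ∉ Z
  nonedge_mem : ∀ T : Finset (Fin m), #T = t → (∀ e ∈ E, ¬ T ⊆ e) → T.map f ∈ Z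
  inter_lt : ∀ g ∈ P, ∀ e ∈ E, ∀ e' ∈ E, #(e.map f ∩ e'.map g) < t
  not_clash : ∀ g ∈ P, ∀ h ∈ P, g ≠ h → ∀ e₁ ∈ E, ∀ e₂ ∈ E, ∀ e₃ ∈ E,
    ¬ Clash t (e₁.map f) (e₂.map g) (e₃.map h)

variable {c : U → V → X} {σ : U → Equiv.Perm V} {f : Fin m ↪ V} {x : Fin m → X}

theorem image_fst_newEmb (e : Finset (Fin m)) : (e.map (newEmb f x)).image Prod.fst = e.map f := by
  rw [map_eq_image, image_image, map_eq_image]; rfl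

theorem image_fst_old {u : U} {g : Fin m ↪ V} (hu : σ u = 1) (e : Finset (Fin m)) :
    (e.map (g.trans (blowEmb c σ u))).image Prod.fst = e.map g := by
  rw [map_eq_image, image_image, map_eq_image]
  refine image_congr fun i _ => ?_
  simp [hu]

theorem injOn_fst_newEmb (e : Finset (Fin m)) : Set.InjOn Prod.fst (e.map (newEmb f x) :
    Set (V × X)) := by
  intro p hp p' hp' h
  obtain ⟨i, -, rfl⟩ := Finset.mem_map.1 hp
  obtain ⟨j, -, rfl⟩ := Finset.mem_map.1 hp'
  rw [f.injective h]

theorem injOn_fst_graph (y : V → X) : Set.InjOn Prod.fst (graph y : Set (V × X)) := by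
  rintro p hp p' hp' h
  simp only [mem_coe, mem_graph] at hp hp'
  exact Prod.ext h (by rw [← hp, ← hp', h])

theorem injOn_fst_old {u : U} {g : Fin m ↪ V} (e : Finset (Fin m)) :
    Set.InjOn Prod.fst (e.map (g.trans (blowEmb c σ u)) : Set (V × X)) :=
  (injOn_fst_graph (c u)).mono (coe_subset.2 (map_trans_subset_graph u g e))

theorem card_inter_le_of_image {A B : Finset (V × X)} {A' B' : Finset V}
    (hA : Set.InjOn Prod.fst (A : Set (V × X))) (h : A.image Prod.fst = A')
        (h' : B.image Prod.fst ⊆ B') :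
    #(A ∩ B) ≤ #(A' ∩ B') := by
  rw [← card_image_of_injOn (hA.mono (s₁ := ((A ∩ B : Finset _) : Set _)) (by simp))]
  refine card_le_card ((image_inter_subset _ _ _).trans ?_)
  rw [h]
  exact inter_subset_inter le_rfl h'

theorem subset_agr_of_map_subset {T : Finset (Fin m)} {u : U}
    (h : T.map (newEmb f x) ⊆ graph (c u)) :
    T ⊆ agr (pull c f) x u := by
  intro i hi
  have := h (mem_map_of_mem _ hi)
  simpa [pull] using this

theorem map_newEmb_inter_graph (u : U) (e : Finset (Fin m)) :
    e.map (newEmb f x) ∩ graph (c u) ⊆ (agr (pull c f) x u).map (newEmb f x) := by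
  intro p hp
  rw [mem_inter] at hp
  obtain ⟨i, hi, rfl⟩ := Finset.mem_map.1 hp.1
  refine mem_map_of_mem _ ?_
  simpa [pull] using hp.2

theorem InW.of_card {u : U} (h : t ≤ #(agr (pull c f) x u)) : InW t (pull c f) x u := Or.inl h

theorem not_clash_of_inW (hR : Rigid t c f x) {u u' : U} (hne : u ≠ u')
    (hW : InW t (pull c f) x u) (hok : Ok t E P Z c f x u (σ u).symm) {g g' : Fin m ↪ V}
        (hg : g ∈ P)
    {e e₁ e₂ : Finset (Fin m)} (he₁ : e₁ ∈ E)
    (h1 : #(e.map (newEmb f x) ∩ e₁.map (g.trans (blowEmb c σ u))) < t)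
    (h2 : #(e.map (newEmb f x) ∩ e₂.map (g'.trans (blowEmb c σ u'))) < t) :
    ¬ Clash t (e.map (newEmb f x)) (e₁.map (g.trans (blowEmb c σ u)))
      (e₂.map (g'.trans (blowEmb c σ u'))) := by
  intro hcl
  have hcl' := hcl.swap.rotate.swap
  have hcl'' := hcl'.rotate.rotate
  set a := e.map (newEmb f x)
  set b := e₁.map (g.trans (blowEmb c σ u))
  set b' := e₂.map (g'.trans (blowEmb c σ u'))
  have k1 : t + 1 ≤ #(b' ∩ (a ∪ b)) := by unfold Clash at hcl; omega
  have k2 : t + 1 ≤ #(b ∩ (a ∪ b')) := by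
    have hx : Clash t a b' b := by
      rw [clash_iff] at hcl ⊢
      rw [union_assoc, union_comm b' b, ← union_assoc]; omega
    unfold Clash at hx; omega
  have inj' : Set.InjOn Prod.fst (b' ∩ (a ∪ b) : Set (V × X)) :=
    (injOn_fst_old (c := c) (σ := σ) (u := u') (g := g') e₂).mono Set.inter_subset_left
  have inj : Set.InjOn Prod.fst (b ∩ (a ∪ b') : Set (V × X)) :=
    (injOn_fst_old (c := c) (σ := σ) (u := u) (g := g) e₁).mono Set.inter_subset_left
  have hJ : (b' ∩ (a ∪ b)).image Prod.fst ⊆ univ.map f := by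
    intro v hv
    obtain ⟨J, hvJ, hJs, hJ⟩ := exists_subsuperset_card_eq (n := t + 1) (singleton_subset_iff.2 hv)
      (by simp) (by rw [card_image_of_injOn (by simpa using inj')]; exact k1)
    refine hR u u' hW hne J hJ ?_ (singleton_subset_iff.1 hvJ)
    intro w hw
    obtain ⟨p, hp, rfl⟩ := mem_image.1 (hJs hw)
    rw [mem_inter, mem_union] at hp
    have hp1 := (mem_map_old.1 hp.1).1
    rcases hp.2 with h | h
    · right
      obtain ⟨i, -, rfl⟩ := Finset.mem_map.1 h
      exact ⟨i, rfl, hp1⟩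
    · left
      rw [hp1, (mem_map_old.1 h).1]
  have hQ : (b ∩ (a ∪ b')).image Prod.fst ⊆ univ.map f := by
    intro v hv
    obtain ⟨p, hp, rfl⟩ := mem_image.1 hv
    rw [mem_inter, mem_union] at hp
    rcases hp.2 with h | h
    · obtain ⟨i, -, rfl⟩ := Finset.mem_map.1 h
      exact mem_map_of_mem _ (mem_univ _)
    · exact hJ (mem_image_of_mem _ (mem_inter.2 ⟨h, mem_union_right _ hp.1⟩))
  obtain ⟨Q, hQs, hQc⟩ := exists_subset_card_eq (n := t + 1) (s := (b ∩ (a ∪ b')).image Prod.fst)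
    (by rw [card_image_of_injOn (by simpa using inj)]; exact k2)
  refine hok.1 Q (hQs.trans hQ) hQc ⟨g, hg, e₁, he₁, ?_⟩
  intro w hw
  obtain ⟨v, hv, rfl⟩ := Finset.mem_map.1 hw
  obtain ⟨p, hp, rfl⟩ := mem_image.1 (hQs hv)
  exact (mem_map_old.1 (mem_inter.1 hp).1).2

theorem IsPacking.not_clash_lift (hP : IsPacking t E P Z) (hc : IsCode t c) (hf : f ∈ P) {u u' : U}
    (hne : u ≠ u') (hW : ¬ InW t (pull c f) x u) (hW' : ¬ InW t (pull c f) x u')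
    (hσ : σ u = 1) (hσ' : σ u' = 1) {g g' : Fin m ↪ V} (hg : g ∈ P) (hg' : g' ∈ P)
    {e e₁ e₂ : Finset (Fin m)} (he : e ∈ E) (he₁ : e₁ ∈ E) (he₂ : e₂ ∈ E)
    (h1 : #(e.map (newEmb f x) ∩ e₁.map (g.trans (blowEmb c σ u))) < t)
    (h2 : #(e.map (newEmb f x) ∩ e₂.map (g'.trans (blowEmb c σ u'))) < t) :
    ¬ Clash t (e.map (newEmb f x)) (e₁.map (g.trans (blowEmb c σ u)))
      (e₂.map (g'.trans (blowEmb c σ u'))) := by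
  intro hcl
  by_cases hfg : f = g
  · by_cases hfg' : f = g'
    · subst hfg; subst hfg'
      let φ : Fin m × X ↪ V × X := f.prodMap (Function.Embedding.refl X)
      have k0 : ∀ e : Finset (Fin m), e.map (newEmb f x) = (e.map (graphEmb x)).map φ := by
        intro e; rw [Finset.map_map]; rfl
      have k1 : ∀ u, σ u = 1 → ∀ e : Finset (Fin m), e.map (f.trans (blowEmb c σ u)) =
          (e.map (graphEmb (pull c f u))).map φ := by
        intro u hu e
        rw [Finset.map_map]
        congr 1
        ext i <;> simp [φ, pull, hu]
      rw [k0, k1 u hσ, k1 u' hσ', clash_map] at hcl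
      refine hW (Or.inr ⟨u', hne, ?_, ?_, hcl.mono (map_graphEmb_subset _ _)
        (map_graphEmb_subset _ _) (map_graphEmb_subset _ _)⟩)
      · by_contra! h; exact hW (Or.inl h)
      · by_contra! h; exact hW' (Or.inl h)
    · subst hfg
      refine not_clash_of_card h1.le ?_ hcl
      refine (card_inter_le_of_image (injOn_fst_old e₂) (image_fst_old hσ' e₂) ?_).trans_lt
        (hP.inter_range_lt hf hg' hfg' he₂)
      rw [image_union, image_fst_newEmb, image_fst_old hσ]
      exact union_subset (map_subset_map.2 (subset_univ _)) (map_subset_map.2 (subset_univ _))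
  · by_cases hfg' : f = g'
    · subst hfg'
      have hx : Clash t (e.map (newEmb f x)) (e₂.map (f.trans (blowEmb c σ u')))
          (e₁.map (g.trans (blowEmb c σ u))) := by
        exact hcl.rotate.rotate.swap
      refine not_clash_of_card h2.le ?_ hx
      refine (card_inter_le_of_image (injOn_fst_old e₁) (image_fst_old hσ e₁) ?_).trans_lt
        (hP.inter_range_lt hf hg hfg he₁)
      rw [image_union, image_fst_newEmb, image_fst_old hσ']
      exact union_subset (map_subset_map.2 (subset_univ _)) (map_subset_map.2 (subset_univ _))
    · by_cases hgg : g = g'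
      · subst hgg
        refine not_clash_of_card ?_ ?_ hcl.rotate
        · exact ((card_le_card (inter_subset_inter (map_trans_subset_graph u g e₁)
            (map_trans_subset_graph u' g e₂))).trans_lt (hc.graph_inter_lt hne)).le
        · refine (card_inter_le_of_image (injOn_fst_newEmb e) (image_fst_newEmb e) ?_).trans_lt
            (hP.inter_range_lt hg hf (Ne.symm hfg) he)
          rw [image_union, image_fst_old hσ, image_fst_old hσ']
          exact union_subset (map_subset_map.2 (subset_univ _)) (map_subset_map.2 (subset_univ _))
      · have := hcl.image Prod.fst (injOn_fst_newEmb e) (injOn_fst_old e₂)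
        rw [image_fst_newEmb, image_fst_old hσ, image_fst_old hσ'] at this
        exact hP.not_clash f hf g hg g' hg' hfg hfg' hgg e he e₁ he₁ e₂ he₂ this

theorem IsPacking.addable [Fintype X] [Nonempty X] (hP : IsPacking t E P Z) (hc : IsCode t c)
    (hU : Fintype.card U = Fintype.card X ^ t) (hf : f ∈ P)
    (h2 : ∀ u, #(agr (pull c f) x u) ≤ t) (hR : Rigid t c f x)
    (hok : ∀ u, InW t (pull c f) x u → Ok t E P Z c f x u (σ u).symm)
    (hbad : ∀ u u', u ≠ u' → ¬ InW t (pull c f) x u → ¬ InW t (pull c f) x u' → σ u' ≠ 1 →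
      ∀ g ∈ P, ∀ g' ∈ P, ∀ e ∈ E, ∀ e₁ ∈ E, ∀ e₂ ∈ E,
        ¬ Clash t (e.map (newEmb f x)) (e₁.map (g.trans (blowEmb c σ u)))
          (e₂.map (g'.trans (blowEmb c σ u')))) :
    Addable t E (blowP c σ P) (blowZ c σ Z) (newEmb f x) := by
  have agr_eq : ∀ {T : Finset (Fin m)} {u}, #T = t → T ⊆ agr (pull c f) x u →
      agr (pull c f) x u = T := fun hT h => (eq_of_subset_of_card_le h
          (by rw [hT]; exact h2 _)).symm
  have inter : ∀ g ∈ P, ∀ u, ∀ e ∈ E, ∀ e' ∈ E,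
      #(e.map (newEmb f x) ∩ e'.map (g.trans (blowEmb c σ u))) < t := by
    intro g hg u e he e' he'
    by_contra! hcon
    obtain ⟨Q, hQ, hQc⟩ := exists_subset_card_eq hcon
    obtain ⟨T, hT, rfl⟩ := exists_map_eq_of_subset_map (hQ.trans inter_subset_left)
    rw [card_map] at hQc
    have hTb := hQ.trans inter_subset_right
    have hTa := subset_agr_of_map_subset (hTb.trans (map_trans_subset_graph u g e'))
    have h := agr_eq hQc hTa
    have hW : InW t (pull c f) x u := InW.of_card (by rw [h, hQc])
    have := ((hok u hW).2 (by rw [h, hQc])).1 ⟨e, he, by rw [h]; exact hT⟩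
    refine this.2 ⟨g, hg, e', he', ?_⟩
    rw [h]
    intro w hw
    obtain ⟨v, hv, rfl⟩ := Finset.mem_map.1 hw
    obtain ⟨i, hi, rfl⟩ := Finset.mem_map.1 hv
    exact (mem_map_old.1 (hTb (mem_map_of_mem _ hi))).2
  constructor
  · intro e he T hT hTc hmem
    obtain ⟨u, R, hRZ, hRT⟩ := mem_blowZ.1 hmem
    have hTa : T ⊆ agr (pull c f) x u := by
      refine subset_agr_of_map_subset ?_
      rw [← hRT]; exact map_blowEmb_subset _ _ _ _
    have h := agr_eq hTc hTa
    have hW : InW t (pull c f) x u := InW.of_card (by rw [h, hTc])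
    refine (((hok u hW).2 (by rw [h, hTc])).1 ⟨e, he, by rw [h]; exact hT⟩).1 ?_
    rw [h]
    convert hRZ
    have h3 := congrArg (fun s => s.image (fun p : V × X => (σ u).symm p.1)) hRT
    simp only [map_eq_image, image_image] at h3
    rw [map_eq_image, map_eq_image, image_image]
    refine Eq.trans ?_ (h3.symm.trans ?_)
    · rfl
    · conv_rhs => rw [← image_id (s := R)]
      refine image_congr fun v _ => ?_
      simp
  · intro T hTc hT
    obtain ⟨u, hu⟩ := hc.exists_eq hU (A := T.map f) (by rw [card_map, hTc]) 
      (Function.extend f x fun _ => Classical.arbitrary X)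
    have hTa : T ⊆ agr (pull c f) x u := by
      intro i hi
      have := hu (f i) (mem_map_of_mem _ hi)
      rw [f.injective.extend_apply] at this
      simpa [pull] using this
    have h := agr_eq hTc hTa
    have hW : InW t (pull c f) x u := InW.of_card (by rw [h, hTc])
    have := ((hok u hW).2 (by rw [h, hTc])).2 (by rw [h]; push Not; exact hT)
    rw [h] at this
    refine mem_blowZ.2 ⟨u, _, this, ?_⟩
    rw [Finset.map_map, Finset.map_map]
    ext p
    simp only [Finset.mem_map]
    refine exists_congr fun i => and_congr_right fun hi => ?_
    have : c u (f i) = x i := by simpa [pull] using hTa hi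
    simp [this]
  · intro h hh e he e' he'
    obtain ⟨u, g, hg, rfl⟩ := mem_blowP.1 hh
    exact inter g hg u e he e' he'
  · intro h hh h' hh' hne e he e₁ he₁ e₂ he₂ hcl
    obtain ⟨u, g, hg, rfl⟩ := mem_blowP.1 hh
    obtain ⟨u', g', hg', rfl⟩ := mem_blowP.1 hh'
    have hcl' : Clash t (e.map (newEmb f x)) (e₂.map (g'.trans (blowEmb c σ u')))
          (e₁.map (g.trans (blowEmb c σ u))) := hcl.rotate.rotate.swap
    by_cases huu : u = u'
    · subst huu
      have hgg : g ≠ g' := fun h => hne (by rw [h])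
      refine not_clash_of_card' ?_ ?_ hcl.rotate
      · rw [← Finset.map_map, ← Finset.map_map, ← map_inter, card_map]
        exact hP.inter_lt g hg g' hg' hgg e₁ he₁ e₂ he₂
      · refine le_trans (card_le_card ?_) ((card_map (newEmb f x)).trans_le (h2 u))
        refine (inter_subset_inter le_rfl (union_subset (map_trans_subset_graph u g e₁)
          (map_trans_subset_graph u g' e₂))).trans ?_
        exact map_newEmb_inter_graph u e
    · by_cases hW : InW t (pull c f) x u
      · exact not_clash_of_inW hR huu hW (hok u hW) hg he₁ (inter g hg u e he e₁ he₁)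
          (inter g' hg' u' e he e₂ he₂) hcl
      by_cases hW' : InW t (pull c f) x u'
      · exact not_clash_of_inW hR (Ne.symm huu) hW' (hok u' hW') hg' he₂
          (inter g' hg' u' e he e₂ he₂) (inter g hg u e he e₁ he₁) hcl'
      by_cases hσ : σ u = 1
      · by_cases hσ' : σ u' = 1
        · exact hP.not_clash_lift hc hf huu hW hW' hσ hσ' hg hg' he he₁ he₂
            (inter g hg u e he e₁ he₁) (inter g' hg' u' e he e₂ he₂) hcl
        · exact hbad u u' huu hW hW' hσ' g hg g' hg' e he e₁ he₁ e₂ he₂ hcl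
      · exact hbad u' u (Ne.symm huu) hW' hW hσ g' hg' g hg e he e₂ he₂ e₁ he₁ hcl'

end NewCopy

section Conflict

variable {m t : ℕ} {V : Type*} [DecidableEq V]
  {E : Finset (Finset (Fin m))} {P : Finset (Fin m ↪ V)} {Z : Finset (Finset V)}

/-- Two copies have edges that share at least `t` vertices. -/
def Share (t : ℕ) (E : Finset (Finset (Fin m))) (f g : Fin m ↪ V) : Prop :=
  ∃ e ∈ E, ∃ e' ∈ E, t ≤ #(e.map f ∩ e'.map g)

/-- Three copies have edges that clash. -/
def Clash₃ (t : ℕ) (E : Finset (Finset (Fin m))) (f g h : Fin m ↪ V) : Prop :=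
  ∃ e₁ ∈ E, ∃ e₂ ∈ E, ∃ e₃ ∈ E, Clash t (e₁.map f) (e₂.map g) (e₃.map h)

theorem Share.symm {f g : Fin m ↪ V} (h : Share t E f g) : Share t E g f := by
  obtain ⟨e, he, e', he', h⟩ := h
  exact ⟨e', he', e, he, by rwa [inter_comm]⟩

theorem Clash₃.swap {f g h : Fin m ↪ V} (H : Clash₃ t E f g h) : Clash₃ t E g f h := by
  obtain ⟨e₁, h₁, e₂, h₂, e₃, h₃, H⟩ := H
  exact ⟨e₂, h₂, e₁, h₁, e₃, h₃, H.swap⟩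

theorem Clash₃.rotate {f g h : Fin m ↪ V} (H : Clash₃ t E f g h) : Clash₃ t E g h f := by
  obtain ⟨e₁, h₁, e₂, h₂, e₃, h₃, H⟩ := H
  exact ⟨e₂, h₂, e₃, h₃, e₁, h₁, H.rotate⟩

theorem not_share {f g : Fin m ↪ V} :
    ¬ Share t E f g ↔ ∀ e ∈ E, ∀ e' ∈ E, #(e.map f ∩ e'.map g) < t := by
  unfold Share; push Not; rfl

theorem IsPacking.union [DecidableEq (Fin m ↪ V)] (hP : IsPacking t E P Z) {R : Finset (Fin m ↪ V)}
    (hR : ∀ f ∈ R, Addable t E P Z f) (h2 : ∀ f ∈ R, ∀ g ∈ R, f ≠ g → ¬ Share t E f g)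
    (h2' : ∀ f ∈ R, ∀ g ∈ R, f ≠ g → ∀ h ∈ P, ¬ Clash₃ t E f g h)
    (h3 : ∀ f ∈ R, ∀ g ∈ R, ∀ h ∈ R, f ≠ g → f ≠ h → g ≠ h → ¬ Clash₃ t E f g h) :
    IsPacking t E (P ∪ R) Z := by
  have hadd : ∀ f ∈ R, ∀ g ∈ P, ∀ h ∈ P, g ≠ h → ¬ Clash₃ t E f g h := by
    rintro f hf g hg h hh hgh ⟨e₁, h₁, e₂, h₂, e₃, h₃, H⟩
    exact (hR f hf).not_clash g hg h hh hgh e₁ h₁ e₂ h₂ e₃ h₃ H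
  refine ⟨hP.card_eq, ?_, ?_, ?_, ?_⟩
  · intro f hf
    rcases mem_union.1 hf with hf | hf
    · exact hP.edge_notMem f hf
    · exact (hR f hf).edge_notMem
  · intro f hf
    rcases mem_union.1 hf with hf | hf
    · exact hP.nonedge_mem f hf
    · exact (hR f hf).nonedge_mem
  · intro f hf g hg hfg
    rcases mem_union.1 hf with hf | hf <;> rcases mem_union.1 hg with hg | hg
    · exact hP.inter_lt f hf g hg hfg
    · intro e he e' he'
      rw [inter_comm]
      exact (hR g hg).inter_lt f hf e' he' e he
    · exact (hR f hf).inter_lt g hg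
    · exact not_share.1 (h2 f hf g hg hfg)
  · intro f hf g hg h hh hfg hfh hgh e₁ h₁ e₂ h₂ e₃ h₃ H
    have H₃ : Clash₃ t E f g h := ⟨e₁, h₁, e₂, h₂, e₃, h₃, H⟩
    rcases mem_union.1 hf with hf | hf <;> rcases mem_union.1 hg with hg | hg <;>
      rcases mem_union.1 hh with hh | hh
    · exact hP.not_clash f hf g hg h hh hfg hfh hgh e₁ h₁ e₂ h₂ e₃ h₃ H
    · exact hadd h hh f hf g hg hfg H₃.rotate.rotate
    · exact hadd g hg f hf h hh hfh H₃.swap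
    · exact h2' g hg h hh hgh f hf H₃.rotate
    · exact hadd f hf g hg h hh hgh H₃
    · exact h2' f hf h hh hfh g hg H₃.rotate.rotate.swap
    · exact h2' f hf g hg hfg h hh H₃
    · exact h3 f hf g hg h hh hfg hfh hgh H₃

end Conflict

section Greedy

variable {α : Type*} [DecidableEq α]

/-- A set without conflicting pairs and triples. -/
def ConflictFree (C₂ : α → α → Prop) (C₃ : α → α → α → Prop) (R : Finset α) : Prop :=
  (∀ a ∈ R, ∀ b ∈ R, a ≠ b → ¬ C₂ a b) ∧
    ∀ a ∈ R, ∀ b ∈ R, ∀ c ∈ R, a ≠ b → a ≠ c → b ≠ c → ¬ C₃ a b c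

theorem exists_conflictFree (A : Finset α) (C₂ : α → α → Prop) (C₃ : α → α → α → Prop)
    (symm : ∀ a b, C₂ a b → C₂ b a) (rotate : ∀ a b c, C₃ a b c → C₃ b c a) (D₂ D₃ : ℕ)
    (h2 : open Classical in ∀ a ∈ A, #{b ∈ A | C₂ a b} ≤ D₂)
    (h3 : open Classical in ∀ R ⊆ A, ConflictFree C₂ C₃ R → ∀ a ∈ R,
      #{p ∈ R ×ˢ A | a ≠ p.1 ∧ ¬ C₂ a p.1 ∧ ¬ C₂ a p.2 ∧ ¬ C₂ p.1 p.2 ∧ C₃ a p.1 p.2} ≤ D₃) :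
    ∃ R ⊆ A, ConflictFree C₂ C₃ R ∧ #A ≤ #R * (1 + D₂ + D₃) := by
  classical
  obtain ⟨R, hR, hmax⟩ := exists_max_image (A.powerset.filter (ConflictFree C₂ C₃)) card
    ⟨∅, by simp [ConflictFree]⟩
  simp only [mem_filter, mem_powerset] at hR hmax
  refine ⟨R, hR.1, hR.2, ?_⟩
  have hsub : A ⊆ R ∪ R.biUnion (fun a => {b ∈ A | C₂ a b}) ∪ R.biUnion (fun a =>
      ({p ∈ R ×ˢ A | a ≠ p.1 ∧ ¬ C₂ a p.1 ∧ ¬ C₂ a p.2 ∧ ¬ C₂ p.1 p.2 ∧ C₃ a p.1 p.2} :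
        Finset _).image Prod.snd) := by
    intro y hy
    by_cases hyR : y ∈ R
    · exact mem_union_left _ (mem_union_left _ hyR)
    by_cases hC : ∃ a ∈ R, C₂ a y
    · obtain ⟨a, ha, h⟩ := hC
      exact mem_union_left _ (mem_union_right _ (mem_biUnion.2 ⟨a, ha, mem_filter.2 ⟨hy, h⟩⟩))
    push Not at hC
    have hnot : ¬ ConflictFree C₂ C₃ (insert y R) := fun h => by
      have := hmax (insert y R) ⟨insert_subset hy hR.1, h⟩
      rw [card_insert_of_notMem hyR] at this
      omega
    have h2' : ∀ a ∈ insert y R, ∀ b ∈ insert y R, a ≠ b → ¬ C₂ a b := by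
      intro a ha b hb hab h
      rcases mem_insert.1 ha with rfl | ha' <;> rcases mem_insert.1 hb with rfl | hb'
      · exact hab rfl
      · exact hC b hb' (symm _ _ h)
      · exact hC a ha' h
      · exact hR.2.1 a ha' b hb' hab h
    suffices h : ∃ a ∈ R, ∃ b ∈ R, a ≠ b ∧ C₃ a b y by
      obtain ⟨a, ha, b, hb, hab, h⟩ := h
      refine mem_union_right _ (mem_biUnion.2 ⟨a, ha,
          mem_image.2 ⟨(a, y).map (fun _ => b) id, ?_, rfl⟩⟩)
      simp only [Prod.map, id, mem_filter, mem_product]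
      exact ⟨⟨hb, hy⟩, hab, hR.2.1 a ha b hb hab, hC a ha, hC b hb, h⟩
    by_contra! hcon
    refine hnot ⟨h2', ?_⟩
    intro a ha b hb c hc hab hac hbc h
    rcases mem_insert.1 ha with rfl | ha'
    · rcases mem_insert.1 hb with rfl | hb'
      · exact hab rfl
      rcases mem_insert.1 hc with rfl | hc'
      · exact hac rfl
      exact hcon b hb' c hc' hbc (rotate _ _ _ h)
    rcases mem_insert.1 hb with rfl | hb'
    · rcases mem_insert.1 hc with rfl | hc'
      · exact hbc rfl
      exact hcon c hc' a ha' hac.symm (rotate _ _ _ (rotate _ _ _ h))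
    rcases mem_insert.1 hc with rfl | hc'
    · exact hcon a ha' b hb' hab h
    exact hR.2.2 a ha' b hb' c hc' hab hac hbc h
  calc #A ≤ #R + #R * D₂ + #R * D₃ := by
        refine (card_le_card hsub).trans ((card_union_le _ _).trans (add_le_add
          ((card_union_le _ _).trans (add_le_add le_rfl ?_)) ?_))
        · exact card_biUnion_le_card_mul _ _ _ fun a ha => h2 a (hR.1 ha)
        · exact card_biUnion_le_card_mul _ _ _ fun a ha =>
            card_image_le.trans (h3 R hR.1 hR.2 a ha)
    _ = _ := by ring

end Greedy

section NewConflict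

variable {m t : ℕ} {V X : Type*} [Fintype V] [DecidableEq V] [Fintype X] [DecidableEq X]
  {E : Finset (Finset (Fin m))} {P : Finset (Fin m ↪ V)} {Z : Finset (Finset V)}

theorem card_newEmb_inter_le (f g : Fin m ↪ V) (x y : Fin m → X) (e e' : Finset (Fin m)) :
    #(e.map (newEmb f x) ∩ e'.map (newEmb g y)) ≤ #(e.map f ∩ e'.map g) :=
  card_inter_le_of_image (injOn_fst_newEmb e) (image_fst_newEmb e) (image_fst_newEmb e').le

theorem newEmb_inter_same (f : Fin m ↪ V) (x y : Fin m → X) (e e' : Finset (Fin m)) :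
    e.map (newEmb f x) ∩ e'.map (newEmb f y) = ({i ∈ e ∩ e' | x i = y i} : Finset _).map
        (newEmb f x) := by
  ext p
  simp only [mem_inter, Finset.mem_map, mem_filter, newEmb_apply]
  constructor
  · rintro ⟨⟨i, hi, rfl⟩, j, hj, h⟩
    have h1 := f.injective (Prod.ext_iff.1 h).1
    subst h1
    exact ⟨j, ⟨⟨hi, hj⟩, (Prod.ext_iff.1 h).2.symm⟩, rfl⟩
  · rintro ⟨i, ⟨⟨hi, hj⟩, h⟩, rfl⟩
    exact ⟨⟨i, hi, rfl⟩, i, hj, by rw [h]⟩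

theorem card_forall_eq_eq {A B : Finset (Fin m)} (h : Disjoint A B) (x y : Fin m → X) :
    #{z : Fin m → X | (∀ i ∈ A, z i = x i) ∧ ∀ i ∈ B, z i = y i} =
      Fintype.card X ^ (m - (#A + #B)) := by
  have := card_forall_eq (A ∪ B) (A.piecewise x y)
  rw [card_union_of_disjoint h, Fintype.card_fin] at this
  rw [← this]
  congr 1
  ext z
  simp only [mem_filter, mem_univ, true_and, mem_union]
  constructor
  · rintro ⟨h1, h2⟩ i (hi | hi)
    · simpa [hi] using h1 i hi
    · have : i ∉ A := fun hA => disjoint_left.1 h hA hi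
      simpa [this] using h2 i hi
  · intro hz
    refine ⟨fun i hi => by simpa [hi] using hz i (Or.inl hi), fun i hi => ?_⟩
    have : i ∉ A := fun hA => disjoint_left.1 h hA hi
    simpa [this] using hz i (Or.inr hi)

theorem IsPacking.card_share_le (hP : IsPacking t E P Z) {f : Fin m ↪ V} (hf : f ∈ P)
    (x : Fin m → X) : open Classical in
    #{y ∈ P ×ˢ (univ : Finset (Fin m → X)) | Share t E (newEmb f x) (newEmb y.1 y.2)} ≤
      2 ^ m * Fintype.card X ^ (m - t) := by
  classical
  let F : Finset (Fin m) → Finset ((Fin m ↪ V) × (Fin m → X)) := fun T =>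
    {f} ×ˢ ({y | #T = t ∧ ∀ i ∈ T, y i = x i} : Finset _)
  have hsub : ({y ∈ P ×ˢ (univ : Finset (Fin m → X)) | Share t E (newEmb f x) (newEmb y.1 y.2)} :
      Finset _) ⊆ univ.biUnion F := by
    rintro ⟨g, y⟩ hy
    obtain ⟨hg, e, he, e', he', h⟩ := mem_filter.1 hy
    simp only [mem_product, mem_univ, and_true] at hg h
    have hfg : f = g := by
      by_contra hne
      have := hP.inter_lt f hf g hg hne e he e' he'
      have := card_newEmb_inter_le f g x y e e'
      omega
    subst hfg
    rw [newEmb_inter_same, card_map] at h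
    obtain ⟨T, hT, hTc⟩ := exists_subset_card_eq h
    refine mem_biUnion.2 ⟨T, mem_univ _, ?_⟩
    simp only [F, mem_product, mem_singleton, mem_filter, mem_univ, true_and]
    exact ⟨hTc, fun i hi => (mem_filter.1 (hT hi)).2.symm⟩
  refine (card_le_card hsub).trans ((card_biUnion_le_card_mul _ _ (Fintype.card X ^ (m - t))
    fun T _ => ?_).trans (by simp))
  rw [card_product, card_singleton, one_mul]
  by_cases hT : #T = t
  · simp only [hT, true_and]
    have := card_forall_eq T x
    rw [Fintype.card_fin, hT] at this
    exact le_of_eq (by convert this)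
  · simp [hT]

theorem IsPacking.card_clash₃_le (hP : IsPacking t E P Z) (hE : ∀ e ∈ E, t ≤ #e) (htm : t ≤ m)
    [Nonempty X] {f : Fin m ↪ V} (hf : f ∈ P) (x : Fin m → X)
        (R : Finset ((Fin m ↪ V) × (Fin m → X)))
    (hR : ∀ a ∈ R, a.1 ∈ P)
    (hRs : ∀ a ∈ R, ∀ b ∈ R, a ≠ b → ¬ Share t E (newEmb a.1 a.2) (newEmb b.1 b.2)) :
    open Classical in
    #{p ∈ R ×ˢ (P ×ˢ (univ : Finset (Fin m → X))) |
      ¬ Share t E (newEmb f x) (newEmb p.1.1 p.1.2) ∧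
      ¬ Share t E (newEmb f x) (newEmb p.2.1 p.2.2) ∧
      ¬ Share t E (newEmb p.1.1 p.1.2) (newEmb p.2.1 p.2.2) ∧
      Clash₃ t E (newEmb f x) (newEmb p.1.1 p.1.2) (newEmb p.2.1 p.2.2)} ≤
      16 ^ m * Fintype.card X ^ (m - t) := by
  classical
  set M := Fintype.card X with hM
  have hM0 : 0 < M := Fintype.card_pos
  let G : Finset (Fin m) → Finset ((Fin m ↪ V) × (Fin m → X)) := fun A =>
    {a ∈ R | a.1 = f ∧ ∀ i ∈ A, a.2 i = x i}
  let F : Finset (Fin m) × Finset (Fin m) × Finset (Fin m) × Finset (Fin m) →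
      Finset (((Fin m ↪ V) × (Fin m → X)) × ((Fin m ↪ V) × (Fin m → X))) := fun q =>
    if 2 * t ≤ #q.1 + #q.2.1 + #q.2.2.1 ∧ Disjoint q.2.1 q.2.2.1 ∧ q.1 ⊆ q.2.2.2 ∧ #q.2.2.2 = t ∧
      (∃ e ∈ E, q.2.2.2 ⊆ e) then
    (G q.1).biUnion fun a => {a} ×ˢ ({f} ×ˢ
      ({z | (∀ i ∈ q.2.1, z i = x i) ∧ ∀ i ∈ q.2.2.1, z i = a.2 i} : Finset _)) else ∅
  have hsub : ({p ∈ R ×ˢ (P ×ˢ (univ : Finset (Fin m → X))) |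
      ¬ Share t E (newEmb f x) (newEmb p.1.1 p.1.2) ∧
      ¬ Share t E (newEmb f x) (newEmb p.2.1 p.2.2) ∧
      ¬ Share t E (newEmb p.1.1 p.1.2) (newEmb p.2.1 p.2.2) ∧
      Clash₃ t E (newEmb f x) (newEmb p.1.1 p.1.2) (newEmb p.2.1 p.2.2)} : Finset _) ⊆
      univ.biUnion F := by
    rintro ⟨⟨g, y⟩, h, z⟩ hp
    rw [mem_filter] at hp
    obtain ⟨hmem, s1, s2, s3, e₁, h₁, e₂, h₂, e₃, h₃, H⟩ := hp
    simp only [mem_product, mem_univ, and_true] at hmem s1 s2 s3 H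
    rw [not_share] at s1 s2 s3
    have hg : g ∈ P := hR _ hmem.1
    have hh := hmem.2
    have H' : Clash t (e₁.map (newEmb f x)) (e₃.map (newEmb h z)) (e₂.map (newEmb g y)) :=
      H.rotate.rotate.swap
    have key : ∀ {f g : Fin m ↪ V} {x y z : Fin m → X} {e₁ e₂ e₃ : Finset (Fin m)}, f ∈ P → g ∈ P →
        f ≠ g → e₃ ∈ E → #(e₁.map (newEmb f x) ∩ e₂.map (newEmb f y)) < t →
        ¬ Clash t (e₁.map (newEmb f x)) (e₂.map (newEmb f y)) (e₃.map (newEmb g z)) := by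
      intro f g x y z e₁ e₂ e₃ hf hg hfg h₃ hlt
      refine not_clash_of_card hlt.le ?_
      refine (card_inter_le_of_image (injOn_fst_newEmb e₃) (image_fst_newEmb e₃) ?_).trans_lt
        (hP.inter_range_lt hf hg hfg h₃)
      rw [image_union, image_fst_newEmb, image_fst_newEmb]
      exact union_subset (map_subset_map.2 (subset_univ _)) (map_subset_map.2 (subset_univ _))
    have hfgh : f = g ∧ f = h := by
      by_cases hfg : f = g
      · refine ⟨hfg, ?_⟩
        by_contra hfh
        subst hfg
        exact key hf hh hfh h₃ (s1 e₁ h₁ e₂ h₂) H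
      · exfalso
        by_cases hfh : f = h
        · subst hfh
          exact key hf hg hfg h₂ (s2 e₁ h₁ e₃ h₃) H'
        · by_cases hgh : g = h
          · subst hgh
            exact key hg hf (Ne.symm hfg) h₁ (s3 e₂ h₂ e₃ h₃) H.rotate
          · have := H.image Prod.fst (injOn_fst_newEmb e₁) (injOn_fst_newEmb e₃)
            rw [image_fst_newEmb, image_fst_newEmb, image_fst_newEmb] at this
            exact hP.not_clash f hf g hg h hh hfg hfh hgh e₁ h₁ e₂ h₂ e₃ h₃ this
    obtain ⟨rfl, rfl⟩ := hfgh
    have H2 := H.le_card_sdiff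
    have c12 := s1 e₁ h₁ e₂ h₂
    rw [newEmb_inter_same, newEmb_inter_same, newEmb_inter_same, card_map, card_map] at H2
    rw [newEmb_inter_same, card_map] at c12
    set A := ({i ∈ e₁ ∩ e₂ | x i = y i} : Finset _) with hA
    set B := ({i ∈ e₁ ∩ e₃ | x i = z i} : Finset _) with hB
    set D := ({i ∈ e₂ ∩ e₃ | y i = z i ∧ ¬ (i ∈ e₁ ∧ x i = y i)} : Finset _) with hD
    have hDc : #(({i ∈ e₂ ∩ e₃ | y i = z i} : Finset _).map (newEmb f y) \ e₁.map (newEmb f x)) ≤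
        #D := by
      rw [← card_map (newEmb f y) (s := D)]
      refine card_le_card fun p hp => ?_
      rw [Finset.mem_sdiff] at hp
      obtain ⟨i, hi, rfl⟩ := Finset.mem_map.1 hp.1
      refine mem_map_of_mem _ ?_
      rw [mem_filter] at hi
      refine mem_filter.2 ⟨hi.1, hi.2, fun hcon => hp.2 ?_⟩
      refine Finset.mem_map.2 ⟨i, hcon.1, ?_⟩
      rw [newEmb_apply, newEmb_apply, hcon.2]
    obtain ⟨T, hAT, hTe, hT⟩ := exists_subsuperset_card_eq (s := A) (t := e₂)
      (fun i hi => (mem_inter.1 (mem_filter.1 hi).1).2) c12.le (hE e₂ h₂)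
    refine mem_biUnion.2 ⟨(A, B, D, T), mem_univ _, ?_⟩
    have hdisj : Disjoint B D := by
      rw [disjoint_left]
      intro i hi hi'
      rw [mem_filter, mem_inter] at hi hi'
      exact hi'.2.2 ⟨hi.1.1, hi.2.trans hi'.2.1.symm⟩
    simp only [F]
    rw [if_pos ⟨by omega, hdisj, hAT, hT, e₂, h₂, hTe⟩]
    refine mem_biUnion.2 ⟨(f, y), ?_, ?_⟩
    · simp only [G, mem_filter]
      exact ⟨hmem.1, by trivial, fun i hi => (mem_filter.1 hi).2.symm⟩
    · simp only [mem_product, mem_singleton, mem_filter, mem_univ, true_and]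
      exact ⟨fun i hi => (mem_filter.1 hi).2.symm, fun i hi => (mem_filter.1 hi).2.1.symm⟩
  have h16 : (16 : ℕ) ^ m = 2 ^ m * (2 ^ m * (2 ^ m * 2 ^ m)) := by
    rw [← mul_pow, ← mul_pow, ← mul_pow]; norm_num
  refine (card_le_card hsub).trans ((card_biUnion_le_card_mul _ _ (M ^ (m - t))
    fun q _ => ?_).trans (by simp [h16]))
  obtain ⟨A, B, D, T⟩ := q
  simp only [F]
  split_ifs with hq
  swap
  · simp
  obtain ⟨hs, hd, hAT, hT, e, he, hTe⟩ := hq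
  have hG : #(G A) ≤ M ^ (t - #A) := by
    have h1 := card_forall_eq (Tᶜ ∪ A) x
    have h2 : #(Tᶜ ∪ A) = m - t + #A := by
      rw [card_union_of_disjoint, card_compl, hT, Fintype.card_fin]
      exact disjoint_left.2 fun i hi hi' => (mem_compl.1 hi) (hAT hi')
    rw [h2, Fintype.card_fin, show m - (m - t + #A) = t - #A by omega] at h1
    rw [hM, ← h1]
    refine card_le_card_of_injOn (fun a => T.piecewise a.2 x) ?_ ?_
    · intro a ha
      obtain ⟨haR, haf, ha⟩ := mem_filter.1 ha
      simp only [mem_coe, mem_filter, mem_univ, true_and, mem_union, mem_compl]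
      rintro i (hi | hi)
      · simp [hi]
      · simpa [hAT hi] using ha i hi
    · intro a ha b hb hab
      obtain ⟨haR, haf, -⟩ := mem_filter.1 ha
      obtain ⟨hbR, hbf, -⟩ := mem_filter.1 hb
      by_contra hne
      refine hRs a haR b hbR hne ⟨e, he, e, he, ?_⟩
      rw [haf, hbf, newEmb_inter_same, card_map, ← hT]
      refine card_le_card fun i hi => mem_filter.2 ⟨by simpa using hTe hi, ?_⟩
      have := congrFun hab i
      simpa [hi] using this
  have hBD : #B + #D ≤ m := by
    rw [← card_union_of_disjoint hd]
    exact (card_le_univ _).trans (by simp)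
  have hAt : #A ≤ t := (card_le_card hAT).trans hT.le
  calc _ ≤ #(G A) * M ^ (m - (#B + #D)) := by
        refine card_biUnion_le_card_mul _ _ _ fun a _ => ?_
        rw [card_product, card_product, card_singleton, card_singleton, one_mul, one_mul,
          card_forall_eq_eq hd]
    _ ≤ M ^ (t - #A) * M ^ (m - (#B + #D)) := Nat.mul_le_mul_right _ hG
    _ ≤ M ^ (m - t) := by
        rw [← pow_add]
        exact Nat.pow_le_pow_right hM0 (by omega)

end NewConflict

section Random

variable {m t k : ℕ} {U V X : Type*} [Fintype V] [DecidableEq V] [DecidableEq X]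
  {E : Finset (Finset (Fin m))} {P : Finset (Fin m ↪ V)} {Z : Finset (Finset V)}

/-- A random permutation which is trivial unless its label is `0`. -/
def ret (o : Equiv.Perm V × Fin (k + 1)) : Equiv.Perm V := if o.2 = 0 then o.1 else 1

theorem card_special (S : Equiv.Perm V → Prop) : open Classical in
    #{o : Equiv.Perm V × Fin (k + 1) | o.2 = 0 ∧ S o.1} = #{π : Equiv.Perm V | S π} := by
  classical
  refine card_bij' (fun o _ => o.1) (fun π _ => (π, 0)) ?_ ?_ ?_ ?_
  · intro o ho
    exact mem_filter.2 ⟨mem_univ _, (mem_filter.1 ho).2.2⟩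
  · intro o ho
    exact mem_filter.2 ⟨mem_univ _, rfl, (mem_filter.1 ho).2⟩
  · intro o ho
    exact Prod.ext rfl (mem_filter.1 ho).2.1.symm
  · intro o ho
    rfl

theorem IsPacking.card_special_cov_le (hP : IsPacking t E P Z) (hE : ∀ e ∈ E, t ≤ #e)
    (hV : 0 < Fintype.card V) (Q : Finset V) (hQ : #Q ≤ 4 * m * t + 1) : open Classical in
    (#{o : Equiv.Perm V × Fin (k + 1) | o.2 = 0 ∧ Cov E P (Q.map (ret o).toEmbedding)} : ℝ) ≤
      permConst m t * ((Fintype.card V : ℝ) ^ t / (Fintype.card V : ℝ) ^ #Q) *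
        (Fintype.card (Equiv.Perm V × Fin (k + 1)) / (k + 1)) := by
  classical
  have h1 : ({o : Equiv.Perm V × Fin (k + 1) | o.2 = 0 ∧ Cov E P (Q.map (ret o).toEmbedding)} :
      Finset _) = ({o | o.2 = 0 ∧ Cov E P (Q.map o.1.toEmbedding)} : Finset _) := by
    ext o
    simp only [mem_filter, mem_univ, true_and]
    refine and_congr_right fun h => ?_
    rw [ret, if_pos h]
  rw [h1, card_special (fun π : Equiv.Perm V => Cov E P (Q.map π.toEmbedding))]
  have h := hP.card_perm_cov_mul_le hE Q hQ
  rw [Fintype.card_prod, Fintype.card_fin]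
  have hk : (0 : ℝ) < k + 1 := by positivity
  have hn : (0 : ℝ) < (Fintype.card V : ℝ) ^ #Q := by positivity
  push_cast
  rw [mul_div_assoc, div_self hk.ne', mul_one, mul_div_assoc', div_mul_eq_mul_div, le_div_iff₀ hn]
  exact_mod_cast h

theorem ret_of_ne {o : Equiv.Perm V × Fin (k + 1)} (h : o.2 ≠ 0) : ret o = 1 := if_neg h

theorem IsPacking.sum_cov_le (hP : IsPacking t E P Z) (hE : ∀ e ∈ E, t ≤ #e) (hm : 1 ≤ m)
    (hV : 0 < Fintype.card V) (Q : Finset V) (hQ : #Q ≤ t) (s : ℕ) (hs : s ≤ 2 * t) :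
    open Classical in
    ∑ S ∈ {S : Finset V | #S = s ∧ Disjoint Q S},
      (#{o : Equiv.Perm V × Fin (k + 1) | Cov E P ((Q ∪ S).map (ret o).toEmbedding)} : ℝ) ≤
      (32 ^ m * t ^ t + permConst m t : ℕ) * (Fintype.card V : ℝ) ^ (t - #Q) *
        Fintype.card (Equiv.Perm V × Fin (k + 1)) := by
  classical
  set N : ℝ := ((Fintype.card (Equiv.Perm V × Fin (k + 1)) : ℕ) : ℝ) with hN
  set n := Fintype.card V with hn
  have hn0 : (0 : ℝ) < n := by exact_mod_cast hV
  have h1 : ∀ S ∈ ({S : Finset V | #S = s ∧ Disjoint Q S} : Finset _),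
      (#{o : Equiv.Perm V × Fin (k + 1) | Cov E P ((Q ∪ S).map (ret o).toEmbedding)} : ℝ) ≤
      (if Cov E P (Q ∪ S) then N else 0) +
        permConst m t * ((n : ℝ) ^ t / (n : ℝ) ^ (#Q + s)) * N := by
    intro S hS
    obtain ⟨hSs, hd⟩ := (mem_filter.1 hS).2
    have hc : #(Q ∪ S) = #Q + s := by rw [card_union_of_disjoint hd, hSs]
    have h2 := hP.card_special_cov_le (k := k) hE hV (Q ∪ S) (by rw [hc]; nlinarith)
    rw [hc, ← hN, ← hn] at h2
    have h3 : ({o : Equiv.Perm V × Fin (k + 1) | Cov E P ((Q ∪ S).map (ret o).toEmbedding)} :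
        Finset _) ⊆ ({_o | Cov E P (Q ∪ S)} : Finset _) ∪
          ({o | o.2 = 0 ∧ Cov E P ((Q ∪ S).map (ret o).toEmbedding)} : Finset _) := by
      intro o ho
      have ho := (mem_filter.1 ho).2
      by_cases h : o.2 = 0
      · exact mem_union_right _ (mem_filter.2 ⟨mem_univ _, h, ho⟩)
      · rw [ret_of_ne h] at ho
        refine mem_union_left _ (mem_filter.2 ⟨mem_univ _, ?_⟩)
        convert ho
        ext v
        simp [← Equiv.Perm.inv_def]
    have h4 : (#({o : Equiv.Perm V × Fin (k + 1) | Cov E P (Q ∪ S)} : Finset _) : ℝ) =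
        if Cov E P (Q ∪ S) then N else 0 := by
      split_ifs with h
      · simp [h, hN]
      · simp [h]
    have h5 := (card_le_card h3).trans (card_union_le _ _)
    have h6 : N / (k + 1) ≤ N := div_le_self (by positivity)
        (by linarith [Nat.cast_nonneg (α := ℝ) k])
    refine le_trans (Nat.cast_le.2 h5) ?_
    push_cast
    rw [h4]
    refine add_le_add le_rfl (h2.trans ?_)
    gcongr
  refine (sum_le_sum h1).trans ?_
  rw [sum_add_distrib, sum_const, nsmul_eq_mul, ← sum_filter, sum_const, nsmul_eq_mul]
  have h2 : (#{S ∈ ({S : Finset V | #S = s ∧ Disjoint Q S} : Finset _) | Cov E P (Q ∪ S)} : ℝ) ≤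
      32 ^ m * t ^ t * (n : ℝ) ^ (t - #Q) := by
    have := hP.card_cov_le hE Q hQ
    have h3 : #{S ∈ ({S : Finset V | #S = s ∧ Disjoint Q S} : Finset _) | Cov E P (Q ∪ S)} ≤
        #({S | Cov E P (Q ∪ S)} : Finset _) := card_le_card (by
      intro S hS
      exact mem_filter.2 ⟨mem_univ _, (mem_filter.1 hS).2⟩)
    exact_mod_cast h3.trans this
  have h3 : (#({S : Finset V | #S = s ∧ Disjoint Q S} : Finset _) : ℝ) ≤ (n : ℝ) ^ s := by
    have : #({S : Finset V | #S = s ∧ Disjoint Q S} : Finset _) ≤ n ^ s := by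
      refine (card_le_card (t := powersetCard s univ) ?_).trans ?_
      · intro S hS
        exact mem_powersetCard.2 ⟨subset_univ _, (mem_filter.1 hS).2.1⟩
      · rw [card_powersetCard, card_univ]
        exact Nat.choose_le_pow _ _
    exact_mod_cast this
  have h4 : (n : ℝ) ^ s * ((n : ℝ) ^ t / (n : ℝ) ^ (#Q + s)) = (n : ℝ) ^ (t - #Q) := by
    obtain ⟨d, hd⟩ := Nat.exists_eq_add_of_le hQ
    rw [hd, show #Q + d - #Q = d by omega, pow_add, pow_add]
    field_simp
  calc _ ≤ 32 ^ m * t ^ t * (n : ℝ) ^ (t - #Q) * N + (n : ℝ) ^ s *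
      (permConst m t * ((n : ℝ) ^ t / (n : ℝ) ^ (#Q + s)) * N) := by
        gcongr
    _ = 32 ^ m * t ^ t * (n : ℝ) ^ (t - #Q) * N + permConst m t *
        ((n : ℝ) ^ s * ((n : ℝ) ^ t / (n : ℝ) ^ (#Q + s))) * N := by
        ring
    _ = _ := by
        rw [h4]
        push_cast
        ring

theorem IsPacking.card_ok_ge (hP : IsPacking t E P Z) (hE : ∀ e ∈ E, t ≤ #e) (hm : 1 ≤ m)
    {κ : ℝ} (hκ : 0 < κ) (hκ1 : κ ≤ 1) (hZt : ∀ Q ∈ Z, #Q = t)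
    (hZ : κ * (Fintype.card V : ℝ) ^ t ≤ #Z)
    (hL : open Classical in κ * (Fintype.card V : ℝ) ^ t ≤
      #{Q : Finset V | #Q = t ∧ Q ∉ Z ∧ ¬ Cov E P Q})
    (hn : 2 * (2 ^ m * permConst m t) / κ ≤ Fintype.card V) (hV : 0 < Fintype.card V)
    {c : U → V → X} {f : Fin m ↪ V} {x : Fin m → X} {u : U} (htm : t < Fintype.card V) :
        open Classical in
    κ / (2 * (k + 1)) * Fintype.card (Equiv.Perm V × Fin (k + 1)) ≤
      #{o : Equiv.Perm V × Fin (k + 1) | o.2 = 0 ∧ Ok t E P Z c f x u o.1} := by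
  classical
  rw [card_special (fun π => Ok t E P Z c f x u π), Fintype.card_prod, Fintype.card_fin]
  have hk : (0 : ℝ) < k + 1 := by positivity
  set N : ℝ := ((Fintype.card (Equiv.Perm V) : ℕ) : ℝ) with hN
  have hN0 : 0 < N := by
    rw [hN]
    exact_mod_cast Fintype.card_pos
  push_cast
  have e1 : κ / (2 * (k + 1)) * (N * (k + 1)) = κ / 2 * N := by field_simp
  rw [e1]
  set n := Fintype.card V with hnn
  have hn0 : (0 : ℝ) < n := by exact_mod_cast hV
  have main : ∀ 𝓕 : Finset (Finset V), (∀ R ∈ 𝓕, #R = t) → κ * (n : ℝ) ^ t ≤ #𝓕 → ∀ Q : Finset V,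
      #Q = t → κ * N ≤ #{π : Equiv.Perm V | Q.map π.toEmbedding ∈ 𝓕} := by
    intro 𝓕 h𝓕 hc Q hQ
    have h := card_perm_map_mem 𝓕 Q (fun R hR => by rw [h𝓕 R hR, hQ])
    rw [hQ] at h
    have hch : (0 : ℝ) < (n.choose t : ℝ) := by
      exact_mod_cast Nat.choose_pos htm.le
    have hch' : (n.choose t : ℝ) ≤ (n : ℝ) ^ t := by exact_mod_cast Nat.choose_le_pow _ _
    have h' : (#{π : Equiv.Perm V | Q.map π.toEmbedding ∈ 𝓕} : ℝ) * (n.choose t : ℝ) = N * #𝓕 := by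
      rw [hN]; exact_mod_cast h
    refine le_of_mul_le_mul_right ?_ hch
    rw [h']
    calc κ * N * (n.choose t : ℝ) ≤ κ * N * (n : ℝ) ^ t := by gcongr
      _ = N * (κ * (n : ℝ) ^ t) := by ring
      _ ≤ _ := by gcongr
  let B : Finset V → Finset (Equiv.Perm V) := fun Q => {π | Cov E P (Q.map π.toEmbedding)}
  let 𝓠 : Finset (Finset V) := (univ.map f).powersetCard (t + 1)
  have hB : (#(𝓠.biUnion B) : ℝ) ≤ κ / 2 * N := by
    have h1 : ∀ Q ∈ 𝓠, (#(B Q) : ℝ) ≤ permConst m t / n * N := by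
      intro Q hQ
      obtain ⟨hQ1, hQ2⟩ := mem_powersetCard.1 hQ
      have h := hP.card_perm_cov_mul_le hE Q (by rw [hQ2]; nlinarith)
      have h' : (#(B Q) : ℝ) * (n : ℝ) ^ (t + 1) ≤ permConst m t * (n : ℝ) ^ t * N := by
        rw [hN, ← hQ2]; exact_mod_cast h
      have hnt : (0 : ℝ) < (n : ℝ) ^ (t + 1) := by positivity
      refine le_of_mul_le_mul_right (h'.trans (le_of_eq ?_)) hnt
      rw [pow_succ]
      field_simp
    have h2 : (#(𝓠.biUnion B) : ℝ) ≤ ∑ Q ∈ 𝓠, (#(B Q) : ℝ) := by exact_mod_cast card_biUnion_le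
    have h3 : (#𝓠 : ℝ) ≤ 2 ^ m := by
      have : #𝓠 ≤ 2 ^ m := by
        refine (card_le_card (t := (univ.map f).powerset) fun Q hQ => ?_).trans (by simp)
        exact mem_powerset.2 (mem_powersetCard.1 hQ).1
      exact_mod_cast this
    refine h2.trans ((sum_le_sum h1).trans ?_)
    rw [sum_const, nsmul_eq_mul]
    calc _ ≤ 2 ^ m * (permConst m t / n * N) := by gcongr
      _ = (2 ^ m * permConst m t) / n * N := by ring
      _ ≤ κ / 2 * N := by
        refine mul_le_mul_of_nonneg_right ?_ hN0.le
        rw [div_le_iff₀ hn0]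
        rw [div_le_iff₀ hκ] at hn
        linarith
  have hA : ∃ A : Finset (Equiv.Perm V), κ * N ≤ #A ∧
      A \ 𝓠.biUnion B ⊆ ({π | Ok t E P Z c f x u π} : Finset _) := by
    have hB' : ∀ {π}, π ∉ 𝓠.biUnion B → ∀ Q ⊆ univ.map f, #Q = t + 1 →
        ¬ Cov E P (Q.map π.toEmbedding) := by
      intro π hπ Q hQ hQc hcov
      exact hπ (mem_biUnion.2 ⟨Q, mem_powersetCard.2 ⟨hQ, hQc⟩, mem_filter.2 ⟨mem_univ _, hcov⟩⟩)
    by_cases ht : #(agr (pull c f) x u) = t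
    · by_cases he : ∃ e ∈ E, agr (pull c f) x u ⊆ e
      · refine ⟨_, main ({Q : Finset V | #Q = t ∧ Q ∉ Z ∧ ¬ Cov E P Q} : Finset _)
          (fun R hR => (mem_filter.1 hR).2.1) hL ((agr (pull c f) x u).map f)
              (by rw [card_map, ht]), ?_⟩
        intro π hπ
        rw [Finset.mem_sdiff, mem_filter, mem_filter] at hπ
        exact mem_filter.2 ⟨mem_univ _, hB' hπ.2, fun _ =>
            ⟨fun _ => hπ.1.2.2.2, fun h => absurd he h⟩⟩
      · refine ⟨_, main Z hZt hZ ((agr (pull c f) x u).map f) (by rw [card_map, ht]), ?_⟩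
        intro π hπ
        rw [Finset.mem_sdiff, mem_filter] at hπ
        exact mem_filter.2 ⟨mem_univ _, hB' hπ.2, fun _ => ⟨fun h => absurd h he, fun h => hπ.1.2⟩⟩
    · refine ⟨univ, ?_, ?_⟩
      · rw [card_univ, ← hN]
        nlinarith
      · intro π hπ
        rw [Finset.mem_sdiff] at hπ
        exact mem_filter.2 ⟨mem_univ _, hB' hπ.2, fun h => absurd h ht⟩
  obtain ⟨A, hA, hsub⟩ := hA
  have h1 : (#A : ℝ) ≤ #(A \ 𝓠.biUnion B) + #(𝓠.biUnion B) := by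
    have := card_le_card_sdiff_add_card (s := A) (t := 𝓠.biUnion B)
    exact_mod_cast this
  have h2 : (#(A \ 𝓠.biUnion B) : ℝ) ≤ #{π : Equiv.Perm V | Ok t E P Z c f x u π} := by
    exact_mod_cast card_le_card hsub
  linarith

end Random

section BadPair

variable {m t k : ℕ} {U V X : Type*} [Fintype U] [DecidableEq U] [Fintype V] [DecidableEq V]
  [DecidableEq X] {E : Finset (Finset (Fin m))} {P : Finset (Fin m ↪ V)} {Z : Finset (Finset V)}

/-- The relabellings of the blow-up given by a random choice. -/
def permOf (ω : U → Equiv.Perm V × Fin (k + 1)) (u : U) : Equiv.Perm V := (ret (ω u)).symm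

/-- The random choice is compatible with `(f, x)` at the exceptional codewords. -/
def GoodAt (t : ℕ) (E : Finset (Finset (Fin m))) (P : Finset (Fin m ↪ V)) (Z : Finset (Finset V))
    (c : U → V → X) (f : Fin m ↪ V) (x : Fin m → X) (ω : U → Equiv.Perm V × Fin (k + 1)) : Prop :=
  ∀ u, InW t (pull c f) x u → (ω u).2 = 0 ∧ Ok t E P Z c f x u (ω u).1

/-- The new copy `(f, x)` clashes with two old edges at non-exceptional codewords. -/
def BadAt (t : ℕ) (E : Finset (Finset (Fin m))) (P : Finset (Fin m ↪ V))
    (c : U → V → X) (f : Fin m ↪ V) (x : Fin m → X) (ω : U → Equiv.Perm V × Fin (k + 1)) : Prop :=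
  ∃ u u', u ≠ u' ∧ ¬ InW t (pull c f) x u ∧ ¬ InW t (pull c f) x u' ∧ permOf ω u' ≠ 1 ∧
    ∃ g ∈ P, ∃ g' ∈ P, ∃ e ∈ E, ∃ e₁ ∈ E, ∃ e₂ ∈ E,
      Clash t (e.map (newEmb f x)) (e₁.map (g.trans (blowEmb c (permOf ω) u)))
        (e₂.map (g'.trans (blowEmb c (permOf ω) u')))

/-- Two codewords are determined by sufficiently many agreements. -/
def PairDet (t : ℕ) (c : U → V → X) : Prop :=
  ∀ A₁ A₂ A₃ : Finset V, #A₁ < t → #A₂ < t → Disjoint A₁ A₃ → Disjoint A₂ A₃ →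
    2 * t ≤ #A₁ + #A₂ + #A₃ → ∀ (y : V → X) (u u' w w' : U), u ≠ u' → w ≠ w' →
    (∀ v ∈ A₁, c u v = y v) → (∀ v ∈ A₁, c w v = y v) → (∀ v ∈ A₂, c u' v = y v) →
    (∀ v ∈ A₂, c w' v = y v) → (∀ v ∈ A₃, c u v = c u' v) → (∀ v ∈ A₃, c w v = c w' v) →
    u = w ∧ u' = w'

variable {c : U → V → X} {f : Fin m ↪ V} {x : Fin m → X}

theorem GoodAt.ret_eq {ω : U → Equiv.Perm V × Fin (k + 1)} (h : GoodAt t E P Z c f x ω) {u : U}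
    (hu : InW t (pull c f) x u) : ret (ω u) = (ω u).1 := if_pos (h u hu).1

theorem map_inter_eq_filter {W : Type*} [DecidableEq W] (ν : Fin m ↪ W) (e : Finset (Fin m))
    (b : Finset W) :
    e.map ν ∩ b = ({i ∈ e | ν i ∈ b} : Finset _).map ν := by
  ext p
  simp only [mem_inter, Finset.mem_map, mem_filter]
  constructor
  · rintro ⟨⟨i, hi, rfl⟩, h⟩
    exact ⟨i, ⟨hi, h⟩, rfl⟩
  · rintro ⟨i, ⟨hi, h⟩, rfl⟩
    exact ⟨⟨i, hi, rfl⟩, h⟩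

/-- The pattern of a clash recorded by `BadAt`. -/
def BadPattern (t : ℕ) (E : Finset (Finset (Fin m))) (P : Finset (Fin m ↪ V))
    (c : U → V → X) (f : Fin m ↪ V) (x : Fin m → X) (S₁ S₂ : Finset (Fin m)) (S : Finset V)
    (ω : U → Equiv.Perm V × Fin (k + 1)) (u u' : U) : Prop :=
  u ≠ u' ∧ ¬ InW t (pull c f) x u ∧ ¬ InW t (pull c f) x u' ∧
    (∀ i ∈ S₁, c u (f i) = x i) ∧ (∀ i ∈ S₂, c u' (f i) = x i) ∧ (∀ v ∈ S, c u v = c u' v) ∧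
    Cov E P ((S₁.map f ∪ S).map (ret (ω u)).toEmbedding) ∧
    (ω u').2 = 0 ∧ Cov E P ((S₂.map f ∪ S).map (ret (ω u')).toEmbedding)

theorem BadAt.exists_pattern {ω : U → Equiv.Perm V × Fin (k + 1)} (h : BadAt t E P c f x ω) :
    ∃ S₁ S₂ : Finset (Fin m), ∃ S : Finset V, (#S₁ < t ∧ #S₂ < t ∧ #S₁ + #S₂ + #S = 2 * t ∧
      Disjoint (S₁.map f) S ∧ Disjoint (S₂.map f) S) ∧
      ∃ u u', BadPattern t E P c f x S₁ S₂ S ω u u' := by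
  classical
  obtain ⟨u, u', hne, hu, hu', hsp, g, hg, g', hg', e, he, e₁, he₁, e₂, he₂, H⟩ := h
  have H2 := H.le_card_sdiff
  rw [map_inter_eq_filter, map_inter_eq_filter, card_map, card_map] at H2
  set b := e₁.map (g.trans (blowEmb c (permOf ω) u)) with hb
  set b' := e₂.map (g'.trans (blowEmb c (permOf ω) u')) with hb'
  set S₁ := ({i ∈ e | newEmb f x i ∈ b} : Finset _) with hS₁
  set S₂ := ({i ∈ e | newEmb f x i ∈ b'} : Finset _) with hS₂
  have a1 : ∀ i ∈ S₁, c u (f i) = x i := fun i hi => (mem_map_old.1 (mem_filter.1 hi).2).1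
  have a2 : ∀ i ∈ S₂, c u' (f i) = x i := fun i hi => (mem_map_old.1 (mem_filter.1 hi).2).1
  have lt : ∀ {w} {T : Finset (Fin m)}, ¬ InW t (pull c f) x w → (∀ i ∈ T, c w (f i) = x i) → #T <
      t := by
    intro w T hw hT
    by_contra! hcon
    refine hw (Or.inl (hcon.trans (card_le_card fun i hi => ?_)))
    rw [mem_agr]
    exact hT i hi
  have l1 := lt hu a1
  have l2 := lt hu' a2
  have hcard : #(((b ∩ b') \ e.map (newEmb f x)).image Prod.fst) =
      #((b ∩ b') \ e.map (newEmb f x)) := by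
    refine card_image_of_injOn ((injOn_fst_old (c := c) (σ := permOf ω) (u := u) (g := g) e₁).mono
        ?_)
    intro p hp
    exact (mem_inter.1 (Finset.mem_sdiff.1 hp).1).1
  obtain ⟨S, hS, hSc⟩ := exists_subset_card_eq (s := ((b ∩ b') \ e.map (newEmb f x)).image Prod.fst)
    (n := 2 * t - (#S₁ + #S₂)) (by rw [hcard]; omega)
  have hSv : ∀ v ∈ S, (v, c u v) ∈ b ∧ (v, c u' v) ∈ b' ∧ c u v = c u' v ∧
      (v, c u v) ∉ e.map (newEmb f x) := by
    intro v hv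
    obtain ⟨p, hp, rfl⟩ := mem_image.1 (hS hv)
    rw [Finset.mem_sdiff, mem_inter] at hp
    have h1 := (mem_map_old.1 hp.1.1).1
    have h2 := (mem_map_old.1 hp.1.2).1
    rw [h1, h2]
    exact ⟨hp.1.1, hp.1.2, rfl, hp.2⟩
  refine ⟨S₁, S₂, S, ⟨l1, l2, by omega, ?_, ?_⟩, u, u', hne, hu, hu', a1, a2,
    fun v hv => (hSv v hv).2.2.1, ⟨g, hg, e₁, he₁, ?_⟩, ?_, ⟨g', hg', e₂, he₂, ?_⟩⟩
  · rw [disjoint_left]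
    intro v hv hvS
    obtain ⟨i, hi, rfl⟩ := Finset.mem_map.1 hv
    refine (hSv _ hvS).2.2.2 (Finset.mem_map.2 ⟨i, (mem_filter.1 hi).1, ?_⟩)
    rw [newEmb_apply, a1 i hi]
  · rw [disjoint_left]
    intro v hv hvS
    obtain ⟨i, hi, rfl⟩ := Finset.mem_map.1 hv
    refine (hSv _ hvS).2.2.2 (Finset.mem_map.2 ⟨i, (mem_filter.1 hi).1, ?_⟩)
    rw [newEmb_apply, (hSv _ hvS).2.2.1, a2 i hi]
  · intro w hw
    obtain ⟨v, hv, rfl⟩ := Finset.mem_map.1 hw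
    rcases mem_union.1 hv with hv | hv
    · obtain ⟨i, hi, rfl⟩ := Finset.mem_map.1 hv
      exact (mem_map_old.1 (mem_filter.1 hi).2).2
    · exact (mem_map_old.1 (hSv v hv).1).2
  · by_contra hcon
    refine hsp ?_
    rw [permOf, ret_of_ne hcon]
    rfl
  · intro w hw
    obtain ⟨v, hv, rfl⟩ := Finset.mem_map.1 hw
    rcases mem_union.1 hv with hv | hv
    · obtain ⟨i, hi, rfl⟩ := Finset.mem_map.1 hv
      exact (mem_map_old.1 (mem_filter.1 hi).2).2
    · exact (mem_map_old.1 (hSv v hv).2.1).2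

theorem goodAt_update {ω : U → Equiv.Perm V × Fin (k + 1)} {u : U} (hu : ¬ InW t (pull c f) x u)
    (y : Equiv.Perm V × Fin (k + 1)) :
    GoodAt t E P Z c f x (Function.update ω u y) ↔ GoodAt t E P Z c f x ω := by
  unfold GoodAt
  refine forall_congr' fun w => imp_congr_right fun hw => ?_
  rw [Function.update_of_ne (by rintro rfl; exact hu hw)]

theorem card_goodAt_and {u u' : U} (hne : u ≠ u') (hu : ¬ InW t (pull c f) x u)
    (hu' : ¬ InW t (pull c f) x u') (A B : Equiv.Perm V × Fin (k + 1) → Prop) : open Classical in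
    #{ω : U → Equiv.Perm V × Fin (k + 1) | (GoodAt t E P Z c f x ω ∧ A (ω u)) ∧ B (ω u')} *
      Fintype.card (Equiv.Perm V × Fin (k + 1)) ^ 2 =
      #{ω : U → Equiv.Perm V × Fin (k + 1) | GoodAt t E P Z c f x ω} * #{o | A o} * #{o | B o} := by
  classical
  have h1 := card_and_mem_mul u' (fun ω : U → Equiv.Perm V × Fin (k + 1) =>
    GoodAt t E P Z c f x ω ∧ A (ω u)) (fun ω y => by
      rw [goodAt_update hu', Function.update_of_ne hne]) B
  have h2 := card_and_mem_mul u (fun ω : U → Equiv.Perm V × Fin (k + 1) =>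
    GoodAt t E P Z c f x ω) (fun ω y => goodAt_update hu y) A
  have h1' : #{ω : U → Equiv.Perm V × Fin (k + 1) | (GoodAt t E P Z c f x ω ∧ A (ω u)) ∧ B (ω u')} *
      Fintype.card (Equiv.Perm V × Fin (k + 1)) =
      #{ω : U → Equiv.Perm V × Fin (k + 1) | GoodAt t E P Z c f x ω ∧ A (ω u)} * #{o | B o} := by
    convert h1
  rw [← h2, pow_two, ← mul_assoc, h1']
  ring

/-- The constant in the estimate of bad choices. -/
def badConst (m t : ℕ) : ℕ := 4 ^ m * ((32 ^ m * t ^ t + permConst m t) * permConst m t)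

theorem IsPacking.card_goodAt_badAt_le (hP : IsPacking t E P Z) (hE : ∀ e ∈ E, t ≤ #e) (hm : 1 ≤ m)
    (hV : 0 < Fintype.card V) (hc : PairDet t c) [Nonempty X] : open Classical in
    (#{ω : U → Equiv.Perm V × Fin (k + 1) | GoodAt t E P Z c f x ω ∧ BadAt t E P c f x ω} : ℝ) ≤
      badConst m t / (k + 1) *
        #{ω : U → Equiv.Perm V × Fin (k + 1) | GoodAt t E P Z c f x ω} := by
  classical
  set G := ({ω : U → Equiv.Perm V × Fin (k + 1) | GoodAt t E P Z c f x ω} : Finset _) with hG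
  set N : ℝ := ((Fintype.card (Equiv.Perm V × Fin (k + 1)) : ℕ) : ℝ) with hN
  have hN0 : 0 < N := by
    rw [hN]
    exact_mod_cast Fintype.card_pos
  set n := Fintype.card V with hn
  have hn0 : (0 : ℝ) < n := by exact_mod_cast hV
  let I : Finset (Finset (Fin m) × Finset (Fin m)) := {p | #p.1 < t ∧ #p.2 < t}
  let 𝓢 : Finset (Fin m) × Finset (Fin m) → Finset (Finset V) := fun p =>
    {S | #S = 2 * t - (#p.1 + #p.2) ∧ Disjoint (p.1.map f) S}
  let 𝓢' : Finset (Fin m) × Finset (Fin m) → Finset (Finset V) := fun p =>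
    {S ∈ 𝓢 p | Disjoint (p.2.map f) S}
  let F : Finset (Fin m) × Finset (Fin m) → Finset V → Finset (U → Equiv.Perm V × Fin (k + 1)) :=
      fun p S =>
    {ω | GoodAt t E P Z c f x ω ∧ ∃ u u', BadPattern t E P c f x p.1 p.2 S ω u u'}
  have hsub : ({ω : U → Equiv.Perm V × Fin (k + 1) | GoodAt t E P Z c f x ω ∧ BadAt t E P c f x ω} :
      Finset _) ⊆ I.biUnion fun p => (𝓢' p).biUnion (F p) := by
    intro ω hω
    obtain ⟨hg, hb⟩ := (mem_filter.1 hω).2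
    obtain ⟨S₁, S₂, S, ⟨l1, l2, hs, d1, d2⟩, hu⟩ := hb.exists_pattern
    refine mem_biUnion.2 ⟨(S₁, S₂), mem_filter.2 ⟨mem_univ _, l1, l2⟩, mem_biUnion.2 ⟨S, ?_, ?_⟩⟩
    · exact mem_filter.2 ⟨mem_filter.2 ⟨mem_univ _, by simp only; omega, d1⟩, d2⟩
    · exact mem_filter.2 ⟨mem_univ _, hg, hu⟩
  have hF : ∀ p ∈ I, ∀ S ∈ 𝓢' p, (#(F p S) : ℝ) ≤ #G *
      #{o : Equiv.Perm V × Fin (k + 1) | Cov E P ((p.1.map f ∪ S).map (ret o).toEmbedding)} *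
      (permConst m t * ((n : ℝ) ^ t / (n : ℝ) ^ (2 * t - #p.1))) / (N * (k + 1)) := by
    rintro ⟨S₁, S₂⟩ hp S hS
    obtain ⟨l1, l2⟩ := (mem_filter.1 hp).2
    obtain ⟨hS, d2⟩ := mem_filter.1 hS
    obtain ⟨hs, d1⟩ := (mem_filter.1 hS).2
    simp only at l1 l2 d2 hs d1 ⊢
    have hk : (0 : ℝ) < k + 1 := by positivity
    by_cases hex : ∃ ω u u', BadPattern (k := k) t E P c f x S₁ S₂ S ω u u'
    swap
    · have : F (S₁, S₂) S = ∅ := by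
        refine filter_eq_empty_iff.2 fun ω _ h => hex ⟨ω, h.2⟩
      rw [this, card_empty, Nat.cast_zero]
      positivity
    obtain ⟨ω₀, u, u', hb₀⟩ := hex
    have hsubF : F (S₁, S₂) S ⊆ ({ω | (GoodAt t E P Z c f x ω ∧
        Cov E P ((S₁.map f ∪ S).map (ret (ω u)).toEmbedding)) ∧
        ((ω u').2 = 0 ∧ Cov E P ((S₂.map f ∪ S).map (ret (ω u')).toEmbedding))} : Finset _) := by
      intro ω hω
      obtain ⟨hg, w, w', hb⟩ := (mem_filter.1 hω).2
      obtain ⟨b1, b2, b3, b4, b5, b6, b7, b8, b9⟩ := hb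
      have huniq := hc (S₁.map f) (S₂.map f) S (by rwa [card_map]) (by rwa [card_map]) d1 d2
        (by rw [card_map, card_map]; omega) (fun v => if h : ∃ i, f i =
            v then x h.choose else Classical.arbitrary X) u u' w w' hb₀.1 b1
      have hy : ∀ i, (if h : ∃ j, f j = f i then x h.choose else Classical.arbitrary X) = x i := by
        intro i
        have h : ∃ j, f j = f i := ⟨i, rfl⟩
        rw [dif_pos h, f.injective h.choose_spec]
      obtain ⟨rfl, rfl⟩ := huniq
        (by
          intro v hv
          obtain ⟨i, hi, rfl⟩ := Finset.mem_map.1 hv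
          rw [hy, hb₀.2.2.2.1 i hi])
        (by
          intro v hv
          obtain ⟨i, hi, rfl⟩ := Finset.mem_map.1 hv
          rw [hy, b4 i hi])
        (by
          intro v hv
          obtain ⟨i, hi, rfl⟩ := Finset.mem_map.1 hv
          rw [hy, hb₀.2.2.2.2.1 i hi])
        (by
          intro v hv
          obtain ⟨i, hi, rfl⟩ := Finset.mem_map.1 hv
          rw [hy, b5 i hi]) hb₀.2.2.2.2.2.1 b6
      exact mem_filter.2 ⟨mem_univ _, ⟨hg, b7⟩, b8, b9⟩
    have hcount := card_goodAt_and (E := E) (P := P) (Z := Z) hb₀.1 hb₀.2.1 hb₀.2.2.1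
      (fun o : Equiv.Perm V × Fin (k + 1) => Cov E P ((S₁.map f ∪ S).map (ret o).toEmbedding))
      (fun o => o.2 = 0 ∧ Cov E P ((S₂.map f ∪ S).map (ret o).toEmbedding))
    have hc2 : #(S₂.map f ∪ S) = 2 * t - #S₁ := by
      rw [card_union_of_disjoint d2, card_map, hs]; omega
    have hsp := hP.card_special_cov_le (k := k) hE hV (S₂.map f ∪ S)
      (by rw [hc2]; have := Nat.mul_le_mul_right t hm; rw [mul_assoc]; omega)
    rw [hc2, ← hn, ← hN] at hsp
    set cA : ℝ := ((#{o : Equiv.Perm V × Fin (k + 1) |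
      Cov E P ((S₁.map f ∪ S).map (ret o).toEmbedding)} : ℕ) : ℝ) with hcA
    set cB : ℝ := ((#{o : Equiv.Perm V × Fin (k + 1) |
      o.2 = 0 ∧ Cov E P ((S₂.map f ∪ S).map (ret o).toEmbedding)} : ℕ) : ℝ) with hcB
    have hcount' : ((#({ω : U → Equiv.Perm V × Fin (k + 1) | (GoodAt t E P Z c f x ω ∧
        Cov E P ((S₁.map f ∪ S).map (ret (ω u)).toEmbedding)) ∧
        ((ω u').2 = 0 ∧ Cov E P ((S₂.map f ∪ S).map (ret (ω u')).toEmbedding))} : Finset _) : ℕ) :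
            ℝ) *
        N ^ 2 = #G * cA * cB := by
      rw [hN, hcA, hcB, hG]
      norm_cast
      convert hcount
    have hle : (#(F (S₁, S₂) S) : ℝ) * N ^ 2 ≤ #G * cA * cB := by
      rw [← hcount']
      gcongr
    rw [le_div_iff₀ (by positivity)]
    refine le_of_mul_le_mul_right ?_ hN0
    calc (#(F (S₁, S₂) S) : ℝ) * (N * (k + 1)) * N = #(F (S₁, S₂) S) * N ^ 2 * (k + 1) := by ring
      _ ≤ #G * cA * cB * (k + 1) := by gcongr
      _ ≤ #G * cA * (permConst m t * ((n : ℝ) ^ t / (n : ℝ) ^ (2 * t - #S₁)) * (N / (k + 1))) *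
          (k + 1) := by
          gcongr
      _ = _ := by field_simp
  have hp : ∀ p ∈ I, (#((𝓢' p).biUnion (F p)) : ℝ) ≤
      ((32 ^ m * t ^ t + permConst m t : ℕ) : ℝ) * permConst m t / (k + 1) * #G := by
    intro p hp
    have l1 := (mem_filter.1 hp).2.1
    have l2 := (mem_filter.1 hp).2.2
    have h1 : (#((𝓢' p).biUnion (F p)) : ℝ) ≤ ∑ S ∈ 𝓢' p, (#(F p S) : ℝ) := by
      exact_mod_cast card_biUnion_le
    refine h1.trans ((sum_le_sum (hF p hp)).trans ?_)
    have hsum := hP.sum_cov_le (k := k) hE hm hV (p.1.map f) (by rw [card_map]; omega)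
      (2 * t - (#p.1 + #p.2)) (by omega)
    rw [card_map, ← hn, ← hN] at hsum
    have hsum' : ∑ S ∈ 𝓢' p, (#{o : Equiv.Perm V × Fin (k + 1) |
        Cov E P ((p.1.map f ∪ S).map (ret o).toEmbedding)} : ℝ) ≤
        ((32 ^ m * t ^ t + permConst m t : ℕ) : ℝ) * (n : ℝ) ^ (t - #p.1) * N := by
      refine le_trans (sum_le_sum_of_subset_of_nonneg (filter_subset _ _) ?_) hsum
      intros
      positivity
    have hpow : (n : ℝ) ^ (t - #p.1) * ((n : ℝ) ^ t / (n : ℝ) ^ (2 * t - #p.1)) = 1 := by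
      rw [mul_div_assoc', ← pow_add, show t - #p.1 + t = 2 * t - #p.1 by omega,
          div_self (by positivity)]
    rw [← sum_div, ← sum_mul, ← mul_sum]
    rw [div_le_iff₀ (by positivity)]
    have hk : (0 : ℝ) < k + 1 := by positivity
    calc _ ≤ #G * (((32 ^ m * t ^ t + permConst m t : ℕ) : ℝ) * (n : ℝ) ^ (t - #p.1) * N) *
          (permConst m t * ((n : ℝ) ^ t / (n : ℝ) ^ (2 * t - #p.1))) := by gcongr
      _ = #G * (((32 ^ m * t ^ t + permConst m t : ℕ) : ℝ) * N * permConst m t) *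
          ((n : ℝ) ^ (t - #p.1) * ((n : ℝ) ^ t / (n : ℝ) ^ (2 * t - #p.1))) := by ring
      _ = _ := by
          rw [hpow]
          field_simp
  have hI : (#I : ℝ) ≤ 4 ^ m := by
    have h1 : #I ≤ 4 ^ m := by
      refine (card_filter_le _ _).trans (le_of_eq ?_)
      rw [card_univ, Fintype.card_prod, Fintype.card_finset, Fintype.card_fin, ← mul_pow]
      norm_num
    exact_mod_cast h1
  have h1 : (#(I.biUnion fun p => (𝓢' p).biUnion (F p)) : ℝ) ≤
      ∑ p ∈ I, (#((𝓢' p).biUnion (F p)) : ℝ) := by exact_mod_cast card_biUnion_le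
  refine (Nat.cast_le.2 (card_le_card hsub)).trans (h1.trans ((sum_le_sum hp).trans ?_))
  rw [sum_const, nsmul_eq_mul]
  calc _ ≤ 4 ^ m * (((32 ^ m * t ^ t + permConst m t : ℕ) : ℝ) * permConst m t / (k + 1) * #G) := by
        gcongr
    _ = _ := by
        rw [badConst]
        push_cast
        ring

end BadPair

section MixClash

variable {m t k : ℕ} {U V X : Type*} [Fintype U] [DecidableEq U] [Fintype V] [DecidableEq V]
  [Fintype X] [DecidableEq X] {E : Finset (Finset (Fin m))} {P : Finset (Fin m ↪ V)}
  {Z : Finset (Finset V)} {c : U → V → X}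

theorem IsCode.card_agree_le (hc : IsCode t c) (htn : t ≤ Fintype.card V)
    (A : Finset V) (hA : #A ≤ t) (y : V → X) :
    #{u | ∀ v ∈ A, c u v = y v} ≤ Fintype.card X ^ (t - #A) := by
  classical
  obtain ⟨T, hAT, -, hT⟩ := exists_subsuperset_card_eq (subset_univ A) hA (by simpa using htn)
  have h1 := card_forall_eq (Tᶜ ∪ A) y
  have h2 : #(Tᶜ ∪ A) = Fintype.card V - t + #A := by
    rw [card_union_of_disjoint, card_compl, hT]
    exact disjoint_left.2 fun i hi hi' => (mem_compl.1 hi) (hAT hi')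
  rw [h2, show Fintype.card V - (Fintype.card V - t + #A) = t - #A by omega] at h1
  rw [← h1]
  refine card_le_card_of_injOn (fun u => T.piecewise (c u) y) ?_ ?_
  · intro u hu
    have hu := (mem_filter.1 hu).2
    simp only [mem_coe, mem_filter, mem_univ, true_and, mem_union, mem_compl]
    rintro i (hi | hi)
    · simp [hi]
    · simpa [hAT hi] using hu i hi
  · intro u _ w _ h
    refine hc.eq_of_subset hT.ge fun v hv => ?_
    simpa [hv] using congrFun h v

/-- A new copy `y` clashes with the new copy `(f, x)` and an old copy. -/
def MixClash (t : ℕ) (E : Finset (Finset (Fin m))) (P : Finset (Fin m ↪ V)) (c : U → V → X)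
    (f : Fin m ↪ V) (x : Fin m → X) (ω : U → Equiv.Perm V × Fin (k + 1))
    (y : (Fin m ↪ V) × (Fin m → X)) : Prop :=
  ¬ Share t E (newEmb f x) (newEmb y.1 y.2) ∧ ∃ u, ∃ g ∈ P,
    ¬ Share t E (newEmb f x) (g.trans (blowEmb c (permOf ω) u)) ∧
    ¬ Share t E (newEmb y.1 y.2) (g.trans (blowEmb c (permOf ω) u)) ∧
    Clash₃ t E (newEmb f x) (newEmb y.1 y.2) (g.trans (blowEmb c (permOf ω) u))

/-- The pattern of a clash recorded by `MixClash`. -/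
def MixPattern (E : Finset (Finset (Fin m))) (P : Finset (Fin m ↪ V)) (c : U → V → X)
    (f : Fin m ↪ V) (x : Fin m → X) (ω : U → Equiv.Perm V × Fin (k + 1))
    (y : (Fin m ↪ V) × (Fin m → X)) (S₁ S₂ S₂' S : Finset (Fin m)) (u : U) : Prop :=
  (∀ i ∈ S₁, c u (f i) = x i) ∧ (∀ j ∈ S₂', ∃ i, f i = y.1 j ∧ y.2 j = x i) ∧
    (∀ j ∈ S, y.2 j = c u (y.1 j)) ∧ Disjoint (S₁.map f) (S.map y.1) ∧
    (∃ e ∈ E, S₂.map f ⊆ e.map y.1) ∧ ((ω u).2 ≠ 0 → y.1 = f) ∧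
    Cov E P ((S₁.map f ∪ S.map y.1).map (ret (ω u)).toEmbedding)

theorem MixClash.exists_pattern (hP : IsPacking t E P Z) {f : Fin m ↪ V} (hf : f ∈ P)
    {x : Fin m → X}
    {ω : U → Equiv.Perm V × Fin (k + 1)} {y : (Fin m ↪ V) × (Fin m → X)} (hy : y.1 ∈ P)
    (h : MixClash t E P c f x ω y) : ∃ S₁ S₂ S₂' S : Finset (Fin m),
      (#S₁ < t ∧ #S₂ < t ∧ #S₂' = #S₂ ∧ #S₁ + #S₂ + #S = 2 * t ∧ Disjoint S₂' S) ∧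
      ∃ u, MixPattern E P c f x ω y S₁ S₂ S₂' S u := by
  classical
  obtain ⟨f₂, x₂⟩ := y
  obtain ⟨s1, u, g, hg, s2, s3, e₁, he₁, e₂, he₂, e₃, he₃, H⟩ := h
  simp only at hy s1 s2 s3 H ⊢
  rw [not_share] at s1 s2 s3
  have H2 := H.le_card_sdiff
  have c12 := s1 e₁ he₁ e₂ he₂
  have c13 := s2 e₁ he₁ e₃ he₃
  set b := e₃.map (g.trans (blowEmb c (permOf ω) u)) with hb
  set S₂ := ({i ∈ e₁ | newEmb f x i ∈ e₂.map (newEmb f₂ x₂)} : Finset _) with hS₂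
  set S₂' := ({i ∈ e₂ | newEmb f₂ x₂ i ∈ e₁.map (newEmb f x)} : Finset _) with hS₂'
  set S₁ := ({i ∈ e₁ | newEmb f x i ∈ b} : Finset _) with hS₁
  have k2 : #S₂' = #S₂ := by
    rw [← card_map (newEmb f₂ x₂), ← map_inter_eq_filter, inter_comm, map_inter_eq_filter, card_map]
  set S₀ := ({i ∈ e₂ | newEmb f₂ x₂ i ∈ b \ e₁.map (newEmb f x)} : Finset _) with hS₀
  have k3 : (e₂.map (newEmb f₂ x₂) ∩ b) \ e₁.map (newEmb f x) = S₀.map (newEmb f₂ x₂) := by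
    rw [← map_inter_eq_filter, inter_sdiff_assoc]
  have d12 : #(e₁.map (newEmb f x) ∩ e₂.map (newEmb f₂ x₂)) = #S₂ := by
    rw [map_inter_eq_filter, card_map]
  have d13 : #(e₁.map (newEmb f x) ∩ b) = #S₁ := by
    rw [map_inter_eq_filter, card_map]
  rw [k3, d12, d13, card_map] at H2
  rw [d12] at c12
  rw [d13] at c13
  obtain ⟨S, hS, hSc⟩ := exists_subset_card_eq (s := S₀) (n := 2 * t - (#S₁ + #S₂)) (by omega)
  have a1 : ∀ i ∈ S₁, c u (f i) = x i := fun i hi => (mem_map_old.1 (mem_filter.1 hi).2).1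
  have aS : ∀ j ∈ S, newEmb f₂ x₂ j ∈ b ∧ newEmb f₂ x₂ j ∉ e₁.map (newEmb f x) := fun j hj =>
    Finset.mem_sdiff.1 (mem_filter.1 (hS hj)).2
  refine ⟨S₁, S₂, S₂', S, ⟨c13, c12, k2, by omega, ?_⟩, u, a1, ?_, ?_, ?_, ⟨e₂, he₂, ?_⟩, ?_, g, hg,
      e₃, he₃, ?_⟩
  · rw [disjoint_left]
    intro j hj hjS
    exact (aS j hjS).2 (mem_filter.1 hj).2
  · intro j hj
    obtain ⟨i, -, h⟩ := Finset.mem_map.1 (mem_filter.1 hj).2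
    obtain ⟨h1, h2⟩ := Prod.ext_iff.1 h
    exact ⟨i, h1, h2.symm⟩
  · intro j hj
    exact (mem_map_old.1 (aS j hj).1).1.symm
  · rw [disjoint_left]
    intro v hv hvS
    obtain ⟨i, hi, rfl⟩ := Finset.mem_map.1 hv
    obtain ⟨j, hj, h⟩ := Finset.mem_map.1 hvS
    refine (aS j hj).2 (Finset.mem_map.2 ⟨i, (mem_filter.1 hi).1, ?_⟩)
    have := (mem_map_old.1 (aS j hj).1).1
    simp only [newEmb_apply] at this ⊢
    rw [← this, h, a1 i hi]
  · intro v hv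
    obtain ⟨i, hi, rfl⟩ := Finset.mem_map.1 hv
    obtain ⟨j, hj, h⟩ := Finset.mem_map.1 (mem_filter.1 hi).2
    exact Finset.mem_map.2 ⟨j, hj, (Prod.ext_iff.1 h).1⟩
  · intro hsp
    have hσ : permOf ω u = 1 := by
      rw [permOf, ret_of_ne hsp]; rfl
    by_contra hne
    have hne' : f ≠ f₂ := fun h => hne h.symm
    have c12' := s1 e₁ he₁ e₂ he₂
    have c13' := s2 e₁ he₁ e₃ he₃
    have c23' := s3 e₂ he₂ e₃ he₃
    by_cases hfg : f = g
    · subst hfg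
      refine not_clash_of_card c13'.le ?_ H.rotate.rotate.swap
      refine (card_inter_le_of_image (injOn_fst_newEmb e₂) (image_fst_newEmb e₂) ?_).trans_lt
        (hP.inter_range_lt hf hy hne' he₂)
      rw [image_union, image_fst_newEmb, image_fst_old hσ]
      exact union_subset (map_subset_map.2 (subset_univ _)) (map_subset_map.2 (subset_univ _))
    · by_cases hgg : f₂ = g
      · subst hgg
        refine not_clash_of_card c23'.le ?_ H.rotate
        refine (card_inter_le_of_image (injOn_fst_newEmb e₁) (image_fst_newEmb e₁) ?_).trans_lt
          (hP.inter_range_lt hy hf hne he₁)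
        rw [image_union, image_fst_newEmb, image_fst_old hσ]
        exact union_subset (map_subset_map.2 (subset_univ _)) (map_subset_map.2 (subset_univ _))
      · have := H.image Prod.fst (injOn_fst_newEmb e₁) (injOn_fst_old e₃)
        rw [image_fst_newEmb, image_fst_newEmb, image_fst_old hσ] at this
        exact hP.not_clash f hf f₂ hy g hg hne' hfg hgg e₁ he₁ e₂ he₂ e₃ he₃ this
  · intro w hw
    obtain ⟨v, hv, rfl⟩ := Finset.mem_map.1 hw
    rcases mem_union.1 hv with hv | hv
    · obtain ⟨i, hi, rfl⟩ := Finset.mem_map.1 hv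
      exact (mem_map_old.1 (mem_filter.1 hi).2).2
    · obtain ⟨j, hj, rfl⟩ := Finset.mem_map.1 hv
      exact (mem_map_old.1 (aS j hj).1).2

/-- The constant in the estimate of mixed clashes. -/
def mixConst (m t : ℕ) : ℕ := 16 ^ m * (1 + 8 ^ m * t ^ t * permConst m t)

theorem card_eval (u : U) (B : Equiv.Perm V × Fin (k + 1) → Prop) : open Classical in
    #{ω : U → Equiv.Perm V × Fin (k + 1) | B (ω u)} * Fintype.card (Equiv.Perm V × Fin (k + 1)) =
      Fintype.card (U → Equiv.Perm V × Fin (k + 1)) * #{o | B o} := by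
  classical
  have := card_and_mem_mul u (fun _ : U → Equiv.Perm V × Fin (k + 1) => True) (fun _ _ => Iff.rfl) B
  simpa using this

theorem IsPacking.card_mixClash_le (hP : IsPacking t E P Z) (hE : ∀ e ∈ E, t ≤ #e) (hm : 1 ≤ m)
    (htm : t ≤ m) (hc : IsCode t c) (htn : t ≤ Fintype.card V) (hV : 0 < Fintype.card V)
    [Nonempty X] {f : Fin m ↪ V} (hf : f ∈ P) (x : Fin m → X) : open Classical in
    ∑ ω : U → Equiv.Perm V × Fin (k + 1),
      (#{y ∈ P ×ˢ (univ : Finset (Fin m → X)) | MixClash t E P c f x ω y} : ℝ) ≤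
      mixConst m t * (Fintype.card X : ℝ) ^ (m - t) *
        Fintype.card (U → Equiv.Perm V × Fin (k + 1)) := by
  classical
  set N : ℝ := ((Fintype.card (U → Equiv.Perm V × Fin (k + 1)) : ℕ) : ℝ) with hN
  set L : ℝ := ((Fintype.card (Equiv.Perm V × Fin (k + 1)) : ℕ) : ℝ) with hL
  have hL0 : 0 < L := by
    rw [hL]
    exact_mod_cast Fintype.card_pos
  set n := Fintype.card V with hn
  have hn0 : (0 : ℝ) < n := by exact_mod_cast hV
  set M := Fintype.card X with hM
  have hM0 : 0 < M := Fintype.card_pos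
  let W := U → Equiv.Perm V × Fin (k + 1)
  let I : Finset (Finset (Fin m) × Finset (Fin m) × Finset (Fin m) × Finset (Fin m)) :=
    {q | #q.1 < t ∧ #q.2.1 < t ∧ #q.2.2.1 = #q.2.1 ∧ #q.1 + #q.2.1 + #q.2.2.2 = 2 * t ∧
      Disjoint q.2.2.1 q.2.2.2}
  let Us : Finset (Fin m) → Finset U := fun S₁ => {u | ∀ i ∈ S₁, c u (f i) = x i}
  let Xs : Finset (Fin m) → Finset (Fin m) → (Fin m ↪ V) → U → Finset (Fin m → X) :=
    fun S₂' S f₂ u => {z | (∀ j ∈ S₂', z j = if h : ∃ i, f i = f₂ j then x h.choose else x j) ∧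
      ∀ j ∈ S, z j = c u (f₂ j)}
  let Ps : Finset (Fin m) → Finset (Fin m ↪ V) := fun S₂ => {f₂ ∈ P | ∃ e ∈ E, S₂.map f ⊆ e.map f₂}
  let A : Finset (Fin m) → Finset (Fin m) → U → (Fin m ↪ V) → Finset W := fun S₁ S u f₂ =>
    if Disjoint (S₁.map f) (S.map f₂) then
      ({ω : U → Equiv.Perm V × Fin (k + 1) |
        (ω u).2 = 0 ∧ Cov E P ((S₁.map f ∪ S.map f₂).map (ret (ω u)).toEmbedding)} : Finset _)
            else ∅
  let F : Finset (Fin m) × Finset (Fin m) × Finset (Fin m) × Finset (Fin m) → U →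
      Finset (W × ((Fin m ↪ V) × (Fin m → X))) := fun q u =>
    ((univ : Finset W) ×ˢ ({f} ×ˢ Xs q.2.2.1 q.2.2.2 f u)) ∪
      (Ps q.2.1).biUnion fun f₂ => A q.1 q.2.2.2 u f₂ ×ˢ ({f₂} ×ˢ Xs q.2.2.1 q.2.2.2 f₂ u)
  have hsum : ∑ ω : W, #{y ∈ P ×ˢ (univ : Finset (Fin m → X)) | MixClash t E P c f x ω y} =
      #({p ∈ (univ : Finset W) ×ˢ (P ×ˢ (univ : Finset (Fin m → X))) |
          MixClash t E P c f x p.1 p.2} :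
        Finset _) := by
    rw [card_eq_sum_card_fiberwise (f := Prod.fst) (t := univ) (by simp)]
    refine sum_congr rfl fun ω _ => ?_
    refine card_bij' (fun y _ => (ω, y)) (fun p _ => p.2) ?_ ?_ ?_ ?_
    · intro y hy
      rw [mem_filter] at hy
      simpa [and_assoc] using hy
    · rintro ⟨ω', y⟩ hp
      simp only [mem_filter] at hp
      obtain ⟨⟨hp, h⟩, rfl⟩ := hp
      exact mem_filter.2 ⟨(mem_product.1 hp).2, h⟩
    · intros; rfl
    · rintro ⟨ω', y⟩ hp
      simp only [mem_filter] at hp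
      exact Prod.ext hp.2.symm rfl
  have hsub : ({p ∈ (univ : Finset W) ×ˢ (P ×ˢ (univ : Finset (Fin m → X))) |
      MixClash t E P c f x p.1 p.2} : Finset _) ⊆ I.biUnion fun q => (Us q.1).biUnion (F q) := by
    rintro ⟨ω, f₂, x₂⟩ hp
    obtain ⟨hp, h⟩ := mem_filter.1 hp
    have hf₂ : f₂ ∈ P := (mem_product.1 (mem_product.1 hp).2).1
    obtain ⟨S₁, S₂, S₂', S, hI, u, p1, p2, p3, p4, p5, p6, p7⟩ := h.exists_pattern hP hf hf₂
    refine mem_biUnion.2 ⟨(S₁, S₂, S₂', S), mem_filter.2 ⟨mem_univ _, hI⟩,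
      mem_biUnion.2 ⟨u, mem_filter.2 ⟨mem_univ _, p1⟩, ?_⟩⟩
    have hx : x₂ ∈ Xs S₂' S f₂ u := by
      refine mem_filter.2 ⟨mem_univ _, fun j hj => ?_, p3⟩
      obtain ⟨i, hi, hi'⟩ := p2 j hj
      have h : ∃ i, f i = f₂ j := ⟨i, hi⟩
      rw [dif_pos h, f.injective (h.choose_spec.trans hi.symm)]
      exact hi'
    by_cases hs : (ω u).2 = 0
    · refine mem_union_right _ (mem_biUnion.2 ⟨f₂, mem_filter.2 ⟨hf₂, p5⟩, mem_product.2 ⟨?_, ?_⟩⟩)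
      · simp only [A]
        rw [if_pos p4]
        exact mem_filter.2 ⟨mem_univ _, hs, p7⟩
      · exact mem_product.2 ⟨mem_singleton_self _, hx⟩
    · obtain rfl : f₂ = f := p6 hs
      exact mem_union_left _ (mem_product.2 ⟨mem_univ _, mem_product.2 ⟨mem_singleton_self _, hx⟩⟩)
  have hA : ∀ S₁ S₂ S : Finset (Fin m), ∀ u f₂, #S₂ < t → #S₁ + #S₂ + #S = 2 * t →
      (#(A S₁ S u f₂) : ℝ) ≤ N * permConst m t / (n : ℝ) ^ (t - #S₂) := by
    intro S₁ S₂ S u f₂ ht hs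
    simp only [A]
    split_ifs with hd
    · have h1 := card_eval (V := V) (k := k) u fun o =>
        o.2 = 0 ∧ Cov E P ((S₁.map f ∪ S.map f₂).map (ret o).toEmbedding)
      have hQ : #(S₁.map f ∪ S.map f₂) = t + (t - #S₂) := by
        rw [card_union_of_disjoint hd, card_map, card_map]
        omega
      have h2 := hP.card_special_cov_le (k := k) hE hV (S₁.map f ∪ S.map f₂) (by
        rw [hQ]
        nlinarith [Nat.mul_le_mul_right t hm, Nat.sub_le t #S₂])
      rw [hQ, ← hn, ← hL, pow_add] at h2
      have h1' : (#({ω : U → Equiv.Perm V × Fin (k + 1) |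
          (ω u).2 = 0 ∧ Cov E P ((S₁.map f ∪ S.map f₂).map (ret (ω u)).toEmbedding)} : Finset _) :
              ℝ) *
          L = N * #({o | o.2 = 0 ∧ Cov E P ((S₁.map f ∪ S.map f₂).map (ret o).toEmbedding)} :
            Finset (Equiv.Perm V × Fin (k + 1))) := by
        rw [hL, hN]
        exact_mod_cast (by convert h1)
      rw [← mul_le_mul_iff_left₀ hL0, h1']
      have hk : L / (k + 1) ≤ L := div_le_self hL0.le (by linarith [k.cast_nonneg (α := ℝ)])
      have h3 : (n : ℝ) ^ t / ((n : ℝ) ^ t * (n : ℝ) ^ (t - #S₂)) = 1 / (n : ℝ) ^ (t - #S₂) := by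
        field_simp
      rw [h3] at h2
      calc _ ≤ N * (permConst m t * (1 / (n : ℝ) ^ (t - #S₂)) * (L / (k + 1))) :=
            mul_le_mul_of_nonneg_left (by convert h2) (by positivity)
        _ ≤ N * (permConst m t * (1 / (n : ℝ) ^ (t - #S₂)) * L) := by gcongr
        _ = _ := by ring
    · rw [card_empty, Nat.cast_zero]
      positivity
  have hF : ∀ q ∈ I, ∀ u, (#(F q u) : ℝ) ≤
      N * (1 + 8 ^ m * t ^ t * permConst m t) * (M : ℝ) ^ (m - (#q.2.1 + #q.2.2.2)) := by
    rintro ⟨S₁, S₂, S₂', S⟩ hq u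
    obtain ⟨i1, i2, i3, i4, i5⟩ := (mem_filter.1 hq).2
    simp only at i1 i2 i3 i4 i5 ⊢
    have hXs : ∀ f₂, #(Xs S₂' S f₂ u) = M ^ (m - (#S₂ + #S)) := by
      intro f₂
      rw [← i3]
      exact card_forall_eq_eq i5 _ _
    have hPs : #(Ps S₂) ≤ 8 ^ m * t ^ t * n ^ (t - #S₂) := by
      have := hP.card_covering_le hE (S₂.map f) (by rw [card_map]; exact i2.le)
      rw [card_map] at this
      exact this
    have h1 : #(F (S₁, S₂, S₂', S) u) ≤ Fintype.card W * M ^ (m - (#S₂ + #S)) +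
        ∑ f₂ ∈ Ps S₂, #(A S₁ S u f₂) * M ^ (m - (#S₂ + #S)) := by
      refine (card_union_le _ _).trans (add_le_add ?_
          (card_biUnion_le.trans (sum_le_sum fun f₂ _ => ?_)))
      · rw [card_product, card_product, card_singleton, one_mul, hXs, card_univ]
      · rw [card_product, card_product, card_singleton, one_mul, hXs]
    have h1' : (#(F (S₁, S₂, S₂', S) u) : ℝ) ≤ N * (M : ℝ) ^ (m - (#S₂ + #S)) +
        ∑ f₂ ∈ Ps S₂, (#(A S₁ S u f₂) : ℝ) * (M : ℝ) ^ (m - (#S₂ + #S)) := by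
      rw [hN]
      exact_mod_cast h1
    refine h1'.trans ?_
    rw [← sum_mul, ← add_mul]
    refine mul_le_mul_of_nonneg_right ?_ (by positivity)
    have h2 : ∑ f₂ ∈ Ps S₂, (#(A S₁ S u f₂) : ℝ) ≤
        (8 ^ m * t ^ t * (n : ℝ) ^ (t - #S₂)) * (N * permConst m t / (n : ℝ) ^ (t - #S₂)) := by
      refine (sum_le_sum fun f₂ _ => hA S₁ S₂ S u f₂ i2 i4).trans ?_
      rw [sum_const, nsmul_eq_mul]
      refine mul_le_mul_of_nonneg_right (by exact_mod_cast hPs) (by positivity)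
    have h3 : (8 ^ m * t ^ t * (n : ℝ) ^ (t - #S₂)) * (N * permConst m t / (n : ℝ) ^ (t - #S₂)) =
        N * (8 ^ m * t ^ t * permConst m t) := by
      field_simp
    linarith
  have hI : #I ≤ 16 ^ m := by
    refine (card_le_univ _).trans (le_of_eq ?_)
    simp only [Fintype.card_prod, Fintype.card_finset, Fintype.card_fin]
    rw [← mul_pow, ← mul_pow, ← mul_pow]
    norm_num
  have hT : ∀ q ∈ I, ∑ u ∈ Us q.1, (#(F q u) : ℝ) ≤
      N * (1 + 8 ^ m * t ^ t * permConst m t) * (M : ℝ) ^ (m - t) := by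
    intro q hq
    refine (sum_le_sum fun u _ => hF q hq u).trans ?_
    obtain ⟨i1, i2, i3, i4, i5⟩ := (mem_filter.1 hq).2
    have hUs : #(Us q.1) ≤ M ^ (t - #q.1) := by
      have := hc.card_agree_le htn (q.1.map f) (by rw [card_map]; exact i1.le)
        (fun v => if h : ∃ i, f i = v then x h.choose else Classical.arbitrary X)
      rw [card_map] at this
      refine (card_le_card fun u hu => ?_).trans this
      rw [mem_filter] at hu ⊢
      refine ⟨mem_univ _, fun v hv => ?_⟩
      obtain ⟨i, hi, rfl⟩ := Finset.mem_map.1 hv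
      have h : ∃ j, f j = f i := ⟨i, rfl⟩
      rw [dif_pos h, f.injective h.choose_spec]
      exact hu.2 i hi
    have h2 : #q.2.1 + #q.2.2.2 ≤ m := by
      rw [← i3, ← card_union_of_disjoint i5]
      simpa using card_le_univ (q.2.2.1 ∪ q.2.2.2)
    rw [sum_const, nsmul_eq_mul]
    calc (#(Us q.1) : ℝ) * (N * (1 + 8 ^ m * t ^ t * permConst m t) *
          (M : ℝ) ^ (m - (#q.2.1 + #q.2.2.2)))
        ≤ (M : ℝ) ^ (t - #q.1) * (N * (1 + 8 ^ m * t ^ t * permConst m t) *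
          (M : ℝ) ^ (m - (#q.2.1 + #q.2.2.2))) :=
        mul_le_mul_of_nonneg_right (by exact_mod_cast hUs) (by positivity)
      _ = N * (1 + 8 ^ m * t ^ t * permConst m t) *
          ((M : ℝ) ^ (t - #q.1 + (m - (#q.2.1 + #q.2.2.2)))) := by
        rw [pow_add]
        ring
      _ = _ := by
        congr 2
        omega
  calc (∑ ω : W, (#{y ∈ P ×ˢ (univ : Finset (Fin m → X)) | MixClash t E P c f x ω y} : ℝ))
      ≤ (#(I.biUnion fun q => (Us q.1).biUnion (F q)) : ℝ) := by
        exact_mod_cast hsum.le.trans (card_le_card hsub)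
    _ ≤ ∑ q ∈ I, ∑ u ∈ Us q.1, (#(F q u) : ℝ) := by
        exact_mod_cast card_biUnion_le.trans (sum_le_sum fun q _ => card_biUnion_le)
    _ ≤ ∑ q ∈ I, N * (1 + 8 ^ m * t ^ t * permConst m t) * (M : ℝ) ^ (m - t) := sum_le_sum hT
    _ ≤ 16 ^ m * (N * (1 + 8 ^ m * t ^ t * permConst m t) * (M : ℝ) ^ (m - t)) := by
        rw [sum_const, nsmul_eq_mul]
        refine mul_le_mul_of_nonneg_right (by exact_mod_cast hI) (by positivity)
    _ = _ := by
        rw [mixConst]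
        push_cast
        ring

end MixClash

theorem mem_filter_iff {α : Type*} {s : Finset α} {p : α → Prop} {inst : DecidablePred p} {a : α} :
    a ∈ @Finset.filter α p inst s ↔ a ∈ s ∧ p a := mem_filter

section Extend

variable {m t k : ℕ} {U V X : Type*} [Fintype U] [DecidableEq U] [Fintype V] [DecidableEq V]
  [Fintype X] [DecidableEq X] {E : Finset (Finset (Fin m))} {P : Finset (Fin m ↪ V)}
  {Z : Finset (Finset V)} {c : U → V → X}

open Classical in
/-- The new copy `(f, x)` can be added to the blowup and is in few clashes with other candidates. -/
def Usable (t : ℕ) (E : Finset (Finset (Fin m))) (P : Finset (Fin m ↪ V)) (Z : Finset (Finset V))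
    (c : U → V → X) (D : ℝ) (a : (Fin m ↪ V) × (Fin m → X))
    (ω : U → Equiv.Perm V × Fin (k + 1)) : Prop :=
  GoodAt t E P Z c a.1 a.2 ω ∧ ¬ BadAt t E P c a.1 a.2 ω ∧
    (#{y ∈ P ×ˢ (univ : Finset (Fin m → X)) | MixClash t E P c a.1 a.2 ω y} : ℝ) ≤
      D * (Fintype.card X : ℝ) ^ (m - t)

theorem mixConst_pos (m t : ℕ) : 0 < mixConst m t := by
  unfold mixConst
  positivity

theorem card_lt_mul_le {α : Type*} [Fintype α] (F : α → ℝ) (hF : ∀ a, 0 ≤ F a) (b : ℝ) :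
    open Classical in (#{a | b < F a} : ℝ) * b ≤ ∑ a, F a := by
  classical
  calc (#{a | b < F a} : ℝ) * b = ∑ a with b < F a, b := by rw [sum_const, nsmul_eq_mul]
    _ ≤ ∑ a with b < F a, F a := sum_le_sum fun a ha => (mem_filter.1 ha).2.le
    _ ≤ ∑ a, F a := sum_le_sum_of_subset_of_nonneg (filter_subset _ _) fun a _ _ => hF a

theorem IsPacking.card_usable_ge (hP : IsPacking t E P Z) (hE : ∀ e ∈ E, t ≤ #e) (hm : 1 ≤ m)
    (htm : t ≤ m) {κ : ℝ} (hκ : 0 < κ) (hκ1 : κ ≤ 1) (hZ : κ * (Fintype.card V : ℝ) ^ t ≤ #Z)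
    (hL : open Classical in κ * (Fintype.card V : ℝ) ^ t ≤
      #{Q : Finset V | #Q = t ∧ Q ∉ Z ∧ ¬ Cov E P Q})
    (hn : 2 * (2 ^ m * permConst m t) / κ ≤ Fintype.card V) (htn : t < Fintype.card V)
    (hk : 4 * badConst m t ≤ k + 1) (hc : IsCode t c) (hcd : PairDet t c) [Nonempty X]
    {f : Fin m ↪ V} (hf : f ∈ P) (x : Fin m → X) {w : ℕ}
    (hw : open Classical in #{u | InW t (pull c f) x u} ≤ w) : open Classical in
    (κ / (2 * (k + 1))) ^ w / 2 * Fintype.card (U → Equiv.Perm V × Fin (k + 1)) ≤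
      #{ω : U → Equiv.Perm V × Fin (k + 1) |
        Usable t E P Z c (4 * mixConst m t / (κ / (2 * (k + 1))) ^ w) (f, x) ω} := by
  classical
  have hV : 0 < Fintype.card V := by omega
  set N : ℝ := ((Fintype.card (U → Equiv.Perm V × Fin (k + 1)) : ℕ) : ℝ) with hN
  have hN0 : 0 < N := by
    rw [hN]
    exact_mod_cast Fintype.card_pos
  set β : ℝ := κ / (2 * (k + 1)) with hβ
  have hk0 : (0 : ℝ) < k + 1 := by positivity
  have hβ0 : 0 < β := by positivity
  have hβ1 : β ≤ 1 := by
    rw [hβ, div_le_one (by positivity)]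
    linarith [k.cast_nonneg (α := ℝ)]
  set γ : ℝ := β ^ w with hγ
  have hγ0 : 0 < γ := by positivity
  set M : ℝ := (Fintype.card X : ℝ) ^ (m - t) with hM
  have hM0 : 0 < M := by
    have : (0 : ℝ) < Fintype.card X := by exact_mod_cast Fintype.card_pos
    positivity
  have hmx : (0 : ℝ) < mixConst m t := by exact_mod_cast mixConst_pos m t
  set D : ℝ := 4 * mixConst m t / γ with hD
  let F : (U → Equiv.Perm V × Fin (k + 1)) → ℝ := fun ω =>
    #{y ∈ P ×ˢ (univ : Finset (Fin m → X)) | MixClash t E P c f x ω y}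
  have h1 : γ * N ≤ #{ω : U → Equiv.Perm V × Fin (k + 1) | GoodAt t E P Z c f x ω} := by
    have h := card_forall_mem_ge ({u | InW t (pull c f) x u} : Finset U)
      (fun u o => o.2 = 0 ∧ Ok t E P Z c f x u o.1) β hβ0.le fun u _ =>
      (hP.card_ok_ge hE hm hκ hκ1 hP.card_eq hZ hL hn hV htn (u := u) (k := k)).trans (le_of_eq (by
        congr!))
    refine le_trans ?_ (h.trans ?_)
    · exact mul_le_mul_of_nonneg_right (pow_le_pow_of_le_one hβ0.le hβ1 hw) hN0.le
    · refine Nat.cast_le.2 (card_le_card fun ω hω => ?_)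
      rw [mem_filter_iff] at hω ⊢
      exact ⟨mem_univ _, fun u hu => hω.2 u (mem_filter.2 ⟨mem_univ _, hu⟩)⟩
  set a : ℝ :=
    ((#{ω : U → Equiv.Perm V × Fin (k + 1) | GoodAt t E P Z c f x ω} : ℕ) : ℝ) with ha
  have h2 : (#{ω : U → Equiv.Perm V × Fin (k + 1) |
      GoodAt t E P Z c f x ω ∧ BadAt t E P c f x ω} : ℝ) ≤ a / 4 := by
    refine (hP.card_goodAt_badAt_le hE hm hV hcd).trans ?_
    rw [← ha]
    have h3 : (badConst m t : ℝ) / (k + 1) ≤ 1 / 4 := by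
      rw [div_le_iff₀ hk0]
      have : (4 * badConst m t : ℝ) ≤ k + 1 := by exact_mod_cast hk
      linarith
    have := mul_le_mul_of_nonneg_right h3 (show 0 ≤ a by positivity)
    linarith
  have h3 : (#{ω | D * M < F ω} : ℝ) ≤ γ * N / 4 := by
    have h := card_lt_mul_le F (fun _ => by positivity) (D * M)
    have h' := hP.card_mixClash_le (k := k) hE hm htm hc htn.le hV hf x
    rw [← hN, ← hM] at h'
    have h4 := h.trans h'
    have h5 : mixConst m t * M * N = γ * N / 4 * (D * M) := by
      rw [hD]
      field_simp
    rw [h5] at h4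
    exact le_of_mul_le_mul_right h4 (by positivity)
  have h4 : ({ω | GoodAt t E P Z c f x ω} : Finset (U → Equiv.Perm V × Fin (k + 1))) ⊆
      ({ω | Usable t E P Z c D (f, x) ω} : Finset _) ∪
        (({ω | GoodAt t E P Z c f x ω ∧ BadAt t E P c f x ω} : Finset _) ∪
          ({ω | D * M < F ω} : Finset _)) := by
    intro ω hω
    have hω := (mem_filter.1 hω).2
    by_cases hb : BadAt t E P c f x ω
    · exact mem_union_right _ (mem_union_left _ (mem_filter.2 ⟨mem_univ _, hω, hb⟩))
    · by_cases hd : D * M < F ω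
      · exact mem_union_right _ (mem_union_right _ (mem_filter.2 ⟨mem_univ _, hd⟩))
      · exact mem_union_left _ (mem_filter.2 ⟨mem_univ _, hω, hb, not_lt.1 hd⟩)
  have h5 : a ≤ #({ω | Usable t E P Z c D (f, x) ω} : Finset (U → Equiv.Perm V × Fin (k + 1))) +
      (#{ω : U → Equiv.Perm V × Fin (k + 1) |
        GoodAt t E P Z c f x ω ∧ BadAt t E P c f x ω} + #{ω | D * M < F ω}) := by
    rw [ha]
    exact_mod_cast (card_le_card h4).trans ((card_union_le _ _).trans
      (add_le_add_right (card_union_le _ _) _))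
  linarith

/-- Double counting: some column meets many rows. -/
theorem exists_le_card_of_forall {α β : Type*} [Fintype β] [Nonempty β] (s : Finset α)
    (r : α → β → Prop) (γ : ℝ)
    (h : open Classical in ∀ a ∈ s, γ * Fintype.card β ≤ #{b | r a b}) : open Classical in
    ∃ b, γ * #s ≤ #{a ∈ s | r a b} := by
  classical
  by_contra! hcon
  have h1 : ∑ b, #{a ∈ s | r a b} = ∑ a ∈ s, #{b | r a b} := by
    simp_rw [card_filter]
    rw [sum_comm]
  have h2 : (∑ b : β, (#{a ∈ s | r a b} : ℝ)) < ∑ b : β, γ * #s :=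
    sum_lt_sum_of_nonempty univ_nonempty fun b _ => hcon b
  have h3 : ∑ a ∈ s, γ * Fintype.card β ≤ ∑ a ∈ s, (#{b | r a b} : ℝ) := sum_le_sum h
  rw [sum_const, nsmul_eq_mul] at h2 h3
  have h1' : (∑ b : β, (#{a ∈ s | r a b} : ℝ)) = ∑ a ∈ s, (#{b | r a b} : ℝ) := by exact_mod_cast h1
  rw [h1', card_univ] at h2
  nlinarith

theorem newEmb_injective {a b : (Fin m ↪ V) × (Fin m → X)} (h : newEmb a.1 a.2 = newEmb b.1 b.2) :
    a = b := by
  have h1 : ∀ i, (a.1 i, a.2 i) = (b.1 i, b.2 i) := fun i => DFunLike.congr_fun h i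
  refine Prod.ext (DFunLike.ext _ _ fun i => (Prod.ext_iff.1 (h1 i)).1)
      (funext fun i => (Prod.ext_iff.1 (h1 i)).2)

theorem IsPacking.exists_extend (hP : IsPacking t E P Z) (hE : ∀ e ∈ E, t ≤ #e) (hE0 : E.Nonempty)
    (hm : 1 ≤ m)
    (htm : t ≤ m) {κ : ℝ} (hκ : 0 < κ) (hκ1 : κ ≤ 1) (hZ : κ * (Fintype.card V : ℝ) ^ t ≤ #Z)
    (hL : open Classical in κ * (Fintype.card V : ℝ) ^ t ≤
      #{Q : Finset V | #Q = t ∧ Q ∉ Z ∧ ¬ Cov E P Q})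
    (hn : 2 * (2 ^ m * permConst m t) / κ ≤ Fintype.card V) (htn : t < Fintype.card V)
    (hk : 4 * badConst m t ≤ k + 1) (hc : IsCode t c) (hcd : PairDet t c) [Nonempty X]
    (hU : Fintype.card U = Fintype.card X ^ t) {w : ℕ} (𝒢 : Finset ((Fin m ↪ V) × (Fin m → X)))
    (h𝒢 : ∀ a ∈ 𝒢, a.1 ∈ P ∧ (∀ u, #(agr (pull c a.1) a.2 u) ≤ t) ∧ Rigid t c a.1 a.2)
    (hw : open Classical in ∀ a ∈ 𝒢, #{u | InW t (pull c a.1) a.2 u} ≤ w) :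
    ∃ P' : Finset (Fin m ↪ V × X), ∃ Z' : Finset (Finset (V × X)), IsPacking t E P' Z' ∧
      #Z' = Fintype.card X ^ t * #Z ∧
      (Fintype.card X : ℝ) ^ t * #P + (κ / (2 * (k + 1))) ^ w / 2 * #𝒢 /
        ((1 + 2 ^ m + 16 ^ m + 4 * mixConst m t / (κ / (2 * (k + 1))) ^ w) *
          (Fintype.card X : ℝ) ^ (m - t)) ≤ #P' := by
  classical
  set β : ℝ := κ / (2 * (k + 1)) with hβ
  have hβ0 : 0 < β := by positivity
  set D : ℝ := 4 * mixConst m t / β ^ w with hD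
  have hD0 : 0 ≤ D := by positivity
  obtain ⟨ω, hω⟩ := exists_le_card_of_forall 𝒢
    (fun a (ω : U → Equiv.Perm V × Fin (k + 1)) => Usable t E P Z c D a ω) (β ^ w / 2) fun a ha =>
      hP.card_usable_ge hE hm htm hκ hκ1 hZ hL hn htn hk hc hcd (h𝒢 a ha).1 a.2 (hw a ha)
  set A : Finset ((Fin m ↪ V) × (Fin m → X)) := {a ∈ 𝒢 | Usable t E P Z c D a ω} with hA
  set σ := permOf ω with hσ
  set ν : (Fin m ↪ V) × (Fin m → X) → (Fin m ↪ V × X) := fun a => newEmb a.1 a.2 with hν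
  have hAP : ∀ a ∈ A, a.1 ∈ P := fun a ha => (h𝒢 a (mem_filter.1 ha).1).1
  have hadd : ∀ a ∈ A, Addable t E (blowP c σ P) (blowZ c σ Z) (ν a) := by
    intro a ha
    obtain ⟨ha, hg, hb, -⟩ := mem_filter.1 ha
    obtain ⟨g1, g2, g3⟩ := h𝒢 a ha
    refine hP.addable hc hU g1 g2 g3 (fun u hu => ?_) ?_
    · have h1 : (σ u).symm = (ω u).1 := by
        rw [← hg.ret_eq hu]
        rfl
      rw [h1]
      exact (hg u hu).2
    · intro u u' hne hu hu' hs g hgP g' hgP' e he e₁ he₁ e₂ he₂ hcl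
      exact hb ⟨u, u', hne, hu, hu', hs, g, hgP, g', hgP', e, he, e₁, he₁, e₂, he₂, hcl⟩
  have hold : ∀ a ∈ A, ∀ h ∈ blowP c σ P, ¬ Share t E (ν a) h := fun a ha h hh =>
    not_share.2 ((hadd a ha).inter_lt h hh)
  set C₂ : (Fin m ↪ V) × (Fin m → X) → (Fin m ↪ V) × (Fin m → X) → Prop := fun a b =>
    Share t E (ν a) (ν b) ∨ ∃ h ∈ blowP c σ P, Clash₃ t E (ν a) (ν b) h with hC₂
  set M := Fintype.card X with hM
  have hM0 : 0 < M := Fintype.card_pos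
  obtain ⟨R, hRA, hR, hcard⟩ := exists_conflictFree A C₂ (fun a b d => Clash₃ t E (ν a) (ν b) (ν d))
    (by
      rintro a b (h | ⟨h, hh, H⟩)
      · exact Or.inl h.symm
      · exact Or.inr ⟨h, hh, H.swap⟩)
    (fun a b d H => H.rotate) (2 ^ m * M ^ (m - t) + ⌊D * (M : ℝ) ^ (m - t)⌋₊)
        (16 ^ m * M ^ (m - t))
    (by
      intro a ha
      have h1 := hP.card_share_le (hAP a ha) a.2
      have h2 : #{y ∈ P ×ˢ (univ : Finset (Fin m → X)) | MixClash t E P c a.1 a.2 ω y} ≤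
          ⌊D * (M : ℝ) ^ (m - t)⌋₊ := Nat.le_floor (mem_filter.1 ha).2.2.2
      refine (card_le_card fun b hb => ?_).trans ((card_union_le _ _).trans (add_le_add h1 h2))
      rw [mem_filter_iff] at hb
      obtain ⟨hb, h⟩ := hb
      have hbm : b ∈ P ×ˢ (univ : Finset (Fin m → X)) := mem_product.2 ⟨hAP b hb, mem_univ _⟩
      by_cases hs : Share t E (ν a) (ν b)
      · exact mem_union_left _ (mem_filter.2 ⟨hbm, hs⟩)
      · obtain ⟨h, hh, H⟩ := h.resolve_left hs
        have s1 := hold a ha h hh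
        have s2 := hold b hb h hh
        obtain ⟨u, g, hg, rfl⟩ := mem_blowP.1 hh
        exact mem_union_right _ (mem_filter.2 ⟨hbm, hs, u, g, hg, s1, s2, H⟩))
    (by
      intro R hRA hR a ha
      have h1 := hP.card_clash₃_le hE htm (hAP a (hRA ha)) a.2 R (fun b hb => hAP b (hRA hb))
        fun b hb d hd hne hs => hR.1 b hb d hd hne (Or.inl hs)
      refine (card_le_card fun p hp => ?_).trans h1
      rw [mem_filter_iff] at hp
      obtain ⟨hp, -, h2, h3, h4, h5⟩ := hp
      obtain ⟨p1, p2⟩ := mem_product.1 hp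
      exact mem_filter.2 ⟨mem_product.2 ⟨p1, mem_product.2 ⟨hAP _ p2, mem_univ _⟩⟩,
        fun h => h2 (Or.inl h), fun h => h3 (Or.inl h), fun h => h4 (Or.inl h), h5⟩)
  have hinj : Function.Injective ν := fun a b h => newEmb_injective h
  refine ⟨blowP c σ P ∪ R.image ν, blowZ c σ Z, ?_, ?_, ?_⟩
  · refine (hP.blow hc).union ?_ ?_ ?_ ?_
    · intro f hf
      obtain ⟨a, ha, rfl⟩ := mem_image.1 hf
      exact hadd a (hRA ha)
    · intro f hf g hg hne
      obtain ⟨a, ha, rfl⟩ := mem_image.1 hf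
      obtain ⟨b, hb, rfl⟩ := mem_image.1 hg
      exact fun h => hR.1 a ha b hb (fun hab => hne (by rw [hab])) (Or.inl h)
    · intro f hf g hg hne h hh H
      obtain ⟨a, ha, rfl⟩ := mem_image.1 hf
      obtain ⟨b, hb, rfl⟩ := mem_image.1 hg
      exact hR.1 a ha b hb (fun hab => hne (by rw [hab])) (Or.inr ⟨h, hh, H⟩)
    · intro f hf g hg h hh n1 n2 n3
      obtain ⟨a, ha, rfl⟩ := mem_image.1 hf
      obtain ⟨b, hb, rfl⟩ := mem_image.1 hg
      obtain ⟨d, hd, rfl⟩ := mem_image.1 hh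
      exact hR.2 a ha b hb d hd (fun h => n1 (by rw [h])) (fun h => n2 (by rw [h]))
        (fun h => n3 (by rw [h]))
  · rw [card_blowZ hc hP.card_eq, hU]
  · have hdisj : Disjoint (blowP c σ P) (R.image ν) := by
      rw [disjoint_right]
      intro f hf hf'
      obtain ⟨a, ha, rfl⟩ := mem_image.1 hf
      obtain ⟨e, he⟩ := hE0
      have := (hadd a (hRA ha)).inter_lt _ hf' e he e he
      rw [inter_self, card_map] at this
      exact absurd (hE e he) (by omega)
    rw [card_union_of_disjoint hdisj, card_blowP hc htm, card_image_of_injective _ hinj, hU]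
    push_cast
    have hMr : (0 : ℝ) < (M : ℝ) ^ (m - t) := by positivity
    have hM1 : (1 : ℝ) ≤ (M : ℝ) ^ (m - t) := one_le_pow₀ (by exact_mod_cast hM0)
    refine add_le_add le_rfl ?_
    rw [div_le_iff₀ (by positivity)]
    refine hω.trans ?_
    have hcard' : (#A : ℝ) ≤ #R * (1 + (2 ^ m * M ^ (m - t) + ⌊D * (M : ℝ) ^ (m - t)⌋₊ : ℝ) +
        16 ^ m * M ^ (m - t)) := by exact_mod_cast hcard
    refine hcard'.trans (mul_le_mul_of_nonneg_left ?_ (by positivity))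
    have := Nat.floor_le (show 0 ≤ D * (M : ℝ) ^ (m - t) by positivity)
    nlinarith

end Extend

section Generic

variable {m t : ℕ}

theorem card_exists_lt_agr_le {U X : Type*} [Fintype U] [Fintype X] [DecidableEq X] (htm : t < m)
    (hU : Fintype.card U = Fintype.card X ^ t) (c : U → Fin m → X) : open Classical in
    #{x : Fin m → X | ∃ u, t < #(agr c x u)} ≤ 2 ^ m * Fintype.card X ^ (m - 1) := by
  classical
  have h1 : ({x : Fin m → X | ∃ u, t < #(agr c x u)} : Finset _) ⊆
      ((univ : Finset U) ×ˢ powersetCard (t + 1) (univ : Finset (Fin m))).biUnion fun q =>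
        ({x | ∀ i ∈ q.2, x i = c q.1 i} : Finset (Fin m → X)) := by
    intro x hx
    obtain ⟨u, hu⟩ := (mem_filter.1 hx).2
    obtain ⟨T, hT, hTc⟩ := exists_subset_card_eq (Nat.succ_le_of_lt hu)
    refine mem_biUnion.2 ⟨(u, T), mem_product.2 ⟨mem_univ _,
        mem_powersetCard.2 ⟨subset_univ _, hTc⟩⟩,
      mem_filter.2 ⟨mem_univ _, fun i hi => ?_⟩⟩
    exact (mem_agr.1 (hT hi)).symm
  refine (card_le_card h1).trans (card_biUnion_le.trans ?_)
  have h2 : ∀ q ∈ (univ : Finset U) ×ˢ powersetCard (t + 1) (univ : Finset (Fin m)),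
      #({x | ∀ i ∈ q.2, x i = c q.1 i} : Finset (Fin m → X)) = Fintype.card X ^ (m - (t + 1)) := by
    intro q hq
    have h := card_forall_eq q.2 (c q.1)
    rw [Fintype.card_fin, (mem_powersetCard.1 (mem_product.1 hq).2).2] at h
    exact le_antisymm (h.le.trans' (le_of_eq (by congr!))) (h.ge.trans (le_of_eq (by congr!)))
  rw [sum_congr rfl h2, sum_const, card_product, card_univ, hU, smul_eq_mul, mul_right_comm,
    ← pow_add, show t + (m - (t + 1)) = m - 1 by omega, mul_comm]
  refine Nat.mul_le_mul_right _ ((card_le_univ _).trans ?_)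
  simp

variable {V : Type*} [Fintype V] [DecidableEq V]

theorem exists_generic_code (htm : t < m) (P : Finset (Fin m ↪ V)) (hP : P.Nonempty) :
    ∃ B : ℕ, ∀ q, B ≤ q → ∀ [Fact q.Prime], ∃ g : V → Fin t → ZMod q, IsCode t (linCode g) ∧
      ∃ 𝒢 : Finset ((Fin m ↪ V) × (Fin m → ZMod q)), (#P * (q : ℝ) ^ m / 2 ≤ #𝒢) ∧
        ∀ a ∈ 𝒢, a.1 ∈ P ∧ (∀ u, #(agr (pull (linCode g) a.1) a.2 u) ≤ t) ∧
          Rigid t (linCode g) a.1 a.2 := by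
  classical
  set C : ℕ := Fintype.card V * ((2 ^ m + 8 ^ m) * 4 ^ Fintype.card V) + 2 * t *
      8 ^ Fintype.card V with hC
  refine ⟨4 * C + 4 * 2 ^ m + 1, fun q hq _ => ?_⟩
  have hq0 : (0 : ℝ) < q := by exact_mod_cast (by omega : 0 < q)
  obtain ⟨g, hg⟩ := exists_le_card_of_forall (P ×ˢ (univ : Finset (Fin m → ZMod q)))
    (fun a (g : V → Fin t → ZMod q) => IsCode t (linCode g) ∧ Rigid t (linCode g) a.1 a.2) (3 / 4)
        (by
      intro a ha
      have h1 := card_not_rigid_mul_le (q := q) (t := t) a.1 a.2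
      have h2 := card_not_isCode_mul_le (q := q) (t := t) (V := V)
      set T := Fintype.card (V → Fin t → ZMod q) with hT
      have h3 : T ≤ #({g | IsCode t (linCode g) ∧ Rigid t (linCode g) a.1 a.2} :
          Finset (V → Fin t → ZMod q)) +
          (#({g | IsCode t (linCode g) ∧ ¬ Rigid t (linCode g) a.1 a.2} :
              Finset (V → Fin t → ZMod q)) +
            #({g | ¬ IsCode t (linCode g)} : Finset (V → Fin t → ZMod q))) := by
        rw [hT, ← card_univ]
        refine (card_le_card fun g _ => ?_).trans ((card_union_le _ _).trans
          (Nat.add_le_add_left (card_union_le _ _) _))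
        by_cases g1 : IsCode t (linCode g)
        · by_cases g2 : Rigid t (linCode g) a.1 a.2
          · exact mem_union_left _ (mem_filter.2 ⟨mem_univ _, g1, g2⟩)
          · exact mem_union_right _ (mem_union_left _ (mem_filter.2 ⟨mem_univ _, g1, g2⟩))
        · exact mem_union_right _ (mem_union_right _ (mem_filter.2 ⟨mem_univ _, g1⟩))
      have h4 : (#({g | IsCode t (linCode g) ∧ ¬ Rigid t (linCode g) a.1 a.2} :
          Finset (V → Fin t → ZMod q)) +
            #({g | ¬ IsCode t (linCode g)} : Finset (V → Fin t → ZMod q))) * q ≤ C * T := by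
        rw [add_mul, hC, add_mul]
        exact add_le_add (by convert h1) (by convert h2)
      have h5 : 4 * (#({g | IsCode t (linCode g) ∧ ¬ Rigid t (linCode g) a.1 a.2} :
          Finset (V → Fin t → ZMod q)) +
            #({g | ¬ IsCode t (linCode g)} : Finset (V → Fin t → ZMod q))) ≤ T := by
        refine Nat.le_of_mul_le_mul_right ?_ (by omega : 0 < q)
        calc _ ≤ 4 * (C * T) := by rw [mul_assoc]; exact Nat.mul_le_mul_left _ h4
          _ = T * (4 * C) := by ring
          _ ≤ T * q := Nat.mul_le_mul_left _ (by omega)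
      have h6 : 3 * T ≤ 4 * #({g | IsCode t (linCode g) ∧ Rigid t (linCode g) a.1 a.2} :
          Finset (V → Fin t → ZMod q)) := by omega
      have h7 : (3 * T : ℝ) ≤ 4 * #({g | IsCode t (linCode g) ∧ Rigid t (linCode g) a.1 a.2} :
          Finset (V → Fin t → ZMod q)) := by exact_mod_cast h6
      have h8 : (3 / 4 * T : ℝ) ≤ #({g | IsCode t (linCode g) ∧ Rigid t (linCode g) a.1 a.2} :
          Finset (V → Fin t → ZMod q)) := by linarith
      exact h8.trans (le_of_eq (by congr!)))
  have hPpos : (0 : ℝ) < #P := by exact_mod_cast hP.card_pos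
  have hcard : (#(P ×ˢ (univ : Finset (Fin m → ZMod q))) : ℝ) = #P * (q : ℝ) ^ m := by
    rw [card_product, card_univ]
    simp
  rw [hcard] at hg
  have hne : ({a ∈ P ×ˢ (univ : Finset (Fin m → ZMod q)) |
      IsCode t (linCode g) ∧ Rigid t (linCode g) a.1 a.2} : Finset _).Nonempty := by
    rw [← card_pos]
    have : (0 : ℝ) < 3 / 4 * (#P * (q : ℝ) ^ m) := by positivity
    have h := this.trans_le hg
    rw [Nat.cast_pos] at h
    exact h.trans_le (le_of_eq (by congr!))
  obtain ⟨a₀, ha₀⟩ := hne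
  have hc : IsCode t (linCode g) := (mem_filter.1 ha₀).2.1
  refine ⟨g, hc, {a ∈ P ×ˢ (univ : Finset (Fin m → ZMod q)) |
    Rigid t (linCode g) a.1 a.2 ∧ ∀ u, #(agr (pull (linCode g) a.1) a.2 u) ≤ t}, ?_, ?_⟩
  · have h1 : #({a ∈ P ×ˢ (univ : Finset (Fin m → ZMod q)) |
        ∃ u, t < #(agr (pull (linCode g) a.1) a.2 u)} : Finset _) ≤ #P * (2 ^ m * q ^ (m - 1)) := by
      rw [← smul_eq_mul, ← sum_const]
      rw [card_eq_sum_card_fiberwise (f := Prod.fst) (t := P) (by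
        intro a ha
        exact (mem_product.1 (mem_filter.1 ha).1).1)]
      refine sum_le_sum fun f _ => ?_
      have := card_exists_lt_agr_le (t := t) htm (by simp) (pull (linCode g) f)
      rw [ZMod.card] at this
      refine (card_le_card_of_injOn Prod.snd ?_ ?_).trans this
      · intro a ha
        simp only [mem_coe, mem_filter] at ha
        obtain ⟨⟨_, h⟩, rfl⟩ := ha
        exact mem_filter.2 ⟨mem_univ _, h⟩
      · intro a ha b hb hab
        simp only [mem_coe, mem_filter] at ha hb
        exact Prod.ext (ha.2.trans hb.2.symm) hab
    have h2 : 4 * (#P * (2 ^ m * q ^ (m - 1))) ≤ #P * q ^ m := by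
      calc _ = #P * (4 * 2 ^ m * q ^ (m - 1)) := by ring
        _ ≤ #P * (q * q ^ (m - 1)) := by gcongr; omega
        _ = _ := by rw [← pow_succ', show m - 1 + 1 = m by omega]
    have h3 : #({a ∈ P ×ˢ (univ : Finset (Fin m → ZMod q)) |
        IsCode t (linCode g) ∧ Rigid t (linCode g) a.1 a.2} : Finset _) ≤
        #({a ∈ P ×ˢ (univ : Finset (Fin m → ZMod q)) | Rigid t (linCode g) a.1 a.2 ∧
          ∀ u, #(agr (pull (linCode g) a.1) a.2 u) ≤ t} : Finset _) +
        #({a ∈ P ×ˢ (univ : Finset (Fin m → ZMod q)) |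
          ∃ u, t < #(agr (pull (linCode g) a.1) a.2 u)} : Finset _) := by
      refine (card_le_card fun a ha => ?_).trans (card_union_le _ _)
      obtain ⟨ha, -, hr⟩ := mem_filter.1 ha
      by_cases h : ∃ u, t < #(agr (pull (linCode g) a.1) a.2 u)
      · exact mem_union_right _ (mem_filter.2 ⟨ha, h⟩)
      · push Not at h
        exact mem_union_left _ (mem_filter.2 ⟨ha, hr, h⟩)
    have h4 : (4 * (#P * (2 ^ m * q ^ (m - 1))) : ℝ) ≤ #P * q ^ m := by exact_mod_cast h2
    have h5 : (#({a ∈ P ×ˢ (univ : Finset (Fin m → ZMod q)) |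
        IsCode t (linCode g) ∧ Rigid t (linCode g) a.1 a.2} : Finset _) : ℝ) ≤
        #({a ∈ P ×ˢ (univ : Finset (Fin m → ZMod q)) | Rigid t (linCode g) a.1 a.2 ∧
          ∀ u, #(agr (pull (linCode g) a.1) a.2 u) ≤ t} : Finset _) +
        #P * (2 ^ m * q ^ (m - 1)) := by exact_mod_cast h3.trans (Nat.add_le_add_left h1 _)
    have h6 : (3 / 4 * (#P * (q : ℝ) ^ m)) ≤ #({a ∈ P ×ˢ (univ : Finset (Fin m → ZMod q)) |
        IsCode t (linCode g) ∧ Rigid t (linCode g) a.1 a.2} : Finset _) :=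
      hg.trans (le_of_eq (by congr!))
    linarith
  · intro a ha
    obtain ⟨ha, h1, h2⟩ := mem_filter.1 ha
    exact ⟨(mem_product.1 ha).1, h2, h1⟩

theorem exists_hasCode (t : ℕ) (V : Type) [Fintype V] [DecidableEq V] :
    ∃ B, ∀ p, p.Prime → B ≤ p → HasCode t V p := by
  classical
  refine ⟨2 * t * 8 ^ Fintype.card V + 1, fun p hp hB => ?_⟩
  have : Fact p.Prime := ⟨hp⟩
  have h := card_not_isCode_mul_le (q := p) (t := t) (V := V)
  have : ∃ g : V → Fin t → ZMod p, IsCode t (linCode g) := by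
    by_contra! hcon
    rw [filter_true_of_mem fun g _ => hcon g, card_univ, mul_comm] at h
    have := Nat.le_of_mul_le_mul_right h Fintype.card_pos
    omega
  obtain ⟨g, hg⟩ := this
  exact ⟨Fin t → ZMod p, ZMod p, inferInstance, inferInstance, inferInstance, by simp, by simp,
    linCode g, hg⟩

end Generic

theorem tendsto_choose_div_pow (t : ℕ) :
    Tendsto (fun n : ℕ => (n.choose t : ℝ) / (n : ℝ) ^ t) atTop (nhds (1 / t.factorial)) := by
  have h1 : ∀ᶠ n : ℕ in atTop, (n : ℝ) ^ t / t.factorial ≠ 0 := by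
    filter_upwards [eventually_gt_atTop 0] with n hn
    positivity
  have h2 := ((Asymptotics.isEquivalent_iff_tendsto_one h1).1 (isEquivalent_choose t)).div_const
    (t.factorial : ℝ)
  refine h2.congr fun n => ?_
  simp only [Pi.div_apply]
  field_simp

section Dense

variable {m t : ℕ} {E : Finset (Finset (Fin m))}

/-- The `t`-sets contained in a member of `E`. -/
def edgeSets (t : ℕ) (E : Finset (Finset (Fin m))) : Finset (Finset (Fin m)) :=
  {T | #T = t ∧ ∃ e ∈ E, T ⊆ e}

theorem choose_le_card_add {V : Type*} [Fintype V] [DecidableEq V] (P : Finset (Fin m ↪ V))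
    (Z : Finset (Finset V)) : open Classical in
    (Fintype.card V).choose t ≤ #Z + #(edgeSets t E) * #P +
      #{Q : Finset V | #Q = t ∧ Q ∉ Z ∧ ¬ Cov E P Q} := by
  classical
  have h : powersetCard t (univ : Finset V) ⊆ (Z ∪ (edgeSets t E ×ˢ P).image fun q => q.1.map q.2) ∪
      ({Q : Finset V | #Q = t ∧ Q ∉ Z ∧ ¬ Cov E P Q} : Finset (Finset V)) := by
    intro Q hQ
    have hQ := (mem_powersetCard.1 hQ).2
    by_cases hZ : Q ∈ Z
    · exact mem_union_left _ (mem_union_left _ hZ)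
    · by_cases hc : Cov E P Q
      · obtain ⟨g, hg, e, he, hs⟩ := hc
        obtain ⟨T, hT, rfl⟩ := subset_map_iff.1 hs
        refine mem_union_left _ (mem_union_right _ (mem_image.2 ⟨(T, g), mem_product.2 ⟨?_, hg⟩,
            rfl⟩))
        exact mem_filter.2 ⟨mem_univ _, by simpa using hQ, e, he, hT⟩
      · exact mem_union_right _ (mem_filter.2 ⟨mem_univ _, hQ, hZ, hc⟩)
  have h1 := card_le_card h
  rw [card_powersetCard, card_univ] at h1
  refine h1.trans ((card_union_le _ _).trans (Nat.add_le_add_right ((card_union_le _ _).trans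
    (Nat.add_le_add_left (card_image_le.trans (card_product _ _).le) _)) _))

theorem IsPacking.card_le_pow {V : Type*} [Fintype V] [DecidableEq V] {P : Finset (Fin m ↪ V)}
    {Z : Finset (Finset V)} (hP : IsPacking t E P Z) (hE : ∀ e ∈ E, t ≤ #e) (hE0 : E.Nonempty) :
    #P ≤ Fintype.card V ^ t := by
  classical
  obtain ⟨e, he⟩ := hE0
  obtain ⟨T, hT, hTc⟩ := exists_subset_card_eq (hE e he)
  have h1 : #P ≤ #(powersetCard t (univ : Finset V)) := by
    refine card_le_card_of_injOn (fun f => T.map f) ?_ ?_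
    · intro f _
      exact mem_powersetCard.2 ⟨subset_univ _, by rw [card_map, hTc]⟩
    · intro f hf g hg h
      by_contra hne
      have h2 := hP.inter_lt f hf g hg hne e he e he
      have h3 : T.map f ⊆ e.map f ∩ e.map g :=
        subset_inter (map_subset_map.2 hT) (by
          rw [show T.map f = T.map g from h]
          exact map_subset_map.2 hT)
      have h4 := card_le_card h3
      rw [card_map] at h4
      omega
  rw [card_powersetCard, card_univ] at h1
  exact h1.trans (Nat.choose_le_pow _ _)

/-- There is a packing with density `p` whose family of forbidden `t`-sets has density `z`. -/
def HasPacking (t : ℕ) (E : Finset (Finset (Fin m))) (z p : ℝ) (N : ℕ) : Prop :=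
  ∃ (V : Type) (_ : Fintype V) (_ : DecidableEq V) (P : Finset (Fin m ↪ V)) (Z : Finset (Finset V)),
    N ≤ Fintype.card V ∧ IsPacking t E P Z ∧ (#Z : ℝ) = z * (Fintype.card V : ℝ) ^ t ∧
      (#P : ℝ) = p * (Fintype.card V : ℝ) ^ t

theorem HasPacking.large (htm : t ≤ m) {z p : ℝ} (h : HasPacking t E z p 1) (N : ℕ) :
    HasPacking t E z p N := by
  classical
  obtain ⟨V, _, _, P, Z, hV, hP, hz, hp⟩ := h
  obtain ⟨B, hB⟩ := exists_hasCode t V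
  obtain ⟨q, hq, hqp⟩ := Nat.exists_infinite_primes (B + N)
  obtain ⟨U, X, _, _, _, hX, hU, c, hc⟩ := hB q hqp (by omega)
  refine ⟨V × X, inferInstance, inferInstance, blowP c (fun _ => 1) P, blowZ c (fun _ => 1) Z, ?_,
    hP.blow hc, ?_, ?_⟩
  · rw [Fintype.card_prod, hX]
    nlinarith
  · rw [card_blowZ hc hP.card_eq, Fintype.card_prod, hX, hU]
    push_cast
    rw [hz]
    ring
  · rw [card_blowP hc htm, Fintype.card_prod, hX, hU]
    push_cast
    rw [hp]
    ring

theorem exists_improvement (htm : t < m) (hE : ∀ e ∈ E, t ≤ #e) (hE0 : E.Nonempty) {z l : ℝ}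
    (hz : 0 < z)
    (hl : 0 < l) : ∃ c > (0 : ℝ), ∀ p > 0, HasPacking t E z p 1 →
      z + #(edgeSets t E) * p + 2 * l ≤ 1 / t.factorial →
      ∃ p' ≥ (1 + c) * p, HasPacking t E z p' 1 := by
  classical
  set κ : ℝ := min (min l z) 1 with hκ
  have hκ0 : 0 < κ := by positivity
  have hκ1 : κ ≤ 1 := min_le_right _ _
  have hκl : κ ≤ l := (min_le_left _ _).trans (min_le_left _ _)
  have hκz : κ ≤ z := (min_le_left _ _).trans (min_le_right _ _)
  set k := 4 * badConst m t with hk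
  set w := 2 ^ m + 8 ^ m with hw
  set γ : ℝ := (κ / (2 * (k + 1))) ^ w with hγ
  have hγ0 : 0 < γ := by positivity
  set D : ℝ := 1 + 2 ^ m + 16 ^ m + 4 * mixConst m t / γ with hD
  have hD0 : 0 < D := by positivity
  refine ⟨γ / 4 / D, by positivity, fun p hp hd hle => ?_⟩
  obtain ⟨N₁, hN₁⟩ := eventually_atTop.1 ((tendsto_choose_div_pow t).eventually
    (lt_mem_nhds (show 1 / (t.factorial : ℝ) - l < 1 / t.factorial by linarith)))
  obtain ⟨N₂, hN₂⟩ := exists_nat_ge (2 * (2 ^ m * permConst m t) / κ)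
  obtain ⟨V, _, _, P, Z, hV, hP, hZc, hPc⟩ := hd.large htm.le (N₁ + N₂ + t + 1)
  set n := Fintype.card V with hn
  have hn0 : (0 : ℝ) < (n : ℝ) ^ t := by
    have : (0 : ℝ) < n := by exact_mod_cast (by omega : 0 < n)
    positivity
  have hL : κ * (n : ℝ) ^ t ≤ #{Q : Finset V | #Q = t ∧ Q ∉ Z ∧ ¬ Cov E P Q} := by
    have h1 := choose_le_card_add (t := t) (E := E) P Z
    have h2 := hN₁ n (by omega)
    rw [lt_div_iff₀ hn0] at h2
    have h1' : (n.choose t : ℝ) ≤ #Z + #(edgeSets t E) * #P +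
      #{Q : Finset V | #Q = t ∧ Q ∉ Z ∧ ¬ Cov E P Q} := by exact_mod_cast (by convert h1)
    rw [hZc, hPc] at h1'
    have h3 := mul_le_mul_of_nonneg_right hle hn0.le
    have h4 := mul_le_mul_of_nonneg_right hκl hn0.le
    linarith
  have hPn : P.Nonempty := by
    rw [← card_pos]
    have : (0 : ℝ) < #P := by rw [hPc]; positivity
    exact_mod_cast this
  obtain ⟨B, hB⟩ := exists_generic_code htm P hPn
  obtain ⟨q, hq, hqp⟩ := Nat.exists_infinite_primes B
  have : Fact q.Prime := ⟨hqp⟩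
  obtain ⟨g, hg, 𝒢, h𝒢, h𝒢'⟩ := hB q hq
  have hq0 : (0 : ℝ) < q := by exact_mod_cast hqp.pos
  obtain ⟨P', Z', hP', hZ', hcard⟩ := hP.exists_extend hE hE0 (by omega) htm.le hκ0 hκ1
    (by rw [hZc]; exact mul_le_mul_of_nonneg_right hκz hn0.le) (by convert hL)
    (hN₂.trans (by exact_mod_cast (by omega : N₂ ≤ n))) (by omega) (k := k) (by omega) hg
    (fun A₁ A₂ A₃ h₁ h₂ h₁₃ h₂₃ hs y u u' w w' hu hw u1 w1 u2 w2 u3 w3 =>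
      linCode_unique hg h₁ h₂ h₁₃ h₂₃ hs y hu hw u1 w1 u2 w2 u3 w3) (by simp) (w := w) 𝒢 h𝒢'
    (fun a _ => by convert card_inW_le hg a.1 a.2)
  rw [← hγ, ← hD, ZMod.card] at hcard
  rw [ZMod.card] at hZ'
  have hcV : Fintype.card (V × ZMod q) = n * q := by rw [Fintype.card_prod, ZMod.card]
  refine ⟨#P' / ((n : ℝ) * q) ^ t, ?_, V × ZMod q, inferInstance, inferInstance, P', Z', ?_, hP',
      ?_, ?_⟩
  · rw [ge_iff_le, le_div_iff₀ (by rw [mul_pow]; positivity)]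
    refine le_trans ?_ hcard
    have h5 : γ / 2 * (#P * (q : ℝ) ^ m / 2) / (D * (q : ℝ) ^ (m - t)) ≤
        γ / 2 * #𝒢 / (D * (q : ℝ) ^ (m - t)) := by gcongr
    refine le_trans (le_of_eq ?_) (add_le_add le_rfl h5)
    rw [hPc, show (q : ℝ) ^ m = (q : ℝ) ^ t * (q : ℝ) ^ (m - t) by rw [← pow_add]; congr 1; omega]
    field_simp
    ring
  · rw [hcV]
    exact Nat.mul_pos (by omega) hqp.pos
  · rw [hZ', hcV]
    push_cast
    rw [hZc]
    ring
  · rw [hcV]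
    push_cast
    rw [div_mul_cancel₀]
    rw [mul_pow]
    positivity

theorem exists_dense (htm : t < m) (hE : ∀ e ∈ E, t ≤ #e) (hE0 : E.Nonempty) {z p l : ℝ}
    (hz : 0 < z)
    (hp : 0 < p) (hl : 0 < l) (h : HasPacking t E z p 1) :
    ∃ p' > 0, HasPacking t E z p' 1 ∧ 1 / t.factorial < z + #(edgeSets t E) * p' + 2 * l := by
  by_contra! hcon
  obtain ⟨c, hc, himp⟩ := exists_improvement htm hE hE0 hz hl
  have h1 : ∀ j : ℕ, ∃ p' ≥ (1 + c) ^ j * p, HasPacking t E z p' 1 := by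
    intro j
    induction j with
    | zero => exact ⟨p, by simp, h⟩
    | succ j ih =>
      obtain ⟨p', hp', hd⟩ := ih
      have hp0 : 0 < p' := lt_of_lt_of_le (by positivity) hp'
      obtain ⟨p'', hp'', hd'⟩ := himp p' hp0 hd (hcon p' hp0 hd)
      refine ⟨p'', le_trans ?_ hp'', hd'⟩
      rw [pow_succ', mul_assoc]
      exact mul_le_mul_of_nonneg_left hp' (by positivity)
  obtain ⟨j, hj⟩ := pow_unbounded_of_one_lt (1 / p) (by linarith : 1 < 1 + c)
  obtain ⟨p', hp', V, _, _, P, Z, hV, hP, -, hPc⟩ := h1 j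
  have h2 : 1 < p' := lt_of_lt_of_le (by rwa [div_lt_iff₀ hp] at hj) hp'
  have h3 : (#P : ℝ) ≤ (Fintype.card V : ℝ) ^ t := by exact_mod_cast hP.card_le_pow hE hE0
  have h4 : (0 : ℝ) < (Fintype.card V : ℝ) ^ t := by
    have : (0 : ℝ) < Fintype.card V := by exact_mod_cast hV
    positivity
  rw [hPc] at h3
  nlinarith

end Dense

section ExNum

variable {r t n : ℕ}

theorem isFree_iff_not_clash {V : Type*} [DecidableEq V] {G : Finset (Finset V)}
    (htr : t ≤ r) (hG : ∀ e ∈ G, #e = r) :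
    IsFree G (3 * r - 2 * t) 3 ↔
      ∀ a ∈ G, ∀ b ∈ G, ∀ c ∈ G, a ≠ b → a ≠ c → b ≠ c → ¬ Clash t a b c := by
  have key : ∀ a ∈ G, ∀ b ∈ G, ∀ c ∈ G,
      (#(({a, b, c} : Finset (Finset V)).sup id) ≤ 3 * r - 2 * t ↔ Clash t a b c) := by
    intro a ha b hb c hc
    rw [clash_iff, hG a ha, hG b hb, hG c hc, sup_insert, sup_insert, sup_singleton]
    simp only [id, sup_eq_union, union_assoc]
    omega
  constructor
  · intro h a ha b hb c hc hab hac hbc hcl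
    refine h ⟨{a, b, c}, ?_, card_eq_three.2 ⟨a, b, c, hab, hac, hbc, rfl⟩,
      (key a ha b hb c hc).2 hcl⟩
    simp [insert_subset_iff, ha, hb, hc]
  · rintro h ⟨S, hS, hS3, hs⟩
    obtain ⟨a, b, c, hab, hac, hbc, rfl⟩ := card_eq_three.1 hS3
    simp only [insert_subset_iff, singleton_subset_iff] at hS
    exact h a hS.1 b hS.2.1 c hS.2.2 hab hac hbc ((key a hS.1 b hS.2.1 c hS.2.2).1 hs)

theorem exists_card_eq_exNum (r n s : ℕ) : ∃ G : Finset (Finset (Fin n)),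
    (∀ e ∈ G, #e = r) ∧ IsFree G s 3 ∧ #G = exNum r n s 3 := by
  refine Nat.sSup_mem (s := {m : ℕ | ∃ G : Finset (Finset (Fin n)), (∀ e ∈ G, e.card = r) ∧
    IsFree G s 3 ∧ G.card = m}) ⟨0, ∅, by simp, ?_, rfl⟩
    ⟨Fintype.card (Finset (Fin n)), ?_⟩
  · rintro ⟨S, hS, hc, -⟩
    rw [subset_empty.1 hS] at hc
    simp at hc
  · rintro _ ⟨G, -, -, rfl⟩
    exact card_le_univ G

theorem card_le_exNum {V : Type*} [Fintype V] [DecidableEq V] {G : Finset (Finset V)}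
    (htr : t ≤ r) (hG : ∀ e ∈ G, #e = r)
    (hc : ∀ a ∈ G, ∀ b ∈ G, ∀ c ∈ G, a ≠ b → a ≠ c → b ≠ c → ¬ Clash t a b c)
    (hn : Fintype.card V ≤ n) : #G ≤ exNum r n (3 * r - 2 * t) 3 := by
  obtain ⟨φ⟩ := Function.Embedding.nonempty_of_card_le (β := Fin n) (by simpa using hn)
  have hG' : ∀ e ∈ G.map (mapEmbedding φ).toEmbedding, #e = r := by
    intro e he
    obtain ⟨e', he', rfl⟩ := Finset.mem_map.1 he
    simpa using hG e' he'
  refine le_csSup ⟨Fintype.card (Finset (Fin n)), ?_⟩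
    ⟨G.map (mapEmbedding φ).toEmbedding, hG', (isFree_iff_not_clash htr hG').2 ?_, card_map _⟩
  · rintro _ ⟨G, -, -, rfl⟩
    exact card_le_univ G
  · intro a ha b hb c hc' hab hac hbc
    obtain ⟨a', ha', rfl⟩ := Finset.mem_map.1 ha
    obtain ⟨b', hb', rfl⟩ := Finset.mem_map.1 hb
    obtain ⟨c', hc'', rfl⟩ := Finset.mem_map.1 hc'
    simp only [RelEmbedding.coe_toEmbedding, mapEmbedding_apply] at *
    rw [clash_map]
    exact hc a' ha' b' hb' c' hc'' (fun h => hab (by rw [h])) (fun h => hac (by rw [h]))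
      (fun h => hbc (by rw [h]))

end ExNum

section LowerBound

variable {r t m : ℕ} {A B : Finset (Fin m)}

theorem IsPacking.two_mul_card_le_exNum {V : Type*} [Fintype V] [DecidableEq V]
    {P : Finset (Fin m ↪ V)} {Z : Finset (Finset V)} (hP : IsPacking t {A, B} P Z)
    (hA : #A = r) (hB : #B = r) (hAB : #(A ∩ B) = t) (htr : t < r) {n : ℕ}
    (hn : Fintype.card V ≤ n) : 2 * #P ≤ exNum r n (3 * r - 2 * t) 3 := by
  have hne : A ≠ B := by
    rintro rfl
    rw [inter_self] at hAB
    omega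
  have hE : ∀ e ∈ ({A, B} : Finset (Finset (Fin m))), #e = r := by
    simp [hA, hB]
  have hpair : ∀ e ∈ ({A, B} : Finset (Finset (Fin m))), ∀ e' ∈ ({A, B} : Finset (Finset (Fin m))),
      e ≠ e' → #(e ∩ e') = t := by
    simp only [mem_insert, mem_singleton]
    rintro e (rfl | rfl) e' (rfl | rfl) h
    · exact absurd rfl h
    · exact hAB
    · rw [inter_comm]; exact hAB
    · exact absurd rfl h
  set G : Finset (Finset V) := (P ×ˢ {A, B}).image fun p => p.2.map p.1 with hGdef
  have hcard : #G = 2 * #P := by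
    rw [hGdef, card_image_of_injOn, card_product, card_pair hne, mul_comm]
    rintro ⟨f, e⟩ hf ⟨g, e'⟩ hg h
    simp only [coe_product, Set.mem_prod, mem_coe] at hf hg h
    by_cases hfg : f = g
    · subst hfg
      rw [Finset.map_inj.1 h]
    · have h1 := hP.inter_lt f hf.1 g hg.1 hfg e hf.2 e' hg.2
      rw [h, inter_self, card_map, hE e' hg.2] at h1
      omega
  have hsame : ∀ f ∈ P, ∀ h ∈ P, f ≠ h → ∀ e₁ ∈ ({A, B} : Finset (Finset (Fin m))),
      ∀ e₂ ∈ ({A, B} : Finset (Finset (Fin m))), ∀ e₃ ∈ ({A, B} : Finset (Finset (Fin m))),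
      e₁.map f ≠ e₂.map f → ¬ Clash t (e₁.map f) (e₂.map f) (e₃.map h) := by
    intro f hf h hh hfh e₁ h₁ e₂ h₂ e₃ h₃ hne
    refine not_clash_of_card ?_ (lt_of_le_of_lt (card_le_card ?_) (hP.inter_range_lt hf hh hfh h₃))
    · rw [← map_inter, card_map, hpair e₁ h₁ e₂ h₂ fun h => hne (by rw [h])]
    · rw [← map_union]
      exact inter_subset_inter subset_rfl (map_subset_map.2 (subset_univ _))
  rw [← hcard]
  refine card_le_exNum htr.le ?_ ?_ hn
  · intro e he
    obtain ⟨⟨f, e⟩, hf, rfl⟩ := mem_image.1 he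
    rw [card_map]
    exact hE _ (mem_product.1 hf).2
  · intro a ha b hb c hc hab hac hbc
    obtain ⟨⟨f, e₁⟩, hf, rfl⟩ := mem_image.1 ha
    obtain ⟨⟨g, e₂⟩, hg, rfl⟩ := mem_image.1 hb
    obtain ⟨⟨h, e₃⟩, hh, rfl⟩ := mem_image.1 hc
    obtain ⟨hf, h₁⟩ := mem_product.1 hf
    obtain ⟨hg, h₂⟩ := mem_product.1 hg
    obtain ⟨hh, h₃⟩ := mem_product.1 hh
    dsimp only at *
    by_cases hfg : f = g
    · subst hfg
      by_cases hfh : f = h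
      · subst hfh
        exfalso
        simp only [mem_insert, mem_singleton] at h₁ h₂ h₃
        rcases h₁ with rfl | rfl <;> rcases h₂ with rfl | rfl <;> rcases h₃ with rfl | rfl <;>
          simp_all
      · exact hsame f hf h hh hfh e₁ h₁ e₂ h₂ e₃ h₃ hab
    · by_cases hfh : f = h
      · subst hfh
        intro hcl
        exact hsame f hf g hg hfg e₃ h₃ e₁ h₁ e₂ h₂ hac.symm hcl.rotate.rotate
      · by_cases hgh : g = h
        · subst hgh
          intro hcl
          exact hsame g hg f hf (Ne.symm hfg) e₂ h₂ e₃ h₃ e₁ h₁ hbc hcl.rotate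
        · exact hP.not_clash f hf g hg h hh hfg hfh hgh e₁ h₁ e₂ h₂ e₃ h₃

theorem HasPacking.exists_le_exNum {z p : ℝ} (h : HasPacking t {A, B} z p 1)
    (htm : t ≤ m) (hA : #A = r) (hB : #B = r) (hAB : #(A ∩ B) = t) (htr : t < r) (hp : 0 ≤ p) :
    ∃ K : ℕ, ∀ n ≥ K, 2 * p * (((n - K : ℕ) : ℕ) : ℝ) ^ t ≤ exNum r n (3 * r - 2 * t) 3 := by
  obtain ⟨V, _, _, P, Z, hV, hP, -, hPc⟩ := h
  obtain ⟨N, hN⟩ := exists_hasCode t V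
  set v := Fintype.card V with hv
  have hK : 0 < v * N.factorial := Nat.mul_pos hV N.factorial_pos
  refine ⟨v + v * N.factorial, fun n hn => ?_⟩
  set j := (n - v) / (v * N.factorial) with hj
  have hj1 : v * N.factorial * j ≤ n - v := Nat.mul_div_le _ _
  have hj2 : n - v < v * N.factorial * (j + 1) := Nat.lt_mul_div_succ _ hK
  obtain ⟨U, X, _, _, _, hX, hU, c, hc⟩ := hasCode_of_prime_factors hN (N.factorial * j + 1)
    (Nat.succ_ne_zero _) (by
      intro q hq hqd
      by_contra! hlt
      have h1 : q ∣ N.factorial * j := ((Nat.Prime.dvd_factorial hq).2 hlt.le).mul_right j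
      exact hq.one_lt.ne' (Nat.dvd_one.1 ((Nat.dvd_add_right h1).1 hqd)))
  have hcV : Fintype.card (V × X) = v * N.factorial * j + v := by
    rw [Fintype.card_prod, hX, ← hv]
    ring
  have h1 := (hP.blow (σ := fun _ => 1) hc).two_mul_card_le_exNum hA hB hAB htr (n := n)
    (by rw [hcV]; omega)
  rw [card_blowP hc htm] at h1
  refine le_trans ?_ (Nat.cast_le.2 h1)
  push_cast
  rw [hPc, hU]
  have h2 : (((n - (v + v * N.factorial) : ℕ) : ℕ) : ℝ) ^ t ≤
      ((v * (N.factorial * j + 1) : ℕ) : ℝ) ^ t := by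
    gcongr
    rw [mul_add] at hj2 ⊢
    rw [← mul_assoc]
    omega
  refine (mul_le_mul_of_nonneg_left h2 (by positivity)).trans (le_of_eq ?_)
  push_cast
  rw [mul_pow]
  ring

end LowerBound

section Template

theorem exists_template {r t : ℕ} (ht : 2 ≤ t) (htr : t < r) :
    ∃ A B : Finset (Fin (2 * r - t)), #A = r ∧ #B = r ∧ #(A ∩ B) = t ∧
      #(edgeSets t {A, B}) + 1 = 2 * r.choose t ∧
      ∃ T : Finset (Fin (2 * r - t)), #T = t ∧ ∀ e ∈ ({A, B} : Finset (Finset (Fin (2 * r - t)))),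
          ¬ T ⊆ e := by
  obtain ⟨A, -, hA⟩ := exists_subset_card_eq (s := (univ : Finset (Fin (2 * r - t)))) (n := r)
    (by rw [card_univ, Fintype.card_fin]; omega)
  obtain ⟨C, hCA, hC⟩ := exists_subset_card_eq (s := A) (n := t) (by omega)
  have hAc : #Aᶜ = r - t := by
    rw [card_compl, Fintype.card_fin, hA]
    omega
  have hdis : Disjoint C Aᶜ := disjoint_compl_right.mono_left hCA
  have hAB : A ∩ (C ∪ Aᶜ) = C := by
    rw [inter_union_distrib_left, inter_compl, union_empty, inter_eq_right.2 hCA]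
  have hB : #(C ∪ Aᶜ) = r := by
    rw [card_union_of_disjoint hdis, hC, hAc]
    omega
  refine ⟨A, C ∪ Aᶜ, hA, hB, by rw [hAB, hC], ?_, ?_⟩
  · have h1 : edgeSets t {A, C ∪ Aᶜ} = powersetCard t A ∪ powersetCard t (C ∪ Aᶜ) := by
      ext T
      simp only [edgeSets, mem_filter, mem_univ, true_and, mem_insert, mem_singleton, mem_union,
        mem_powersetCard, exists_eq_or_imp, exists_eq_left]
      tauto
    have h2 : powersetCard t A ∩ powersetCard t (C ∪ Aᶜ) = powersetCard t C := by
      ext T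
      have h : T ⊆ C ↔ T ⊆ A ∧ T ⊆ C ∪ Aᶜ := by rw [← subset_inter_iff, hAB]
      simp only [Finset.mem_inter, mem_powersetCard, h]
      tauto
    have h3 := card_union_add_card_inter (powersetCard t A) (powersetCard t (C ∪ Aᶜ))
    rw [h2, card_powersetCard, card_powersetCard, card_powersetCard, hA, hB, hC,
      Nat.choose_self] at h3
    rw [h1]
    omega
  · obtain ⟨x, hxA, hxC⟩ := exists_mem_notMem_of_card_lt_card (show #C < #A by omega)
    obtain ⟨y, hy⟩ := card_pos.1 (show 0 < #Aᶜ by omega)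
    obtain ⟨T, hT, -, hTc⟩ := exists_subsuperset_card_eq (subset_univ ({x, y} : Finset _)) (n := t)
      (card_le_two.trans ht) (by rw [card_univ, Fintype.card_fin]; omega)
    have hx : x ∈ T := hT (by simp)
    have hy' : y ∈ T := hT (by simp)
    refine ⟨T, hTc, ?_⟩
    simp only [mem_insert, mem_singleton, forall_eq_or_imp, forall_eq]
    refine ⟨fun h => mem_compl.1 hy (h hy'), fun h => ?_⟩
    rcases mem_union.1 (h hx) with h' | h'
    · exact hxC h'
    · exact mem_compl.1 h' hxA

theorem exists_hasPacking_init {m t : ℕ} {E : Finset (Finset (Fin m))} (ht : 1 ≤ t)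
    (hT : ∃ T : Finset (Fin m), #T = t ∧ ∀ e ∈ E, ¬ T ⊆ e) {ε : ℝ} (hε : 0 < ε) :
    ∃ z p : ℝ, 0 < z ∧ z ≤ ε ∧ 0 < p ∧ HasPacking t E z p 1 := by
  classical
  set W : Finset (Finset (Fin m)) := {T | #T = t ∧ ∀ e ∈ E, ¬ T ⊆ e} with hW
  have hW0 : 0 < #W := by
    obtain ⟨T, h1, h2⟩ := hT
    exact card_pos.2 ⟨T, mem_filter.2 ⟨mem_univ _, h1, h2⟩⟩
  obtain ⟨n, hn⟩ := exists_nat_ge ((#W : ℝ) / ε)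
  set N := n + m + 1 with hN
  set f : Fin m ↪ Fin N := Fin.castLEEmb (by omega) with hf
  have hN0 : (0 : ℝ) < (N : ℝ) ^ t := by
    have : (0 : ℝ) < N := by exact_mod_cast (by omega : 0 < N)
    positivity
  refine ⟨#W / (N : ℝ) ^ t, 1 / (N : ℝ) ^ t, by positivity, ?_, by positivity,
    Fin N, inferInstance, inferInstance, {f}, W.image fun T => T.map f, ?_, ?_, ?_, ?_⟩
  · rw [div_le_iff₀ hN0]
    rw [div_le_iff₀ hε] at hn
    have h1 : (n : ℝ) ≤ (N : ℝ) ^ t := by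
      have : n ≤ N ^ t := le_trans (by omega) (Nat.le_self_pow (by omega) N)
      exact_mod_cast this
    calc (#W : ℝ) ≤ n * ε := hn
      _ ≤ ε * (N : ℝ) ^ t := by rw [mul_comm]; gcongr
  · rw [Fintype.card_fin]
    omega
  · refine ⟨?_, ?_, ?_, ?_, ?_⟩
    · intro Q hQ
      obtain ⟨T, hT, rfl⟩ := mem_image.1 hQ
      rw [card_map]
      exact (mem_filter.1 hT).2.1
    · intro g hg e he T hTe _ hmem
      rw [mem_singleton.1 hg] at hmem
      obtain ⟨T', hT', h⟩ := mem_image.1 hmem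
      rw [Finset.map_inj] at h
      subst h
      exact (mem_filter.1 hT').2.2 e he hTe
    · intro g hg T hTc hTe
      rw [mem_singleton.1 hg]
      exact mem_image_of_mem _ (mem_filter.2 ⟨mem_univ _, hTc, hTe⟩)
    · intro g hg h hh hgh
      exact absurd ((mem_singleton.1 hg).trans (mem_singleton.1 hh).symm) hgh
    · intro g hg h hh _ _ hgh
      exact absurd ((mem_singleton.1 hg).trans (mem_singleton.1 hh).symm) hgh
  · rw [card_image_of_injective _ (map_injective f), Fintype.card_fin, div_mul_cancel₀ _ hN0.ne']
  · rw [card_singleton, Fintype.card_fin, div_mul_cancel₀ _ hN0.ne', Nat.cast_one]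

end Template

theorem tendsto_sub_pow_div_pow (K t : ℕ) :
    Tendsto (fun n : ℕ => (((n - K : ℕ) : ℕ) : ℝ) ^ t / (n : ℝ) ^ t) atTop (nhds 1) := by
  have h1 : Tendsto (fun n : ℕ => 1 - (K : ℝ) / (n : ℝ)) atTop (nhds (1 - 0)) :=
    tendsto_const_nhds.sub (tendsto_const_div_atTop_nhds_zero_nat _)
  have h2 := h1.pow t
  rw [sub_zero, one_pow] at h2
  refine h2.congr' ?_
  filter_upwards [eventually_ge_atTop (K + 1)] with n hn
  have hn0 : (n : ℝ) ≠ 0 := by exact_mod_cast (by omega : n ≠ 0)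
  rw [← div_pow, Nat.cast_sub (by omega), sub_div, div_self hn0]

theorem eventually_lt_exNum_div {r t : ℕ} (ht : 2 ≤ t) (htr : t < r) {a : ℝ}
    (ha : a < 2 / ((t.factorial : ℝ) * (2 * (r.choose t : ℝ) - 1))) :
    ∀ᶠ n : ℕ in atTop, a < (exNum r n (3 * r - 2 * t) 3 : ℝ) / (n : ℝ) ^ t := by
  obtain ⟨A, B, hA, hB, hAB, hcard, hT⟩ := exists_template ht htr
  have hr : 1 ≤ r.choose t := Nat.choose_pos htr.le
  have hc : (#(edgeSets t {A, B}) : ℝ) = 2 * (r.choose t : ℝ) - 1 := by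
    have : (#(edgeSets t {A, B}) : ℝ) + 1 = 2 * (r.choose t : ℝ) := by exact_mod_cast hcard
    linarith
  rw [← hc] at ha
  set e : ℝ := (#(edgeSets t {A, B}) : ℝ) with he
  have he0 : 0 < e := by
    rw [hc]
    have : (1 : ℝ) ≤ r.choose t := by exact_mod_cast hr
    linarith
  have hf : (0 : ℝ) < t.factorial := by exact_mod_cast t.factorial_pos
  have ha' : a * e / 2 < 1 / t.factorial := by
    rw [lt_div_iff₀ (by positivity)] at ha ⊢
    nlinarith
  set δ : ℝ := (1 / t.factorial - a * e / 2) / 3 with hδ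
  have hδ0 : 0 < δ := by
    rw [hδ]
    linarith
  obtain ⟨z, p, hz, hzδ, hp, hpack⟩ := exists_hasPacking_init (by omega) hT hδ0
  obtain ⟨p', hp', hpack', hlt⟩ := exists_dense (by omega) (by simp; omega) (by simp) hz hp hδ0
      hpack
  rw [← he] at hlt
  have hap : a < 2 * p' := by
    have : a * e < 2 * p' * e := by linarith
    exact lt_of_mul_lt_mul_right this he0.le
  obtain ⟨K, hK⟩ := hpack'.exists_le_exNum (by omega) hA hB hAB htr hp'.le
  have h1 := (tendsto_sub_pow_div_pow K t).const_mul (2 * p')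
  rw [mul_one] at h1
  filter_upwards [h1.eventually (lt_mem_nhds hap), eventually_ge_atTop (K + 1)] with n hn hnK
  refine hn.trans_le ?_
  rw [← mul_div_assoc]
  gcongr
  exact hK n (by omega)

section UpperBound

variable {r t : ℕ} {V : Type*} [Fintype V] [DecidableEq V] {G : Finset (Finset V)}

theorem card_mul_le_of_inter_le (hG : ∀ e ∈ G, #e = r)
    (hc : ∀ a ∈ G, ∀ b ∈ G, ∀ c ∈ G, a ≠ b → a ≠ c → b ≠ c → ¬ Clash t a b c)
    (hi : ∀ a ∈ G, ∀ b ∈ G, a ≠ b → #(a ∩ b) ≤ t) :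
    #G * (2 * r.choose t - 1) ≤ 2 * (Fintype.card V).choose t := by
  set d : Finset V → ℕ := fun Q => #{e ∈ G | Q ⊆ e} with hd
  have hclash : ∀ Q Q' : Finset V, #Q = t → #Q' = t → ∀ a b c : Finset V, Q ⊆ a → Q ⊆ b →
      Q' ⊆ c → Q' ⊆ a ∪ b → Clash t a b c := by
    intro Q Q' hQ hQ' a b c ha hb hc hab
    have h1 := card_le_card (subset_inter ha hb)
    have h2 := card_le_card (subset_inter hc hab)
    unfold Clash
    omega
  have hd2 : ∀ Q, #Q = t → d Q ≤ 2 := by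
    intro Q hQ
    by_contra! h
    obtain ⟨a, ha, b, hb, c, hc', hab, hac, hbc⟩ := two_lt_card.1 h
    rw [mem_filter] at ha hb hc'
    exact hc a ha.1 b hb.1 c hc'.1 hab hac hbc
      (hclash Q Q hQ hQ a b c ha.2 hb.2 hc'.2 (ha.2.trans subset_union_left))
  have hone : ∀ e ∈ G, ∀ Q ∈ powersetCard t e, ∀ Q' ∈ powersetCard t e, 2 ≤ d Q → 2 ≤ d Q' →
      Q = Q' := by
    intro e he Q hQ Q' hQ' h2 h2'
    obtain ⟨hQe, hQc⟩ := mem_powersetCard.1 hQ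
    obtain ⟨hQe', hQc'⟩ := mem_powersetCard.1 hQ'
    obtain ⟨a, ha, hae⟩ := exists_mem_ne (by omega : 1 < d Q) e
    obtain ⟨b, hb, hbe⟩ := exists_mem_ne (by omega : 1 < d Q') e
    rw [mem_filter] at ha hb
    have hab : a = b := by
      by_contra hab
      exact hc a ha.1 e he b hb.1 hae hab hbe.symm
        (hclash Q Q' hQc hQc' a e b ha.2 hQe hb.2 (hQe'.trans subset_union_right))
    subst hab
    have h3 := hi a ha.1 e he hae
    rw [eq_of_subset_of_card_le (subset_inter ha.2 hQe) (by omega),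
      eq_of_subset_of_card_le (subset_inter hb.2 hQe') (by omega)]
  have hsum : ∀ e ∈ G, 2 * r.choose t - 1 ≤ ∑ Q ∈ powersetCard t e, (3 - d Q) := by
    intro e he
    have hcard : #(powersetCard t e) = r.choose t := by rw [card_powersetCard, hG e he]
    by_cases h : ∃ Q ∈ powersetCard t e, 2 ≤ d Q
    · obtain ⟨Q, hQ, hQ2⟩ := h
      rw [← add_sum_erase _ _ hQ]
      have h1 : #((powersetCard t e).erase Q) * 2 ≤ ∑ Q ∈ (powersetCard t e).erase Q, (3 - d Q) :=
          by
        rw [← smul_eq_mul]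
        refine card_nsmul_le_sum _ _ _ fun Q' hQ' => ?_
        obtain ⟨hne, hQ'⟩ := mem_erase.1 hQ'
        have : ¬ 2 ≤ d Q' := fun h => hne (hone e he Q' hQ' Q hQ h hQ2)
        omega
      have h2 := hd2 Q (mem_powersetCard.1 hQ).2
      rw [card_erase_of_mem hQ, hcard] at h1
      omega
    · push Not at h
      have h1 : #(powersetCard t e) * 2 ≤ ∑ Q ∈ powersetCard t e, (3 - d Q) := by
        rw [← smul_eq_mul]
        refine card_nsmul_le_sum _ _ _ fun Q hQ => ?_
        have := h Q hQ
        omega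
      omega
  have hswap : ∑ e ∈ G, ∑ Q ∈ powersetCard t e, (3 - d Q) =
      ∑ Q ∈ powersetCard t (univ : Finset V), d Q * (3 - d Q) := by
    rw [sum_comm' (t' := powersetCard t (univ : Finset V)) (s' := fun Q => {e ∈ G | Q ⊆ e})]
    · exact sum_congr rfl fun Q _ => by rw [sum_const, smul_eq_mul]
    · intro e Q
      simp only [mem_powersetCard, mem_filter, subset_univ, true_and]
      tauto
  calc #G * (2 * r.choose t - 1) ≤ ∑ e ∈ G, ∑ Q ∈ powersetCard t e, (3 - d Q) :=
        card_nsmul_le_sum _ _ _ hsum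
    _ ≤ #(powersetCard t (univ : Finset V)) * 2 := by
        rw [hswap]
        refine sum_le_card_nsmul _ _ _ fun Q hQ => ?_
        have := hd2 Q (mem_powersetCard.1 hQ).2
        interval_cases d Q <;> norm_num
    _ = 2 * (Fintype.card V).choose t := by
        rw [card_powersetCard, card_univ, mul_comm]

theorem card_exists_lt_inter_le (ht : 1 ≤ t) (htr : t ≤ r) (hG : ∀ e ∈ G, #e = r)
    (hc : ∀ a ∈ G, ∀ b ∈ G, ∀ c ∈ G, a ≠ b → a ≠ c → b ≠ c → ¬ Clash t a b c) :
    #{e ∈ G | ∃ e' ∈ G, e ≠ e' ∧ t < #(e ∩ e')} ≤ 2 * Fintype.card V ^ (t - 1) := by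
  have hT : ∀ e ∈ G, ∃ T ⊆ e, #T = t - 1 := fun e he =>
    exists_subset_card_eq (by rw [hG e he]; omega)
  choose! τ hτ hτc using hT
  have h1 : #{e ∈ G | ∃ e' ∈ G, e ≠ e' ∧ t < #(e ∩ e')} ≤
      2 * #(powersetCard (t - 1) (univ : Finset V)) := by
    refine card_le_mul_card_image_of_maps_to (f := τ) ?_ 2 ?_
    · intro e he
      exact mem_powersetCard.2 ⟨subset_univ _, hτc e (mem_filter.1 he).1⟩
    · intro T _
      by_contra! h
      obtain ⟨a, ha, -⟩ := two_lt_card.1 h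
      obtain ⟨ha', haT⟩ := mem_filter.1 ha
      obtain ⟨haG, b, hb, hab, hlt⟩ := mem_filter.1 ha'
      have h2 : ¬ _ ⊆ ({a, b} : Finset (Finset V)) := fun h' =>
        absurd ((card_le_card h').trans card_le_two) (not_le.2 h)
      obtain ⟨c, hc', hcab⟩ := not_subset.1 h2
      obtain ⟨hc'', hcT⟩ := mem_filter.1 hc'
      have hcG := (mem_filter.1 hc'').1
      simp only [mem_insert, mem_singleton, not_or] at hcab
      refine hc a haG b hb c hcG hab (Ne.symm hcab.1) (Ne.symm hcab.2) ?_
      have h3 : T ⊆ c ∩ (a ∪ b) := subset_inter (hcT ▸ hτ c hcG)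
        ((haT ▸ hτ a haG : T ⊆ a).trans subset_union_left)
      have h4 := card_le_card h3
      have h5 : #T = t - 1 := haT ▸ hτc a haG
      unfold Clash
      omega
  rw [card_powersetCard, card_univ] at h1
  exact h1.trans (Nat.mul_le_mul_left _ (Nat.choose_le_pow _ _))

theorem card_mul_le (ht : 1 ≤ t) (htr : t ≤ r) (hG : ∀ e ∈ G, #e = r)
    (hc : ∀ a ∈ G, ∀ b ∈ G, ∀ c ∈ G, a ≠ b → a ≠ c → b ≠ c → ¬ Clash t a b c) :
    #G * (2 * r.choose t - 1) ≤ 2 * (Fintype.card V).choose t +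
      2 * Fintype.card V ^ (t - 1) * (2 * r.choose t - 1) := by
  have h1 := card_exists_lt_inter_le ht htr hG hc
  have h2 := card_mul_le_of_inter_le (G := {e ∈ G | ¬ ∃ e' ∈ G, e ≠ e' ∧ t < #(e ∩ e')}) (r := r)
    (t := t) (fun e he => hG e (mem_filter.1 he).1)
    (fun a ha b hb c hc' => hc a (mem_filter.1 ha).1 b (mem_filter.1 hb).1 c (mem_filter.1 hc').1)
    (fun a ha b hb hab => by
      by_contra! h
      exact (mem_filter.1 ha).2 ⟨b, (mem_filter.1 hb).1, hab, h⟩)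
  rw [← card_filter_add_card_filter_not (s := G) fun e => ∃ e' ∈ G, e ≠ e' ∧ t < #(e ∩ e'), add_mul,
    add_comm]
  exact add_le_add h2 (Nat.mul_le_mul_right _ h1)

end UpperBound

theorem exNum_div_le {r t n : ℕ} (ht : 1 ≤ t) (htr : t ≤ r) (hn : 0 < n) :
    (exNum r n (3 * r - 2 * t) 3 : ℝ) / (n : ℝ) ^ t ≤
      2 * ((n.choose t : ℝ) / (n : ℝ) ^ t) / (2 * (r.choose t : ℝ) - 1) + 2 / (n : ℝ) := by
  obtain ⟨G, hG, hfree, hcard⟩ := exists_card_eq_exNum r n (3 * r - 2 * t)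
  have h := card_mul_le ht htr hG ((isFree_iff_not_clash htr hG).1 hfree)
  rw [hcard, Fintype.card_fin] at h
  have hr : 1 ≤ r.choose t := Nat.choose_pos htr
  have hc : ((2 * r.choose t - 1 : ℕ) : ℝ) = 2 * (r.choose t : ℝ) - 1 := by
    rw [Nat.cast_sub (by omega)]
    push_cast
    ring
  have hc0 : (0 : ℝ) < 2 * (r.choose t : ℝ) - 1 := by
    have : (1 : ℝ) ≤ r.choose t := by exact_mod_cast hr
    linarith
  have h' : (exNum r n (3 * r - 2 * t) 3 : ℝ) * (2 * (r.choose t : ℝ) - 1) ≤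
      2 * (n.choose t : ℝ) + 2 * (n : ℝ) ^ (t - 1) * (2 * (r.choose t : ℝ) - 1) := by
    rw [← hc]
    exact_mod_cast h
  have hn0 : (0 : ℝ) < n := by exact_mod_cast hn
  have hpow : (n : ℝ) ^ t = (n : ℝ) ^ (t - 1) * n := by
    rw [← pow_succ]
    congr 1
    omega
  rw [div_le_iff₀ (by positivity), ← mul_le_mul_iff_left₀ hc0]
  refine h'.trans (le_of_eq ?_)
  rw [hpow]
  field_simp

/-- For all `2 ≤ t < r`, the limit of `n⁻ᵗ f⁽ʳ⁾(n; 3r-2t, 3)` exists and equals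
`2 / (t! (2 C(r,t) - 1))`. -/
theorem bes_k_eq_3 (r t : ℕ) (ht : 2 ≤ t) (htr : t < r) :
    Tendsto (fun n : ℕ => (exNum r n (3 * r - 2 * t) 3 : ℝ) / (n : ℝ) ^ t) atTop
      (nhds (2 / ((t.factorial : ℝ) * (2 * (r.choose t : ℝ) - 1)))) := by
  rw [tendsto_order]
  refine ⟨fun a ha => eventually_lt_exNum_div ht htr ha, fun a ha => ?_⟩
  have h1 := (((tendsto_choose_div_pow t).const_mul 2).div_const
    (2 * (r.choose t : ℝ) - 1)).add (tendsto_const_div_atTop_nhds_zero_nat (2 : ℝ))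
  rw [add_zero, mul_one_div, div_div] at h1
  filter_upwards [h1.eventually (gt_mem_nhds ha), eventually_gt_atTop 0] with n hn hn0
  exact (exNum_div_le (by omega) htr.le hn0).trans_lt hn
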